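/- arXiv:1803.02056 — 2 statements merged into one kernel-verified Lean document; each statement's English description precedes it below -/
import Mathlib

section
/- There is at most one fundamental discriminant D < 0 with |D| ≥ d_58, where d_58 is the product of the first 58 prime numbers (one has d_58 ≤ 3.17·10^110), such that the exponent E(D) of the class group Cl(D) of ℚ(√D) equals 8. -/
open NumberField

/-- `D` is a fundamental discriminant: either `D ≡ 1 (mod 4)` and `D` is squarefree,
or `D = 4m` for a squarefree integer `m ≡ 2` or `3 (mod 4)`. (We exclude the degenerate
case `D = 1`, so that `D` is the discriminant of a quadratic number field.) -/
def IsFundamentalDiscriminant (D : ℤ) : Prop :=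
  D ≠ 1 ∧ ((D % 4 = 1 ∧ Squarefree D) ∨
    ∃ m : ℤ, D = 4 * m ∧ Squarefree m ∧ (m % 4 = 2 ∨ m % 4 = 3))

/-- `d n`: the product of the first `n` prime numbers. -/
noncomputable def primesProd (n : ℕ) : ℕ := ∏ i ∈ Finset.range n, Nat.nth Nat.Prime i

section PartialSumTransform

open MeasureTheory Set Filter Topology

/-- The integral `∫_1^∞ A(t) t^(-s-1) dt`. -/
noncomputable def tailTransform (A : ℝ → ℝ) (s : ℂ) : ℂ :=
  ∫ t in Ioi (1 : ℝ), (A t : ℂ) * (t : ℂ) ^ (-(s + 1))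

theorem tailTransform_eq_mellin (A : ℝ → ℝ) (s : ℂ) :
    tailTransform A s = mellin ((Ioi (1 : ℝ)).indicator fun t ↦ (A t : ℂ)) (-s) := by
  have h : ∀ t : ℝ, (t : ℂ) ^ (-s - 1) • (Ioi (1 : ℝ)).indicator (fun t ↦ (A t : ℂ)) t =
      (Ioi (1 : ℝ)).indicator (fun t ↦ (A t : ℂ) * (t : ℂ) ^ (-(s + 1))) t := by
    intro t
    by_cases ht : t ∈ Ioi (1 : ℝ)
    · simp only [indicator_of_mem ht, smul_eq_mul]
      rw [mul_comm, neg_add']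
    · simp [indicator_of_notMem ht]
  rw [mellin, tailTransform]
  simp_rw [h]
  rw [setIntegral_indicator measurableSet_Ioi,
    inter_eq_self_of_subset_right (Ioi_subset_Ioi zero_le_one)]

theorem tailTransform_differentiableAt {A : ℝ → ℝ} (hA : Measurable A) {C : ℝ}
    (hC : ∀ t, 1 < t → |A t| ≤ C) {s : ℂ} (hs : 0 < s.re) :
    DifferentiableAt ℂ (tailTransform A) s := by
  set f : ℝ → ℂ := (Ioi (1 : ℝ)).indicator fun t ↦ (A t : ℂ) with hf
  have hC0 : 0 ≤ C := (abs_nonneg _).trans (hC 2 one_lt_two)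
  have hbd : ∀ t, ‖f t‖ ≤ C := by
    intro t
    by_cases ht : t ∈ Ioi (1 : ℝ)
    · simpa [hf, indicator_of_mem ht] using hC t ht
    · simpa [hf, indicator_of_notMem ht] using hC0
  have hmeas : Measurable f := (Complex.measurable_ofReal.comp hA).indicator measurableSet_Ioi
  have hloc : LocallyIntegrableOn f (Ioi 0) := by
    apply LocallyIntegrable.locallyIntegrableOn
    have : LocallyIntegrable (fun _ : ℝ ↦ C) := locallyIntegrable_const C
    refine this.mono hmeas.aestronglyMeasurable (Eventually.of_forall fun t ↦ ?_)
    simpa [abs_of_nonneg hC0] using hbd t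
  have htop : f =O[atTop] (· ^ (-(0 : ℝ)) : ℝ → ℝ) := by
    refine Asymptotics.IsBigO.of_bound C (Eventually.of_forall fun t ↦ ?_)
    simpa using hbd t
  have hbot : f =O[𝓝[>] 0] (· ^ (-(-s.re - 1)) : ℝ → ℝ) := by
    refine Asymptotics.IsBigO.of_bound 0 ?_
    have : Ioo (0 : ℝ) 1 ∈ 𝓝[>] (0 : ℝ) := Ioo_mem_nhdsGT one_pos
    filter_upwards [this] with t ht
    have : t ∉ Ioi (1 : ℝ) := by simpa using ht.2.le
    simp [hf, indicator_of_notMem this]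
  have key : DifferentiableAt ℂ (mellin f) (-s) :=
    mellin_differentiableAt_of_isBigO_rpow hloc htop (by simpa using hs) hbot
      (by simp)
  have heq : tailTransform A = fun s ↦ mellin f (-s) := funext fun s ↦ tailTransform_eq_mellin A s
  rw [heq]
  exact key.comp s differentiableAt_id.neg

/-- The integral `∫_1^∞ min(t, q) t^(-σ-1) dt`. -/
noncomputable def minTransform (q σ : ℝ) : ℝ :=
  ∫ t in Ioi (1 : ℝ), min t q * t ^ (-(σ + 1))

theorem integrableOn_min_mul_rpow (q : ℝ) {σ : ℝ} (hσ : 0 < σ) (hq : 0 ≤ q) :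
    IntegrableOn (fun t : ℝ ↦ min t q * t ^ (-(σ + 1))) (Ioi 1) := by
  have h1 : IntegrableOn (fun t : ℝ ↦ q * t ^ (-(σ + 1))) (Ioi 1) :=
    (integrableOn_Ioi_rpow_of_lt (by linarith) one_pos).const_mul q
  refine h1.mono' (by fun_prop) ?_
  filter_upwards [ae_restrict_mem measurableSet_Ioi] with t ht
  have ht0 : (0 : ℝ) < t := one_pos.trans ht
  rw [Real.norm_eq_abs, abs_of_nonneg (by positivity)]
  gcongr
  exact min_le_right _ _

theorem minTransform_eq_add {q σ : ℝ} (hq : 1 ≤ q) (hσ : 0 < σ) :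
    minTransform q σ = (∫ t in (1 : ℝ)..q, t ^ (-σ)) + q ^ (1 - σ) / σ := by
  have hint := integrableOn_min_mul_rpow q hσ (zero_le_one.trans hq)
  have hq0 : 0 < q := one_pos.trans_le hq
  rw [minTransform, ← Ioc_union_Ioi_eq_Ioi hq, setIntegral_union (Ioc_disjoint_Ioi le_rfl)
    measurableSet_Ioi (hint.mono_set Ioc_subset_Ioi_self)
    (hint.mono_set (Ioi_subset_Ioi hq)), intervalIntegral.integral_of_le hq]
  congr 1
  · refine setIntegral_congr_fun measurableSet_Ioc fun t ht ↦ ?_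
    have ht0 : 0 < t := one_pos.trans ht.1
    simp only [min_eq_left ht.2]
    nth_rewrite 1 [← Real.rpow_one t]
    rw [← Real.rpow_add ht0]
    ring_nf
  · have : ∀ t ∈ Ioi q, min t q * t ^ (-(σ + 1)) = q * t ^ (-(σ + 1)) := fun t ht ↦ by
      rw [min_eq_right (le_of_lt ht)]
    rw [setIntegral_congr_fun measurableSet_Ioi this, integral_const_mul,
      integral_Ioi_rpow_of_lt (by linarith) hq0]
    have h2 : q ^ (1 - σ) = q * q ^ (-σ) := by
      nth_rewrite 2 [← Real.rpow_one q]
      rw [← Real.rpow_add hq0]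
      ring_nf
    rw [h2, show -(σ + 1) + 1 = -σ by ring]
    field_simp

theorem minTransform_eq {q σ : ℝ} (hq : 1 ≤ q) (hσ : 0 < σ) (hσ1 : σ ≠ 1) :
    minTransform q σ = (q ^ (1 - σ) - 1) / (1 - σ) + q ^ (1 - σ) / σ := by
  have h0 : (0 : ℝ) ∉ uIcc 1 q := by
    rw [uIcc_of_le hq]
    exact fun h ↦ absurd h.1 (by norm_num)
  rw [minTransform_eq_add hq hσ, integral_rpow (Or.inr ⟨by contrapose! hσ1; linarith, h0⟩)]
  simp [show -σ + 1 = 1 - σ by ring]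

theorem minTransform_one {q : ℝ} (hq : 1 ≤ q) : minTransform q 1 = Real.log q + 1 := by
  have h0 : (0 : ℝ) ∉ uIcc 1 q := by
    rw [uIcc_of_le hq]
    exact fun h ↦ absurd h.1 (by norm_num)
  rw [minTransform_eq_add hq one_pos]
  simp_rw [Real.rpow_neg_one]
  rw [integral_inv h0]
  simp

theorem minTransform_anti {q σ τ : ℝ} (hq : 0 ≤ q) (hσ : 0 < σ) (h : σ ≤ τ) :
    minTransform q τ ≤ minTransform q σ := by
  refine setIntegral_mono_on (integrableOn_min_mul_rpow q (hσ.trans_le h) hq)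
    (integrableOn_min_mul_rpow q hσ hq) measurableSet_Ioi fun t ht ↦ ?_
  have ht1 : 1 ≤ t := le_of_lt ht
  gcongr

theorem norm_tailTransform_le {A : ℝ → ℝ} {q σ : ℝ} (hq : 0 ≤ q)
    (hAq : ∀ t, 1 < t → |A t| ≤ min t q) (hσ : 0 < σ) {s : ℂ} (hs : σ ≤ s.re) :
    ‖tailTransform A s‖ ≤ minTransform q σ := by
  refine (norm_integral_le_of_norm_le (integrableOn_min_mul_rpow q (hσ.trans_le hs) hq) ?_).trans
    (minTransform_anti hq hσ hs)
  filter_upwards [ae_restrict_mem measurableSet_Ioi] with t ht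
  have ht0 : (0 : ℝ) < t := one_pos.trans ht
  rw [norm_mul, Complex.norm_real, Real.norm_eq_abs, Complex.norm_cpow_eq_rpow_re_of_pos ht0]
  simp only [Complex.neg_re, Complex.add_re, Complex.one_re]
  gcongr
  exact hAq t ht

theorem minTransform_le {q r : ℝ} (hq : 1 ≤ q) (hr : 0 < r) (hr1 : r < 1) :
    minTransform q (1 - r) ≤ q ^ r / (r * (1 - r)) := by
  rw [minTransform_eq hq (by linarith) (by linarith), show 1 - (1 - r) = r by ring]
  have : 0 < 1 - r := by linarith
  rw [div_add_div _ _ hr.ne' this.ne']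
  gcongr
  nlinarith

theorem ofReal_tailTransform (A : ℝ → ℝ) (x : ℝ) :
    tailTransform A x = ((∫ t in Ioi (1 : ℝ), A t * t ^ (-(x + 1)) : ℝ) : ℂ) := by
  rw [tailTransform, ← integral_complex_ofReal]
  refine setIntegral_congr_fun measurableSet_Ioi fun t ht ↦ ?_
  have ht0 : (0 : ℝ) < t := one_pos.trans ht
  rw [Complex.ofReal_mul, Complex.ofReal_cpow ht0.le]
  push_cast
  rfl

/-- If `∫_1^∞ A(t) t^(-x-1) dt` vanishes at `x = 1 - d`, it is small at `1`. -/
theorem abs_integral_le_of_eq_zero {A : ℝ → ℝ} (hA : Measurable A) {q d : ℝ} (hq : 1 ≤ q)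
    (hAq : ∀ t, 1 < t → |A t| ≤ min t q) (hd : 0 < d) (hd1 : d < 1)
    (h0 : ∫ t in Ioi (1 : ℝ), A t * t ^ (-((1 - d) + 1)) = 0) :
    |∫ t in Ioi (1 : ℝ), A t * t ^ (-((1 : ℝ) + 1))| ≤
      minTransform q (1 - d) - minTransform q 1 := by
  have hq0 : 0 ≤ q := zero_le_one.trans hq
  have i1 := integrableOn_min_mul_rpow q (σ := 1 - d) (by linarith) hq0
  have i2 := integrableOn_min_mul_rpow q one_pos hq0
  have hAi : ∀ σ : ℝ, 0 < σ → IntegrableOn (fun t : ℝ ↦ A t * t ^ (-(σ + 1))) (Ioi 1) := by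
    intro σ hσ
    refine (integrableOn_min_mul_rpow q hσ hq0).mono' (by fun_prop) ?_
    filter_upwards [ae_restrict_mem measurableSet_Ioi] with t ht
    have ht0 : (0 : ℝ) < t := one_pos.trans ht
    rw [norm_mul, Real.norm_eq_abs, Real.norm_eq_abs, abs_of_nonneg (Real.rpow_nonneg ht0.le _)]
    gcongr
    exact hAq t ht
  rw [← sub_zero (∫ t in Ioi (1 : ℝ), A t * t ^ (-((1 : ℝ) + 1))), ← h0,
    ← integral_sub (hAi 1 one_pos) (hAi (1 - d) (by linarith)), minTransform, minTransform,
    ← integral_sub i1 i2, ← Real.norm_eq_abs]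
  refine norm_integral_le_of_norm_le (i1.sub i2) ?_
  filter_upwards [ae_restrict_mem measurableSet_Ioi] with t ht
  have ht0 : (0 : ℝ) < t := one_pos.trans ht
  have ht1 : 1 ≤ t := le_of_lt ht
  rw [← mul_sub, ← mul_sub, norm_mul, Real.norm_eq_abs, Real.norm_eq_abs, abs_sub_comm,
    abs_of_nonneg (sub_nonneg.2 (Real.rpow_le_rpow_of_exponent_le ht1 (by linarith)))]
  exact mul_le_mul_of_nonneg_right (hAq t ht)
    (sub_nonneg.2 (Real.rpow_le_rpow_of_exponent_le ht1 (by linarith)))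

theorem minTransform_sub_le {q d : ℝ} (hq : 1 ≤ q) (hd : 0 < d) (hd1 : d < 1) :
    minTransform q (1 - d) - minTransform q 1 ≤
      d * (Real.log q ^ 2 * q ^ d + (Real.log q * q ^ d + 1) / (1 - d)) := by
  have hq0 : 0 < q := one_pos.trans_le hq
  have h1d : 0 < 1 - d := by linarith
  rw [minTransform_eq hq h1d (by linarith), minTransform_one hq, show 1 - (1 - d) = d by ring]
  set l := Real.log q
  have hl : 0 ≤ l := Real.log_nonneg hq
  set e := q ^ d
  have he : e = Real.exp (l * d) := Real.rpow_def_of_pos hq0 d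
  have he1 : e - 1 ≤ d * l * e := by
    have h := Real.add_one_le_exp (-(l * d))
    rw [Real.exp_neg, ← he] at h
    have he0 : 0 < e := he ▸ Real.exp_pos _
    have := mul_le_mul_of_nonneg_right h he0.le
    rw [inv_mul_cancel₀ he0.ne'] at this
    nlinarith
  have h1 : (e - 1) / d - l ≤ d * (l ^ 2 * e) := by
    rw [sub_le_iff_le_add, div_le_iff₀ hd]
    nlinarith [mul_le_mul_of_nonneg_left he1 (mul_nonneg hd.le hl)]
  have h2 : e / (1 - d) - 1 ≤ d * ((l * e + 1) / (1 - d)) := by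
    rw [← mul_div_assoc, sub_le_iff_le_add, div_le_iff₀ h1d, add_mul, div_mul_cancel₀ _ h1d.ne']
    nlinarith
  linarith

end PartialSumTransform

section QuadraticCharacter

open MeasureTheory Set Filter Topology Finset

/-- A completely multiplicative function with values in `{-1, 0, 1}` whose partial sums are
bounded by `q`. -/
structure IsQuadraticCharacter (f : ℕ → ℤ) (q : ℝ) : Prop where
  one_le : 1 ≤ q
  map_zero : f 0 = 0
  map_one : f 1 = 1
  map_mul : ∀ m n, f (m * n) = f m * f n
  abs_le : ∀ n, |f n| ≤ 1
  abs_sum_le : ∀ n, |((∑ k ∈ Finset.Icc 1 n, f k : ℤ) : ℝ)| ≤ q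

/-- The summatory function `t ↦ ∑_{1 ≤ k ≤ t} f k`. -/
noncomputable def summatory (f : ℕ → ℤ) (t : ℝ) : ℝ := ((∑ k ∈ Finset.Icc 1 ⌊t⌋₊, f k : ℤ) : ℝ)

/-- The analytic continuation of `∑ f(n) n^(-s)` to the half plane `0 < re s`, for `f` with
bounded partial sums. -/
noncomputable def charL (f : ℕ → ℤ) (s : ℂ) : ℂ := s * tailTransform (summatory f) s

/-- The restriction of `charL f` to the real axis. -/
noncomputable def charLReal (f : ℕ → ℤ) (x : ℝ) : ℝ :=
  x * ∫ t in Ioi (1 : ℝ), summatory f t * t ^ (-(x + 1))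

theorem ofReal_charLReal (f : ℕ → ℤ) (x : ℝ) : (charLReal f x : ℂ) = charL f x := by
  rw [charL, ofReal_tailTransform, charLReal]
  push_cast
  rfl

theorem measurable_summatory (f : ℕ → ℤ) : Measurable (summatory f) :=
  (measurable_from_nat (f := fun n ↦ ((∑ k ∈ Finset.Icc 1 n, f k : ℤ) : ℝ))).comp
    Nat.measurable_floor

theorem abs_sum_Icc_le {f : ℕ → ℤ} (hf : ∀ n, |f n| ≤ 1) (n : ℕ) :
    |∑ k ∈ Finset.Icc 1 n, f k| ≤ n := by
  refine (Finset.abs_sum_le_sum_abs _ _).trans ((Finset.sum_le_card_nsmul _ _ 1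
    fun k _ ↦ hf k).trans ?_)
  simp

theorem LSeries_eq_mul_tailTransform {f : ℕ → ℤ} (hf : ∀ n, |f n| ≤ 1) {s : ℂ} (hs : 1 < s.re) :
    LSeries (fun n ↦ (f n : ℂ)) s = charL f s := by
  have hO : (fun n : ℕ ↦ ∑ k ∈ Finset.Icc 1 n, ‖((f k : ℤ) : ℂ)‖) =O[atTop]
      fun n ↦ (n : ℝ) ^ (1 : ℝ) := by
    refine Asymptotics.IsBigO.of_bound 1 (Eventually.of_forall fun n ↦ ?_)
    have h1 : ∑ k ∈ Finset.Icc 1 n, ‖((f k : ℤ) : ℂ)‖ ≤ n := by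
      refine (Finset.sum_le_card_nsmul _ _ 1 fun k _ ↦ ?_).trans (by simp)
      rw [Complex.norm_intCast]
      exact_mod_cast hf k
    rw [Real.norm_eq_abs, abs_of_nonneg (by positivity)]
    simpa using h1
  rw [LSeries_eq_mul_integral' _ zero_le_one hs hO, charL, tailTransform]
  congr 2
  ext t
  simp [summatory]

namespace IsQuadraticCharacter

variable {f : ℕ → ℤ} {q : ℝ}

theorem abs_summatory_le (hf : IsQuadraticCharacter f q) (t : ℝ) (ht : 1 < t) :
    |summatory f t| ≤ min t q := by
  refine le_min ?_ (hf.abs_sum_le _)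
  have h := abs_sum_Icc_le hf.abs_le ⌊t⌋₊
  calc |summatory f t| = ((|∑ k ∈ Finset.Icc 1 ⌊t⌋₊, f k| : ℤ) : ℝ) := by
        rw [summatory]; push_cast; rfl
    _ ≤ ((⌊t⌋₊ : ℤ) : ℝ) := by exact_mod_cast h
    _ ≤ t := by
        push_cast
        exact Nat.floor_le (by linarith)

theorem differentiableAt_charL (hf : IsQuadraticCharacter f q) {s : ℂ} (hs : 0 < s.re) :
    DifferentiableAt ℂ (charL f) s :=
  differentiableAt_id.mul (tailTransform_differentiableAt (measurable_summatory f)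
    (fun t ht ↦ (hf.abs_summatory_le t ht).trans (min_le_right _ _)) hs)

theorem LSeries_eq (hf : IsQuadraticCharacter f q) {s : ℂ} (hs : 1 < s.re) :
    LSeries (fun n ↦ (f n : ℂ)) s = charL f s :=
  LSeries_eq_mul_tailTransform hf.abs_le hs

theorem norm_charL_le (hf : IsQuadraticCharacter f q) {r : ℝ} (hr : 0 < r) (hr1 : r < 1) {s : ℂ}
    (hs : 1 - r ≤ s.re) : ‖charL f s‖ ≤ ‖s‖ * (q ^ r / (r * (1 - r))) := by
  rw [charL, norm_mul]
  gcongr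
  exact (norm_tailTransform_le (zero_le_one.trans hf.one_le) hf.abs_summatory_le
    (by linarith) hs).trans (minTransform_le hf.one_le hr hr1)

theorem abs_charLReal_one_le (hf : IsQuadraticCharacter f q) :
    |charLReal f 1| ≤ Real.log q + 1 := by
  have h := norm_tailTransform_le (zero_le_one.trans hf.one_le) hf.abs_summatory_le one_pos
    (s := 1) (by simp)
  rw [minTransform_one hf.one_le] at h
  have h2 : ((charLReal f 1 : ℝ) : ℂ) = tailTransform (summatory f) 1 := by
    rw [ofReal_charLReal, charL]
    simp
  rw [← h2, Complex.norm_real] at h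
  exact h

theorem continuousOn_charLReal (hf : IsQuadraticCharacter f q) :
    ContinuousOn (charLReal f) (Ioi 0) := by
  intro x hx
  have h1 : ContinuousAt (fun y : ℝ ↦ (charL f y).re) x :=
    Complex.continuous_re.continuousAt.comp
      ((hf.differentiableAt_charL (s := (x : ℂ)) (by simpa using hx)).continuousAt.comp
        Complex.continuous_ofReal.continuousAt)
  have h2 : (fun y : ℝ ↦ (charL f y).re) = charLReal f := by
    ext y
    rw [← ofReal_charLReal, Complex.ofReal_re]
  rw [h2] at h1
  exact h1.continuousWithinAt

theorem abs_charLReal_one_le_of_eq_zero (hf : IsQuadraticCharacter f q) {d : ℝ} (hd : 0 < d)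
    (hd1 : d < 1) (h0 : charLReal f (1 - d) = 0) :
    |charLReal f 1| ≤ d * (Real.log q ^ 2 * q ^ d + (Real.log q * q ^ d + 1) / (1 - d)) := by
  rw [charLReal, mul_eq_zero, or_iff_right (by linarith)] at h0
  rw [charLReal, one_mul]
  exact (abs_integral_le_of_eq_zero (measurable_summatory f) hf.one_le hf.abs_summatory_le
    hd hd1 h0).trans (minTransform_sub_le hf.one_le hd hd1)

end IsQuadraticCharacter

/-- The regular part `ζ(s) - 1 / (s - 1)` of the Riemann zeta function on `0 < re s`. -/
noncomputable def zetaReg (s : ℂ) : ℂ := 1 - s * tailTransform Int.fract s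

theorem abs_fract_le (t : ℝ) (ht : 1 < t) : |Int.fract t| ≤ min t 1 := by
  rw [min_eq_right ht.le, Int.abs_fract]
  exact (Int.fract_lt_one t).le

theorem differentiableAt_zetaReg {s : ℂ} (hs : 0 < s.re) : DifferentiableAt ℂ zetaReg s :=
  (differentiableAt_const _).sub (differentiableAt_id.mul (tailTransform_differentiableAt
    measurable_fract (fun t ht ↦ (abs_fract_le t ht).trans (min_le_right _ _)) hs))

theorem norm_zetaReg_le {r : ℝ} (hr : 0 < r) (hr1 : r < 1) {s : ℂ} (hs : 1 - r ≤ s.re) :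
    ‖zetaReg s‖ ≤ 1 + ‖s‖ / (1 - r) := by
  have h := norm_tailTransform_le zero_le_one abs_fract_le (by linarith) hs
  rw [minTransform_eq le_rfl (by linarith) (by linarith)] at h
  simp only [Real.one_rpow, sub_self, zero_div, zero_add] at h
  refine (norm_sub_le _ _).trans ?_
  rw [norm_one, norm_mul, div_eq_mul_one_div ‖s‖]
  gcongr

/-- For `0 < x < 1` the continued Riemann zeta function is negative. -/
theorem exists_zetaReg_ofReal {x : ℝ} (hx : 0 < x) (hx1 : x < 1) :
    ∃ z : ℝ, z < 0 ∧ 1 / ((x : ℂ) - 1) + zetaReg x = z := by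
  refine ⟨1 / (x - 1) + (1 - x * ∫ t in Ioi (1 : ℝ), Int.fract t * t ^ (-(x + 1))), ?_, ?_⟩
  · have h : 0 ≤ ∫ t in Ioi (1 : ℝ), Int.fract t * t ^ (-(x + 1)) :=
      setIntegral_nonneg measurableSet_Ioi fun t ht ↦
        mul_nonneg (Int.fract_nonneg t) (Real.rpow_nonneg (one_pos.trans ht).le _)
    have h2 : 1 / (x - 1) + 1 < 0 := by
      have : x - 1 < 0 := by linarith
      rw [div_add_one this.ne]
      exact div_neg_of_pos_of_neg (by linarith) this
    nlinarith [mul_nonneg hx.le h]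
  · rw [zetaReg, ofReal_tailTransform]
    push_cast
    rfl

theorem LSeries_one_eq_add {s : ℂ} (hs : 1 < s.re) :
    LSeries 1 s = 1 / (s - 1) + zetaReg s := by
  have h1 := LSeries_eq_mul_tailTransform (f := fun _ ↦ 1) (by simp) hs
  have h2 : LSeries (fun _ ↦ ((1 : ℤ) : ℂ)) s = LSeries 1 s := by
    congr 1; ext; simp
  have hs0 : s ≠ 0 := by rintro rfl; simp at hs; linarith
  have hs1 : s - 1 ≠ 0 := by
    intro h; rw [sub_eq_zero.1 h] at hs; simp at hs
  rw [← h2, h1, charL, zetaReg]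
  have hi1 : IntegrableOn (fun t : ℝ ↦ (t : ℂ) ^ (-s)) (Ioi 1) :=
    integrableOn_Ioi_cpow_of_lt (by simpa using hs) one_pos
  have hi2 : IntegrableOn (fun t : ℝ ↦ ((Int.fract t : ℝ) : ℂ) * (t : ℂ) ^ (-(s + 1))) (Ioi 1) := by
    refine (integrableOn_Ioi_rpow_of_lt (a := -(s.re + 1)) (by linarith) one_pos).mono'
      (by
        refine AEStronglyMeasurable.mul (by fun_prop) ?_
        exact (Complex.measurable_ofReal.pow_const _).aestronglyMeasurable) ?_
    filter_upwards [ae_restrict_mem measurableSet_Ioi] with t ht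
    have ht0 : (0 : ℝ) < t := one_pos.trans ht
    rw [norm_mul, Complex.norm_real, Real.norm_eq_abs, Complex.norm_cpow_eq_rpow_re_of_pos ht0]
    simp only [Complex.neg_re, Complex.add_re, Complex.one_re]
    exact mul_le_of_le_one_left (Real.rpow_nonneg ht0.le _)
      ((abs_fract_le t ht).trans (min_le_right _ _))
  have h3 : tailTransform (summatory fun _ ↦ 1) s = 1 / (s - 1) - tailTransform Int.fract s := by
    have h4 : ∫ t in Ioi (1 : ℝ), (t : ℂ) ^ (-s) = 1 / (s - 1) := by
      rw [integral_Ioi_cpow_of_lt (by simpa using hs) one_pos]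
      simp only [Complex.ofReal_one, Complex.one_cpow]
      rw [show -s + 1 = -(s - 1) by ring, neg_div_neg_eq]
    rw [← h4, tailTransform, tailTransform, ← integral_sub hi1 hi2]
    refine setIntegral_congr_fun measurableSet_Ioi fun t ht ↦ ?_
    have ht0 : (0 : ℝ) < t := one_pos.trans ht
    have hfl : summatory (fun _ ↦ 1) t = t - Int.fract t := by
      rw [Int.self_sub_fract, summatory]
      simp only [Finset.sum_const, Nat.card_Icc, add_tsub_cancel_right, nsmul_eq_mul, mul_one]
      exact_mod_cast Int.natCast_floor_eq_floor ht0.le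
    have hp : (t : ℂ) ^ (-s) = t * (t : ℂ) ^ (-(s + 1)) := by
      have ht' : (t : ℂ) ≠ 0 := by exact_mod_cast ht0.ne'
      nth_rewrite 2 [← Complex.cpow_one (t : ℂ)]
      rw [← Complex.cpow_add _ _ ht']
      ring_nf
    simp only [hfl, hp]
    push_cast
    ring
  rw [h3]
  field_simp
  ring

end QuadraticCharacter

section TaylorLowerBound

open Filter Topology Metric LSeries
open scoped ComplexOrder Nat

theorem iteratedDeriv_div_sub_one (lam : ℂ) (n : ℕ) (x : ℂ) :
    iteratedDeriv n (fun s ↦ lam / (s - 1)) x =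
      lam * ((-1) ^ n * n ! * (x - 1) ^ (-1 - n : ℤ)) := by
  have h : (fun s : ℂ ↦ lam / (s - 1)) = fun s ↦ lam * (fun z : ℂ ↦ z⁻¹) (s - 1) := by
    ext s
    rw [div_eq_mul_inv]
  rw [h, iteratedDeriv_const_mul_field, iteratedDeriv_comp_sub_const]
  rw [iteratedDeriv_eq_iterate]
  exact congrArg (lam * ·) (iter_deriv_inv n (x - 1))

/-- A Dirichlet series with nonnegative coefficients is at least its first coefficient. -/
theorem one_le_LSeries_re {c : ℕ → ℂ} (hc : 0 ≤ c) (hc1 : c 1 = 1) {x : ℝ}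
    (hx : abscissaOfAbsConv c < x) : 1 ≤ (LSeries c x).re := by
  have hs : LSeriesSummable c x := LSeriesSummable_of_abscissaOfAbsConv_lt_re (by simpa using hx)
  have hnn : ∀ n, 0 ≤ (term c x n).re := fun n ↦
    (Complex.le_def.1 (term_nonneg (hc n) x)).1
  have h1 : (LSeries c x).re = ∑' n, (term c x n).re := Complex.re_tsum hs
  have h2 : (term c x 1).re = 1 := by simp [term_of_ne_zero, hc1]
  rw [h1, ← h2]
  exact (Complex.hasSum_re hs.hasSum).summable.le_tsum 1 fun n _ ↦ hnn n


theorem iteratedDeriv_sub_pole {c : ℕ → ℂ} {lam : ℂ} {a : ℝ} (ha : 0 < a)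
    (habs : abscissaOfAbsConv c ≤ 1) {G : ℂ → ℂ}
    (hGc : ∀ s : ℂ, 1 < s.re → G s = LSeries c s - lam / (s - 1)) (n : ℕ) :
    iteratedDeriv n G ((1 + a : ℝ) : ℂ) = iteratedDeriv n (LSeries c) ((1 + a : ℝ) : ℂ) -
      lam * ((-1) ^ n * n ! * (a : ℂ) ^ (-1 - n : ℤ)) := by
  set σ : ℂ := ((1 + a : ℝ) : ℂ) with hσ
  have hre : σ.re = 1 + a := Complex.ofReal_re _
  have hev : G =ᶠ[𝓝 σ] LSeries c - fun s ↦ lam / (s - 1) := by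
    have : {s : ℂ | 1 < s.re} ∈ 𝓝 σ :=
      (isOpen_lt continuous_const Complex.continuous_re).mem_nhds (by
        simp only [Set.mem_ofPred_eq, hre]; linarith)
    filter_upwards [this] with s hs using hGc s hs
  have hlt : abscissaOfAbsConv c < σ.re := by
    refine habs.trans_lt ?_
    rw [hre]
    exact_mod_cast (by linarith : (1 : ℝ) < 1 + a)
  have hs1 : σ - 1 = a := by rw [hσ]; push_cast; ring
  have hne : σ - 1 ≠ 0 := by rw [hs1]; exact_mod_cast ha.ne'
  have h1 : ContDiffAt ℂ n (LSeries c) σ := (LSeries_analyticOnNhd c σ hlt).contDiffAt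
  have h2 : ContDiffAt ℂ n (fun s ↦ lam / (s - 1)) σ :=
    contDiffAt_const.div (contDiffAt_id.sub contDiffAt_const) hne
  rw [hev.iteratedDeriv_eq, iteratedDeriv_sub h1 h2, iteratedDeriv_div_sub_one, hs1]

/-- Lower bound, from its Taylor expansion at `1 + a`, for the regular part `G` of a function with
a simple pole at `1` that is given by a Dirichlet series with nonnegative coefficients. -/
theorem re_ge_of_nonneg_coeff {c : ℕ → ℂ} (hc : 0 ≤ c) (hc1 : c 1 = 1) {lam a r B d : ℝ}
    (ha : 0 < a) (habs : abscissaOfAbsConv c ≤ 1) {G : ℂ → ℂ}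
    (hG : ∀ s ∈ closedBall ((1 + a : ℝ) : ℂ) (a + r), DifferentiableAt ℂ G s)
    (hGc : ∀ s : ℂ, 1 < s.re → G s = LSeries c s - lam / (s - 1))
    (hB : ∀ s ∈ sphere ((1 + a : ℝ) : ℂ) (a + r), ‖G s‖ ≤ B) (hd : 0 < d) (hdr : d < r)
    {M : ℕ} (hM : 0 < M) :
    1 - lam * ((1 + d / a) ^ M - 1) / d -
      B * ((a + d) / (a + r)) ^ M / (1 - (a + d) / (a + r)) ≤ (G ((1 - d : ℝ) : ℂ)).re := by
  set σ : ℂ := ((1 + a : ℝ) : ℂ) with hσ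
  set R := a + r
  have hR : 0 < R := by linarith
  set ρ := (a + d) / R
  have hρ0 : 0 ≤ ρ := by positivity
  have hρ1 : ρ < 1 := by rw [div_lt_one hR]; linarith
  set z : ℂ := ((1 - d : ℝ) : ℂ) with hz
  have hzσ : z - σ = ((-(a + d) : ℝ) : ℂ) := by rw [hz, hσ]; push_cast; ring
  have hnz : ‖z - σ‖ = a + d := by
    rw [hzσ, Complex.norm_real, Real.norm_eq_abs, abs_neg, abs_of_pos (by linarith)]
  have hdiff : DifferentiableOn ℂ G (ball σ R) := fun s hs ↦
    (hG s (ball_subset_closedBall hs)).differentiableWithinAt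
  have hzmem : z ∈ ball σ R := by
    rw [mem_ball, dist_eq_norm, hnz]
    linarith
  have hsum := Complex.hasSum_taylorSeries_on_ball hdiff hzmem
  set u : ℕ → ℂ := fun n ↦ (n ! : ℂ)⁻¹ • (z - σ) ^ n • iteratedDeriv n G σ with hu
  have hcl : DiffContOnCl ℂ G (ball σ R) := by
    refine ⟨hdiff, ?_⟩
    rw [closure_ball σ hR.ne']
    exact fun s hs ↦ (hG s hs).continuousAt.continuousWithinAt
  have hunorm : ∀ n, ‖u n‖ ≤ B * ρ ^ n := by
    intro n
    have h := Complex.norm_iteratedDeriv_le_of_forall_mem_sphere_norm_le n hR hcl hB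
    have hf : (0 : ℝ) < n ! := by exact_mod_cast n.factorial_pos
    rw [hu]
    simp only [norm_smul, norm_inv, norm_pow, hnz, Complex.norm_natCast]
    calc ((n ! : ℝ))⁻¹ * ((a + d) ^ n * ‖iteratedDeriv n G σ‖)
        ≤ ((n ! : ℝ))⁻¹ * ((a + d) ^ n * (n ! * B / R ^ n)) := by gcongr
      _ = B * ρ ^ n := by
        simp only [ρ, div_pow]
        field_simp
  have htail : ‖∑' n, u (n + M)‖ ≤ B * ρ ^ M / (1 - ρ) := by
    have hg : HasSum (fun n ↦ B * ρ ^ M * ρ ^ n) (B * ρ ^ M * (1 - ρ)⁻¹) :=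
      (hasSum_geometric_of_lt_one hρ0 hρ1).mul_left _
    rw [div_eq_mul_inv]
    exact tsum_of_norm_bounded hg fun n ↦ (hunorm (n + M)).trans_eq (by rw [pow_add]; ring)
  have hlt : abscissaOfAbsConv c < ((1 + a : ℝ) : EReal) :=
    habs.trans_lt (by exact_mod_cast (by linarith : (1 : ℝ) < 1 + a))
  have hterm : ∀ n, (u n).re = (n ! : ℝ)⁻¹ * (a + d) ^ n *
      ((-1) ^ n * iteratedDeriv n (LSeries c) σ).re - lam * ((a + d) ^ n / a ^ (n + 1)) := by
    intro n
    have hf : (n ! : ℂ) ≠ 0 := by exact_mod_cast n.factorial_ne_zero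
    have ha' : (a : ℂ) ≠ 0 := by exact_mod_cast ha.ne'
    have hpow : (a : ℂ) ^ (-1 - n : ℤ) = ((a : ℂ) ^ (n + 1))⁻¹ := by
      rw [← zpow_natCast, ← zpow_neg]
      congr 1
      push_cast
      ring
    have h1 : ((-1 : ℂ)) ^ n * (-1) ^ n = 1 := by rw [← mul_pow]; norm_num
    have : u n = (((n ! : ℝ)⁻¹ * (a + d) ^ n : ℝ) : ℂ) * ((-1) ^ n * iteratedDeriv n (LSeries c) σ)
        - ((lam * ((a + d) ^ n / a ^ (n + 1)) : ℝ) : ℂ) := by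
      simp only [hu, smul_eq_mul]
      rw [iteratedDeriv_sub_pole ha habs hGc, ← hσ, hzσ, hpow, Complex.ofReal_neg, neg_pow]
      push_cast
      generalize iteratedDeriv n (LSeries c) σ = w
      field_simp
      linear_combination (-(lam : ℂ) * n !) * h1
    rw [this, Complex.sub_re, Complex.re_ofReal_mul, Complex.ofReal_re]
  have hnonneg : ∀ n, 0 ≤ ((-1) ^ n * iteratedDeriv n (LSeries c) σ).re := fun n ↦
    (Complex.le_def.1 (iteratedDeriv_alternating hc hlt n)).1
  have hgeom : ∑ n ∈ Finset.range M, lam * ((a + d) ^ n / a ^ (n + 1)) =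
      lam * ((1 + d / a) ^ M - 1) / d := by
    have h1 : ∀ n, lam * ((a + d) ^ n / a ^ (n + 1)) = lam / a * (1 + d / a) ^ n := by
      intro n
      rw [one_add_div ha.ne', div_pow, pow_succ]
      field_simp
    simp_rw [h1]
    rw [← Finset.mul_sum, geom_sum_eq (by simpa using ⟨hd.ne', ha.ne'⟩), add_sub_cancel_left]
    field_simp
  have hfin : 1 - lam * ((1 + d / a) ^ M - 1) / d ≤ ∑ n ∈ Finset.range M, (u n).re := by
    simp_rw [hterm]
    rw [Finset.sum_sub_distrib, hgeom]
    gcongr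
    refine le_trans ?_ (Finset.single_le_sum (f := fun n : ℕ ↦ (n ! : ℝ)⁻¹ * (a + d) ^ n *
      ((-1) ^ n * iteratedDeriv n (LSeries c) σ).re) (fun n _ ↦ ?_) (Finset.mem_range.2 hM))
    · simp only [Nat.factorial_zero, Nat.cast_one, inv_one, pow_zero, one_mul, iteratedDeriv_zero]
      exact one_le_LSeries_re hc hc1 hlt
    · have := hnonneg n
      positivity
  have hsplit : (G z).re = ∑ n ∈ Finset.range M, (u n).re + (∑' n, u (n + M)).re := by
    rw [← hsum.tsum_eq, ← hsum.summable.sum_add_tsum_nat_add M, Complex.add_re, Complex.re_sum]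
  have := (abs_le.1 ((Complex.abs_re_le_norm _).trans htail)).1
  rw [hsplit]
  linarith

end TaylorLowerBound

section ResidueLowerBound

open Filter Topology Metric LSeries
open scoped ComplexOrder

theorem residue_lower_bound {c : ℕ → ℂ} (hc : 0 ≤ c) (hc1 : c 1 = 1)
    (habs : abscissaOfAbsConv c ≤ 1) {H : ℂ → ℂ} {lam : ℝ}
    (hH : ∀ s : ℂ, 0 < s.re → DifferentiableAt ℂ H s) (hH1 : H 1 = lam)
    (hHc : ∀ s : ℂ, 1 < s.re → LSeries c s = LSeries 1 s * H s) {a r K d h : ℝ} (ha : 0 < a)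
    (hd : 0 < d) (hdr : d < r) (hr1 : r < 1)
    (hK : ∀ s : ℂ, 1 - r ≤ s.re → ‖s‖ ≤ 1 + 2 * a + r → ‖H s‖ ≤ K)
    (hh : H ((1 - d : ℝ) : ℂ) = h) (hh0 : 0 ≤ h) {M : ℕ} (hM : 0 < M) :
    1 - ((1 / r + 1 + (1 + 2 * a + r) / (1 - r)) * K + |lam| / r) *
      ((a + d) / (a + r)) ^ M / (1 - (a + d) / (a + r)) ≤ lam * (1 + d / a) ^ M / d := by
  have hr : 0 < r := hd.trans hdr
  have h1r : 0 < 1 - r := by linarith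
  set G : ℂ → ℂ := fun s ↦ dslope H 1 s + zetaReg s * H s with hGdef
  have hopen : IsOpen {s : ℂ | 0 < s.re} := isOpen_lt continuous_const Complex.continuous_re
  have hslope : DifferentiableOn ℂ (dslope H 1) {s : ℂ | 0 < s.re} :=
    (Complex.differentiableOn_dslope (hopen.mem_nhds (by simp))).2
      fun s hs ↦ (hH s hs).differentiableWithinAt
  have hGd : ∀ s : ℂ, 0 < s.re → DifferentiableAt ℂ G s := fun s hs ↦
    (hslope.differentiableAt (hopen.mem_nhds hs)).add
      ((differentiableAt_zetaReg hs).mul (hH s hs))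
  have hGeq : ∀ s : ℂ, s ≠ 1 → G s = (1 / (s - 1) + zetaReg s) * H s - lam / (s - 1) := by
    intro s hs
    have : s - 1 ≠ 0 := sub_ne_zero.2 hs
    simp only [hGdef, dslope_of_ne _ hs, slope_def_field, hH1]
    field_simp
    ring
  have hball : ∀ s ∈ closedBall ((1 + a : ℝ) : ℂ) (a + r), 1 - r ≤ s.re ∧ ‖s‖ ≤ 1 + 2 * a + r := by
    intro s hs
    rw [mem_closedBall, dist_eq_norm] at hs
    constructor
    · have h1 := (abs_le.1 ((Complex.abs_re_le_norm _).trans hs)).1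
      rw [Complex.sub_re, Complex.ofReal_re] at h1
      linarith
    · have h1 : ‖s‖ ≤ ‖s - ((1 + a : ℝ) : ℂ)‖ + ‖((1 + a : ℝ) : ℂ)‖ := by
        simpa using norm_add_le (s - ((1 + a : ℝ) : ℂ)) ((1 + a : ℝ) : ℂ)
      rw [Complex.norm_real, Real.norm_eq_abs, abs_of_pos (by linarith)] at h1
      linarith
  have hB : ∀ s ∈ sphere ((1 + a : ℝ) : ℂ) (a + r),
      ‖G s‖ ≤ (1 / r + 1 + (1 + 2 * a + r) / (1 - r)) * K + |lam| / r := by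
    intro s hs
    obtain ⟨hs1, hs2⟩ := hball s (sphere_subset_closedBall hs)
    have hs3 : r ≤ ‖s - 1‖ := by
      rw [mem_sphere, dist_eq_norm] at hs
      have h1 : ‖s - ((1 + a : ℝ) : ℂ)‖ ≤ ‖s - 1‖ + ‖(a : ℂ)‖ := by
        rw [show s - ((1 + a : ℝ) : ℂ) = (s - 1) - (a : ℂ) by push_cast; ring]
        exact norm_sub_le _ _
      rw [Complex.norm_real, Real.norm_eq_abs, abs_of_pos ha] at h1
      linarith
    have hne : s ≠ 1 := by
      rintro rfl
      simp only [sub_self, norm_zero] at hs3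
      linarith
    rw [hGeq s hne]
    refine (norm_sub_le _ _).trans (add_le_add ?_ ?_)
    · rw [norm_mul]
      refine mul_le_mul ?_ (hK s hs1 hs2) (norm_nonneg _) (by positivity)
      refine (norm_add_le _ _).trans ?_
      rw [add_assoc]
      refine add_le_add ?_ ((norm_zetaReg_le hr hr1 hs1).trans ?_)
      · rw [norm_div, norm_one]
        gcongr
      · gcongr
    · rw [norm_div, Complex.norm_real, Real.norm_eq_abs]
      gcongr
  have hGc : ∀ s : ℂ, 1 < s.re → G s = LSeries c s - lam / (s - 1) := by
    intro s hs
    have hne : s ≠ 1 := by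
      rintro rfl
      simp at hs
    rw [hGeq s hne, hHc s hs, LSeries_one_eq_add hs]
  have hmain := re_ge_of_nonneg_coeff hc hc1 ha habs
    (fun s hs ↦ hGd s (h1r.trans_le (hball s hs).1)) hGc hB hd hdr hM
  obtain ⟨z, hz, hzeq⟩ := exists_zetaReg_ofReal (x := 1 - d) (by linarith) (by linarith)
  have hne : ((1 - d : ℝ) : ℂ) ≠ 1 := by
    intro h1
    have : (1 - d : ℝ) = 1 := by exact_mod_cast h1
    linarith
  have hGv : G ((1 - d : ℝ) : ℂ) = ((z * h + lam / d : ℝ) : ℂ) := by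
    rw [hGeq _ hne, hzeq, hh]
    have : (d : ℂ) ≠ 0 := by exact_mod_cast hd.ne'
    push_cast
    rw [show (1 : ℂ) - d - 1 = -d by ring, div_neg]
    ring
  rw [hGv, Complex.ofReal_re] at hmain
  have h2 : lam * ((1 + d / a) ^ M - 1) / d = lam * (1 + d / a) ^ M / d - lam / d := by ring
  rw [h2] at hmain
  have := mul_nonneg_of_nonpos_of_nonpos hz.le (neg_nonpos.2 hh0)
  linarith

end ResidueLowerBound

section NonnegativeConvolutions

open LSeries ArithmeticFunction
open scoped ComplexOrder ArithmeticFunction.zeta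

theorem ArithmeticFunction.IsMultiplicative.nonneg_of_prime_pow {g : ArithmeticFunction ℤ}
    (hg : g.IsMultiplicative) (h : ∀ p k : ℕ, p.Prime → 0 ≤ g (p ^ k)) (n : ℕ) : 0 ≤ g n := by
  rcases eq_or_ne n 0 with rfl | hn
  · simp
  · rw [hg.multiplicative_factorization g hn]
    exact Finset.prod_nonneg fun p hp ↦ h p _ (Nat.prime_of_mem_primeFactors hp)

theorem int_cases_of_abs_le_one {x : ℤ} (hx : |x| ≤ 1) : x = -1 ∨ x = 0 ∨ x = 1 := by
  rw [abs_le] at hx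
  omega

theorem geom_sum_nonneg_of_abs_le_one {x : ℤ} (hx : |x| ≤ 1) (n : ℕ) :
    0 ≤ ∑ i ∈ Finset.range n, x ^ i := by
  rcases int_cases_of_abs_le_one hx with rfl | rfl | rfl
  · rw [neg_one_geom_sum]
    split_ifs <;> norm_num
  · exact Finset.sum_nonneg fun i _ ↦ by positivity
  · exact Finset.sum_nonneg fun i _ ↦ by positivity

namespace IsQuadraticCharacter

variable {f f₁ f₂ f₁₂ : ℕ → ℤ} {q q₁ q₂ q₁₂ : ℝ}

/-- A quadratic character as an arithmetic function. -/
def toArith (hf : IsQuadraticCharacter f q) : ArithmeticFunction ℤ := ⟨f, hf.map_zero⟩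

theorem toArith_apply (hf : IsQuadraticCharacter f q) (n : ℕ) : hf.toArith n = f n := rfl

theorem map_pow (hf : IsQuadraticCharacter f q) (m k : ℕ) : f (m ^ k) = f m ^ k := by
  induction k with
  | zero => simpa using hf.map_one
  | succ k ih => rw [pow_succ, hf.map_mul, ih, pow_succ]

theorem isMultiplicative (hf : IsQuadraticCharacter f q) : hf.toArith.IsMultiplicative :=
  ⟨hf.map_one, fun _ ↦ hf.map_mul _ _⟩

theorem zeta_mul_isMultiplicative (hf : IsQuadraticCharacter f q) :
    ((ζ : ArithmeticFunction ℤ) * hf.toArith).IsMultiplicative :=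
  isMultiplicative_zeta.natCast.mul hf.isMultiplicative

theorem zeta_mul_prime_pow (hf : IsQuadraticCharacter f q) {p : ℕ} (hp : p.Prime) (k : ℕ) :
    ((ζ : ArithmeticFunction ℤ) * hf.toArith) (p ^ k) = ∑ i ∈ Finset.range (k + 1), f p ^ i := by
  rw [coe_zeta_mul_apply, Nat.sum_divisors_prime_pow hp]
  exact Finset.sum_congr rfl fun i _ ↦ hf.map_pow p i

theorem zeta_mul_nonneg (hf : IsQuadraticCharacter f q) (n : ℕ) :
    0 ≤ ((ζ : ArithmeticFunction ℤ) * hf.toArith) n :=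
  hf.zeta_mul_isMultiplicative.nonneg_of_prime_pow (fun p k hp ↦ by
    rw [hf.zeta_mul_prime_pow hp]
    exact geom_sum_nonneg_of_abs_le_one (hf.abs_le p) _) n

theorem pmul_zeta_mul (hf₁ : IsQuadraticCharacter f₁ q₁) (hf₂ : IsQuadraticCharacter f₂ q₂) :
    hf₂.toArith.pmul ((ζ : ArithmeticFunction ℤ) * hf₁.toArith) =
      hf₂.toArith * hf₁.toArith.pmul hf₂.toArith := by
  ext n
  rw [pmul_apply, mul_apply, mul_apply, Finset.mul_sum]
  refine Finset.sum_congr rfl fun x hx ↦ ?_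
  obtain ⟨hxn, hn⟩ := Nat.mem_divisorsAntidiagonal.1 hx
  have hx1 : x.1 ≠ 0 := by
    rintro h
    rw [h, zero_mul] at hxn
    exact hn hxn.symm
  rw [natCoe_apply, zeta_apply_ne hx1, pmul_apply, toArith_apply, toArith_apply, toArith_apply,
    toArith_apply, ← hxn, hf₂.map_mul]
  push_cast
  ring

theorem quadruple_comm (hf₁ : IsQuadraticCharacter f₁ q₁) (hf₂ : IsQuadraticCharacter f₂ q₂) :
    ((ζ : ArithmeticFunction ℤ) * hf₁.toArith) *
      hf₂.toArith.pmul ((ζ : ArithmeticFunction ℤ) * hf₁.toArith) =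
    ((ζ : ArithmeticFunction ℤ) * hf₂.toArith) *
      hf₁.toArith.pmul ((ζ : ArithmeticFunction ℤ) * hf₂.toArith) := by
  rw [hf₁.pmul_zeta_mul hf₂, hf₂.pmul_zeta_mul hf₁, pmul_comm hf₂.toArith]
  ring

theorem quadruple_isMultiplicative (hf₁ : IsQuadraticCharacter f₁ q₁)
    (hf₂ : IsQuadraticCharacter f₂ q₂) :
    (((ζ : ArithmeticFunction ℤ) * hf₁.toArith) *
      hf₂.toArith.pmul ((ζ : ArithmeticFunction ℤ) * hf₁.toArith)).IsMultiplicative :=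
  hf₁.zeta_mul_isMultiplicative.mul (hf₂.isMultiplicative.pmul hf₁.zeta_mul_isMultiplicative)

theorem quadruple_prime_pow_nonneg (hf₁ : IsQuadraticCharacter f₁ q₁)
    (hf₂ : IsQuadraticCharacter f₂ q₂) {p : ℕ} (hp : p.Prime) (h : 0 ≤ f₂ p ∨ f₁ p = -1) (k : ℕ) :
    0 ≤ (((ζ : ArithmeticFunction ℤ) * hf₁.toArith) *
      hf₂.toArith.pmul ((ζ : ArithmeticFunction ℤ) * hf₁.toArith)) (p ^ k) := by
  rw [mul_apply]
  refine Finset.sum_nonneg fun x hx ↦ mul_nonneg (hf₁.zeta_mul_nonneg _) ?_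
  obtain ⟨hxn, -⟩ := Nat.mem_divisorsAntidiagonal.1 hx
  obtain ⟨j, -, hj⟩ := (Nat.dvd_prime_pow hp).1 (Dvd.intro_left _ hxn)
  rw [hj, pmul_apply, toArith_apply, hf₂.map_pow, hf₁.zeta_mul_prime_pow hp]
  rcases h with h | h
  · exact mul_nonneg (pow_nonneg h _) (geom_sum_nonneg_of_abs_le_one (hf₁.abs_le p) _)
  · rw [h, neg_one_geom_sum]
    split_ifs with he
    · simp
    · rw [mul_one]
      exact Even.pow_nonneg (by rwa [Nat.even_add_one, not_not] at he) _

theorem quadruple_nonneg (hf₁ : IsQuadraticCharacter f₁ q₁)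
    (hf₂ : IsQuadraticCharacter f₂ q₂) (n : ℕ) :
    0 ≤ (((ζ : ArithmeticFunction ℤ) * hf₁.toArith) *
      hf₂.toArith.pmul ((ζ : ArithmeticFunction ℤ) * hf₁.toArith)) n := by
  refine (hf₁.quadruple_isMultiplicative hf₂).nonneg_of_prime_pow (fun p k hp ↦ ?_) n
  rcases int_cases_of_abs_le_one (hf₁.abs_le p) with h | h
  · exact hf₁.quadruple_prime_pow_nonneg hf₂ hp (Or.inr h) k
  · rw [hf₁.quadruple_comm hf₂]
    refine hf₂.quadruple_prime_pow_nonneg hf₁ hp (Or.inl ?_) k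
    rcases h with h | h <;> simp [h]

theorem LSeriesSummable_toArith (hf : IsQuadraticCharacter f q) {s : ℂ} (hs : 1 < s.re) :
    LSeriesSummable (fun n ↦ (hf.toArith : ArithmeticFunction ℂ) n) s :=
  LSeriesSummable_of_bounded_of_one_lt_re (m := 1) (fun n _ ↦ by
    rw [intCoe_apply, toArith_apply, Complex.norm_intCast]
    exact_mod_cast hf.abs_le n) hs

theorem LSeries_toArith (hf : IsQuadraticCharacter f q) {s : ℂ} (hs : 1 < s.re) :
    LSeries (fun n ↦ (hf.toArith : ArithmeticFunction ℂ) n) s = charL f s :=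
  hf.LSeries_eq hs

theorem _root_.LSeriesSummable_natCoe_zeta {s : ℂ} (hs : 1 < s.re) :
    LSeriesSummable (fun n ↦ (ζ : ArithmeticFunction ℂ) n) s :=
  LSeriesSummable_zeta_iff.2 hs

theorem _root_.LSeries_natCoe_zeta (s : ℂ) :
    LSeries (fun n ↦ (ζ : ArithmeticFunction ℂ) n) s = LSeries 1 s := by
  rw [← LSeries_zeta_eq]
  rfl

theorem exists_nonneg_coeff (hf : IsQuadraticCharacter f q) :
    ∃ c : ℕ → ℂ, 0 ≤ c ∧ c 1 = 1 ∧ abscissaOfAbsConv c ≤ 1 ∧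
      ∀ s : ℂ, 1 < s.re → LSeries c s = LSeries 1 s * charL f s := by
  set g : ArithmeticFunction ℤ := (ζ : ArithmeticFunction ℤ) * hf.toArith with hg
  have hgc : (g : ArithmeticFunction ℂ) = (ζ : ArithmeticFunction ℂ) * (hf.toArith) := by
    rw [hg, intCoe_mul]
    congr 1
  have hg0 : ∀ n, 0 ≤ g n := hf.zeta_mul_nonneg
  have hg1 : g 1 = 1 := hf.zeta_mul_isMultiplicative.1
  clear_value g
  have hsum : ∀ s : ℂ, 1 < s.re → LSeriesSummable (fun n ↦ (g : ArithmeticFunction ℂ) n) s :=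
    fun s hs ↦ by
      rw [hgc]
      exact LSeriesSummable_mul (LSeriesSummable_natCoe_zeta hs) (hf.LSeriesSummable_toArith hs)
  refine ⟨fun n ↦ (g : ArithmeticFunction ℂ) n, fun n ↦ ?_, ?_, ?_, fun s hs ↦ ?_⟩
  · exact Int.cast_nonneg (hg0 n)
  · exact (congrArg (Int.cast : ℤ → ℂ) hg1).trans Int.cast_one
  · exact abscissaOfAbsConv_le_of_forall_lt_LSeriesSummable' fun y hy ↦
      hsum y (by exact_mod_cast hy)
  · rw [hgc, LSeries_mul' (LSeriesSummable_natCoe_zeta hs) (hf.LSeriesSummable_toArith hs),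
      hf.LSeries_toArith hs, LSeries_natCoe_zeta s]

theorem exists_nonneg_coeff_quadruple (hf₁ : IsQuadraticCharacter f₁ q₁)
    (hf₂ : IsQuadraticCharacter f₂ q₂) (hf₁₂ : IsQuadraticCharacter f₁₂ q₁₂)
    (h : ∀ n, f₁₂ n = f₁ n * f₂ n) :
    ∃ c : ℕ → ℂ, 0 ≤ c ∧ c 1 = 1 ∧ abscissaOfAbsConv c ≤ 1 ∧
      ∀ s : ℂ, 1 < s.re → LSeries c s = LSeries 1 s * (charL f₁ s * charL f₂ s * charL f₁₂ s) := by
  set g : ArithmeticFunction ℤ := ((ζ : ArithmeticFunction ℤ) * hf₁.toArith) *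
      hf₂.toArith.pmul ((ζ : ArithmeticFunction ℤ) * hf₁.toArith) with hg
  have h12 : hf₁.toArith.pmul hf₂.toArith = hf₁₂.toArith := by
    ext n
    rw [pmul_apply, toArith_apply, toArith_apply, toArith_apply, h]
  have hgc : (g : ArithmeticFunction ℂ) =
      (ζ : ArithmeticFunction ℂ) * hf₁.toArith * (hf₂.toArith * hf₁₂.toArith) := by
    rw [hg, hf₁.pmul_zeta_mul hf₂, intCoe_mul, intCoe_mul, intCoe_mul, h12]
    congr 2
  have hg0 : ∀ n, 0 ≤ g n := hf₁.quadruple_nonneg hf₂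
  have hg1 : g 1 = 1 := (hf₁.quadruple_isMultiplicative hf₂).1
  clear_value g
  have hsum : ∀ s : ℂ, 1 < s.re → LSeriesSummable (fun n ↦ (g : ArithmeticFunction ℂ) n) s :=
    fun s hs ↦ by
      rw [hgc]
      exact LSeriesSummable_mul
        (LSeriesSummable_mul (LSeriesSummable_natCoe_zeta hs) (hf₁.LSeriesSummable_toArith hs))
        (LSeriesSummable_mul (hf₂.LSeriesSummable_toArith hs) (hf₁₂.LSeriesSummable_toArith hs))
  refine ⟨fun n ↦ (g : ArithmeticFunction ℂ) n, fun n ↦ ?_, ?_, ?_, fun s hs ↦ ?_⟩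
  · exact Int.cast_nonneg (hg0 n)
  · exact (congrArg (Int.cast : ℤ → ℂ) hg1).trans Int.cast_one
  · exact abscissaOfAbsConv_le_of_forall_lt_LSeriesSummable' fun y hy ↦
      hsum y (by exact_mod_cast hy)
  · have s0 := LSeriesSummable_natCoe_zeta hs
    have s1 := hf₁.LSeriesSummable_toArith hs
    have s2 := hf₂.LSeriesSummable_toArith hs
    have s3 := hf₁₂.LSeriesSummable_toArith hs
    rw [hgc, LSeries_mul' (LSeriesSummable_mul s0 s1) (LSeriesSummable_mul s2 s3),
      LSeries_mul' s0 s1, LSeries_mul' s2 s3, hf₁.LSeries_toArith hs, hf₂.LSeries_toArith hs,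
      hf₁₂.LSeries_toArith hs, LSeries_natCoe_zeta s]
    ring

end IsQuadraticCharacter

end NonnegativeConvolutions

section TwoCharacters

open LSeries Filter Topology Set

theorem Real.exp_div_le_of_pow_le {a b : ℕ} (hb : b ≠ 0) {x : ℝ} (hx : 0 ≤ x)
    (h : (2.7182818286 : ℝ) ^ a ≤ x ^ b) : Real.exp (a / b) ≤ x := by
  refine le_of_pow_le_pow_left₀ hb hx ?_
  rw [← Real.exp_nat_mul, mul_div_cancel₀ _ (by exact_mod_cast hb), ← mul_one (a : ℝ),
    Real.exp_nat_mul]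
  exact (pow_le_pow_left₀ (Real.exp_pos _).le Real.exp_one_lt_d9.le _).trans h

open ComplexOrder in
theorem le_residue_of_nonneg_coeff {c : ℕ → ℂ} (hc : 0 ≤ c) (hc1 : c 1 = 1)
    (habs : abscissaOfAbsConv c ≤ 1) {H : ℂ → ℂ} {lam : ℝ}
    (hH : ∀ s : ℂ, 0 < s.re → DifferentiableAt ℂ H s) (hH1 : H 1 = lam) (hlam : |lam| ≤ 1)
    (hHc : ∀ s : ℂ, 1 < s.re → LSeries c s = LSeries 1 s * H s) {K d h B : ℝ}
    (hd : 0 < d) (hd' : d ≤ 1 / 800) (hK1 : 1 ≤ K)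
    (hK : ∀ s : ℂ, 2 / 3 ≤ s.re → ‖s‖ ≤ 16 / 3 → ‖H s‖ ≤ K)
    (hh : H ((1 - d : ℝ) : ℂ) = h) (hh0 : 0 ≤ h) (hB : 0 < B)
    (hKB : 2200 * K ≤ Real.exp (23 / 150 * B)) :
    19 / 20 * d ≤ |lam| * Real.exp ((B + 1) / 1600) := by
  have hM : 0 < ⌈B⌉₊ := Nat.ceil_pos.2 hB
  have hM1 : B ≤ ⌈B⌉₊ := Nat.le_ceil B
  have hM2 : (⌈B⌉₊ : ℝ) ≤ B + 1 := (Nat.ceil_lt_add_one hB.le).le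
  have key := residue_lower_bound hc hc1 habs hH hH1 hHc (a := 2) (r := 1 / 3) (K := K)
    two_pos hd (by linarith) (by norm_num)
    (fun s hs hs' ↦ hK s (by linarith) (by linarith)) hh hh0 hM
  have hgrow : (1 + d / 2) ^ ⌈B⌉₊ ≤ Real.exp ((B + 1) / 1600) := by
    refine (pow_le_pow_left₀ (by positivity) ((add_comm 1 (d / 2)).le.trans
      (Real.add_one_le_exp _)) _).trans ?_
    rw [← Real.exp_nat_mul, Real.exp_le_exp]
    nlinarith
  have hrho : (2 + d) / (2 + 1 / 3) ≤ Real.exp (-(23 / 150)) := by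
    have h1 : Real.exp ((23 : ℕ) / (150 : ℕ)) ≤ 5600 / 4803 :=
      Real.exp_div_le_of_pow_le (by norm_num) (by norm_num) (by norm_num)
    rw [show (-(23 / 150) : ℝ) = -((23 : ℕ) / (150 : ℕ)) by norm_num, Real.exp_neg]
    refine le_trans ?_ (inv_anti₀ (Real.exp_pos _) h1)
    norm_num
    linarith
  have hrhoM : ((2 + d) / (2 + 1 / 3)) ^ ⌈B⌉₊ ≤ Real.exp (-(23 / 150 * B)) := by
    refine (pow_le_pow_left₀ (by positivity) hrho _).trans ?_
    rw [← Real.exp_nat_mul, Real.exp_le_exp]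
    nlinarith
  have htail : ((1 / (1 / 3) + 1 + (1 + 2 * 2 + 1 / 3) / (1 - 1 / 3)) * K + |lam| / (1 / 3)) *
      ((2 + d) / (2 + 1 / 3)) ^ ⌈B⌉₊ / (1 - (2 + d) / (2 + 1 / 3)) ≤ 1 / 20 := by
    have h1 : 797 / 5600 ≤ 1 - (2 + d) / (2 + 1 / 3) := by
      norm_num
      linarith
    rw [div_le_iff₀ (by linarith)]
    calc _ ≤ (15 * K) * Real.exp (-(23 / 150 * B)) := by
          gcongr
          linarith
      _ ≤ (15 / 2200) * (Real.exp (23 / 150 * B) * Real.exp (-(23 / 150 * B))) := by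
          have := Real.exp_pos (-(23 / 150 * B))
          nlinarith
      _ = 15 / 2200 := by rw [← Real.exp_add]; simp
      _ ≤ _ := by linarith
  have h1 : lam * (1 + d / 2) ^ ⌈B⌉₊ ≤ |lam| * Real.exp ((B + 1) / 1600) := by
    gcongr
    exact le_abs_self _
  have h2 : 19 / 20 ≤ lam * (1 + d / 2) ^ ⌈B⌉₊ / d := by linarith
  rw [le_div_iff₀ hd] at h2
  linarith

namespace IsQuadraticCharacter

variable {f f₁ f₂ f₁₂ : ℕ → ℤ} {q q₁ q₂ : ℝ}

theorem charL_one (f : ℕ → ℤ) : charL f 1 = (charLReal f 1 : ℝ) := by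
  rw [ofReal_charLReal]; simp

open ComplexOrder in
theorem charLReal_one_nonneg (hf : IsQuadraticCharacter f q) : 0 ≤ charLReal f 1 := by
  obtain ⟨c, hc, -, -, hcL⟩ := hf.exists_nonneg_coeff
  have h1 : Tendsto (fun s : ℂ ↦ (s - 1) * riemannZeta s * charL f s) (𝓝[≠] 1)
      (𝓝 (1 * charL f 1)) :=
    riemannZeta_residue_one.mul
      ((hf.differentiableAt_charL (by simp)).continuousAt.tendsto.mono_left nhdsWithin_le_nhds)
  have h2 : Tendsto (fun x : ℝ ↦ (x : ℂ)) (𝓝[>] 1) (𝓝[≠] 1) := by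
    refine tendsto_nhdsWithin_iff.2 ⟨?_, ?_⟩
    · have := (Complex.continuous_ofReal.tendsto (1 : ℝ)).mono_left
        (nhdsWithin_le_nhds (s := Ioi 1))
      simpa using this
    · filter_upwards [self_mem_nhdsWithin] with x (hx : 1 < x)
      simpa using hx.ne'
  have h3 := (Complex.continuous_re.tendsto _).comp (h1.comp h2)
  rw [one_mul, charL_one, Complex.ofReal_re] at h3
  refine ge_of_tendsto h3 ?_
  filter_upwards [self_mem_nhdsWithin] with x (hx : 1 < x)
  have hx' : 1 < (x : ℂ).re := by simpa using hx
  have h4 : 0 ≤ LSeries c x := by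
    refine tsum_nonneg fun n ↦ ?_
    exact LSeries.term_nonneg (hc n) x
  have h5 : 0 ≤ ((x : ℂ) - 1) := by
    rw [← Complex.ofReal_one, ← Complex.ofReal_sub]
    exact_mod_cast (sub_pos.2 hx).le
  have h6 := mul_nonneg h5 h4
  rw [hcL _ hx', LSeries_one_eq_riemannZeta hx', ← mul_assoc] at h6
  exact (Complex.le_def.1 h6).1

theorem norm_charL_le_of_le (hf : IsQuadraticCharacter f q) {s : ℂ} (hs : 2 / 3 ≤ s.re)
    (hs' : ‖s‖ ≤ 16 / 3) {E : ℝ} (hq : q ≤ Real.exp E) : ‖charL f s‖ ≤ 24 * Real.exp (E / 3) := by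
  have hq0 : (0 : ℝ) ≤ q := zero_le_one.trans hf.one_le
  have h1 : q ^ (1 / 3 : ℝ) ≤ Real.exp (E / 3) := by
    refine (Real.rpow_le_rpow hq0 hq (by norm_num)).trans_eq ?_
    rw [← Real.exp_mul]; ring_nf
  refine (hf.norm_charL_le (r := 1 / 3) (by norm_num) (by norm_num) (by linarith)).trans ?_
  calc _ ≤ 16 / 3 * (Real.exp (E / 3) / (1 / 3 * (1 - 1 / 3))) := by gcongr
    _ = _ := by ring

theorem charLReal_neg_of_small (hf : IsQuadraticCharacter f q) {y : ℝ} (hy : 0 ≤ y)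
    (hq : q ≤ Real.exp (256 + y)) (h1 : |charLReal f 1| ≤ 0.000612 * Real.exp (-(y / 8))) :
    charLReal f (1 - 1 / 800) < 0 := by
  by_contra! h0
  obtain ⟨c, hc, hc1, habs, hcL⟩ := hf.exists_nonneg_coeff
  have he : Real.exp (-(y / 8)) ≤ 1 := Real.exp_le_one_iff.2 (by linarith)
  have key := le_residue_of_nonneg_coeff hc hc1 habs (fun s hs ↦ hf.differentiableAt_charL hs)
    (charL_one f) (by linarith) hcL (K := 24 * Real.exp ((256 + y) / 3)) (d := 1 / 800)
    (B := 640 + 3 * y) (by norm_num) le_rfl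
    (by have := Real.one_le_exp (x := (256 + y) / 3) (by linarith); linarith)
    (fun s hs hs' ↦ hf.norm_charL_le_of_le hs hs' hq) (ofReal_charLReal f _).symm h0
    (by linarith) (by
      have h2 : (52800 : ℝ) ≤ Real.exp 12 := by
        refine le_trans ?_ (pow_le_pow_left₀ (by norm_num) Real.exp_one_gt_d9.le 12 |>.trans_eq ?_)
        · norm_num
        · rw [← Real.exp_nat_mul]; norm_num
      calc _ = 52800 * Real.exp ((256 + y) / 3) := by ring
        _ ≤ Real.exp 12 * Real.exp ((256 + y) / 3) := by gcongr
        _ ≤ _ := by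
          rw [← Real.exp_add, Real.exp_le_exp]
          linarith)
  have h3 : Real.exp (-(y / 8)) * Real.exp ((640 + 3 * y + 1) / 1600) ≤ 1.6 := by
    rw [← Real.exp_add]
    refine le_trans (Real.exp_le_exp.2 (?_ : _ ≤ ((41 : ℕ) / (100 : ℕ) : ℝ)))
      (Real.exp_div_le_of_pow_le (by norm_num) (by norm_num) (by norm_num))
    push_cast
    linarith
  have h4 := mul_le_mul_of_nonneg_right h1 (Real.exp_pos ((640 + 3 * y + 1) / 1600)).le
  rw [mul_assoc] at h4
  linarith

theorem false_of_small_pair (hf₁ : IsQuadraticCharacter f₁ q₁) (hf₂ : IsQuadraticCharacter f₂ q₂)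
    (hf₁₂ : IsQuadraticCharacter f₁₂ (q₁ * q₂)) (h : ∀ n, f₁₂ n = f₁ n * f₂ n) {y₁ y₂ : ℝ}
    (hy₁ : 0 ≤ y₁) (hy₂ : 0 ≤ y₂) (hq₁ : q₁ ≤ Real.exp (256 + y₁)) (hq₂ : q₂ ≤ Real.exp (256 + y₂))
    (h₁ : |charLReal f₁ 1| ≤ 0.000612 * Real.exp (-(y₁ / 8)))
    (h₂ : |charLReal f₂ 1| ≤ 0.000612 * Real.exp (-(y₂ / 8)))
    (h₁₂ : charLReal f₁₂ 1 ≠ 0) : False := by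
  obtain ⟨c, hc, hc1, habs, hcL⟩ := hf₁.exists_nonneg_coeff_quadruple hf₂ hf₁₂ h
  set Y := y₁ + y₂ with hY
  have hY0 : 0 ≤ Y := by positivity
  have hqQ : q₁ * q₂ ≤ Real.exp (512 + Y) := by
    refine (mul_le_mul hq₁ hq₂ (zero_le_one.trans hf₂.one_le) (Real.exp_pos _).le).trans_eq ?_
    rw [← Real.exp_add]; congr 1; rw [hY]; ring
  have hQ0 : 0 < q₁ * q₂ := zero_lt_one.trans_le hf₁₂.one_le
  set l := Real.log (q₁ * q₂) with hldef
  have hl : l ≤ 512 + Y := (Real.log_le_iff_le_exp hQ0).2 hqQ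
  have hl0 : 0 ≤ l := Real.log_nonneg hf₁₂.one_le
  have hlY : l + 1 ≤ 513 * Real.exp (Y / 513) := by
    have := Real.add_one_le_exp (Y / 513)
    linarith
  have hlY' : l + 2 ≤ 514 * Real.exp (Y / 513) := by
    have := Real.add_one_le_exp (Y / 513)
    linarith
  have hpos := hf₁₂.charLReal_one_nonneg.lt_of_ne' h₁₂
  have hprod : |charLReal f₁ 1 * charLReal f₂ 1| ≤ 0.000000375 * Real.exp (-(Y / 8)) := by
    rw [abs_mul]
    refine (mul_le_mul h₁ h₂ (abs_nonneg _) (by positivity)).trans ?_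
    rw [mul_mul_mul_comm, ← Real.exp_add, show -(y₁ / 8) + -(y₂ / 8) = -(Y / 8) by rw [hY]; ring]
    gcongr
    norm_num
  have hlam : |charLReal f₁ 1 * charLReal f₂ 1 * charLReal f₁₂ 1| ≤
      0.0002 * Real.exp (Y / 513 - Y / 8) := by
    rw [abs_mul]
    refine (mul_le_mul hprod (hf₁₂.abs_charLReal_one_le.trans hlY) (abs_nonneg _)
      (by positivity)).trans ?_
    rw [mul_mul_mul_comm, ← Real.exp_add, show -(Y / 8) + Y / 513 = Y / 513 - Y / 8 by ring]
    gcongr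
    norm_num
  have key {d h : ℝ} (hd : 0 < d) (hd' : d ≤ 1 / 800)
      (hh : charLReal f₁ (1 - d) * charLReal f₂ (1 - d) * charLReal f₁₂ (1 - d) = h)
      (hh0 : 0 ≤ h) : 19 / 20 * d ≤ |charLReal f₁ 1 * charLReal f₂ 1 * charLReal f₁₂ 1| *
        Real.exp ((2350 + 5 * Y + 1) / 1600) := by
    have he : Real.exp (Y / 513 - Y / 8) ≤ 1 := Real.exp_le_one_iff.2 (by linarith)
    refine le_residue_of_nonneg_coeff hc hc1 habs
      (H := fun s ↦ charL f₁ s * charL f₂ s * charL f₁₂ s)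
      (fun s hs ↦ ((hf₁.differentiableAt_charL hs).mul (hf₂.differentiableAt_charL hs)).mul
        (hf₁₂.differentiableAt_charL hs))
      (by simp only [charL_one]; push_cast; ring) (by linarith) hcL
      (K := 13824 * Real.exp ((512 + Y) * (2 / 3))) (B := 2350 + 5 * Y) (h := h) hd hd'
      (by
        have := Real.one_le_exp (x := (512 + Y) * (2 / 3)) (by linarith)
        linarith)
      (fun s hs hs' ↦ ?_) (by simp only [← ofReal_charLReal]; exact_mod_cast hh) hh0
      (by linarith) ?_
    · rw [norm_mul, norm_mul]
      calc _ ≤ (24 * Real.exp ((256 + y₁) / 3)) * (24 * Real.exp ((256 + y₂) / 3)) *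
            (24 * Real.exp ((512 + Y) / 3)) := by
            gcongr
            exacts [hf₁.norm_charL_le_of_le hs hs' hq₁, hf₂.norm_charL_le_of_le hs hs' hq₂,
              hf₁₂.norm_charL_le_of_le hs hs' hqQ]
        _ = 13824 * (Real.exp ((256 + y₁) / 3) * Real.exp ((256 + y₂) / 3) *
            Real.exp ((512 + Y) / 3)) := by ring
        _ = _ := by
            rw [← Real.exp_add, ← Real.exp_add]
            congr 2
            rw [hY]; ring
    · have h2 : (30412800 : ℝ) ≤ Real.exp 18 := by
        refine le_trans ?_ (pow_le_pow_left₀ (by norm_num) Real.exp_one_gt_d9.le 18 |>.trans_eq ?_)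
        · norm_num
        · rw [← Real.exp_nat_mul]; norm_num
      calc _ = 30412800 * Real.exp ((512 + Y) * (2 / 3)) := by ring
        _ ≤ Real.exp 18 * Real.exp ((512 + Y) * (2 / 3)) := by gcongr
        _ ≤ _ := by
          rw [← Real.exp_add, Real.exp_le_exp]
          linarith
  have hn₁ := hf₁.charLReal_neg_of_small hy₁ hq₁ h₁
  have hn₂ := hf₂.charLReal_neg_of_small hy₂ hq₂ h₂
  have hn₁₂ : charLReal f₁₂ (1 - 1 / 800) < 0 := by
    by_contra! h0
    have h3 := key (d := 1 / 800) (by norm_num) le_rfl rfl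
      (mul_nonneg (mul_pos_of_neg_of_neg hn₁ hn₂).le h0)
    have h4 := mul_le_mul_of_nonneg_right hlam (Real.exp_pos ((2350 + 5 * Y + 1) / 1600)).le
    have h5 : Real.exp (Y / 513 - Y / 8) * Real.exp ((2350 + 5 * Y + 1) / 1600) ≤ 4.4 := by
      rw [← Real.exp_add]
      refine le_trans (Real.exp_le_exp.2 (?_ : _ ≤ ((147 : ℕ) / (100 : ℕ) : ℝ)))
        (Real.exp_div_le_of_pow_le (by norm_num) (by norm_num) (by norm_num))
      push_cast
      linarith
    rw [mul_assoc (0.0002 : ℝ)] at h4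
    linarith
  obtain ⟨x, ⟨hx1, hx2⟩, hx0⟩ : (0 : ℝ) ∈ charLReal f₁₂ '' Icc (1 - 1 / 800) 1 := by
    refine intermediate_value_Icc (by norm_num) (hf₁₂.continuousOn_charLReal.mono ?_)
      ⟨hn₁₂.le, hpos.le⟩
    exact fun z hz ↦ lt_of_lt_of_le (by norm_num) hz.1
  have hx3 : x < 1 := lt_of_le_of_ne hx2 (by rintro rfl; exact h₁₂ hx0)
  obtain ⟨d, rfl⟩ : ∃ d, x = 1 - d := ⟨1 - x, by ring⟩
  have hd : 0 < d := by linarith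
  have hd' : d ≤ 1 / 800 := by linarith
  have h3 := key hd hd' (by rw [hx0, mul_zero]) le_rfl
  have hQd : (q₁ * q₂) ^ d ≤ Real.exp ((512 + Y) / 800) := by
    rw [Real.rpow_def_of_pos hQ0, Real.exp_le_exp, ← hldef]
    nlinarith
  have hQ1 : 1 ≤ (q₁ * q₂) ^ d := Real.one_le_rpow hf₁₂.one_le hd.le
  have h4 : |charLReal f₁₂ 1| ≤ d * (264196 * Real.exp (2 * Y / 513 + (512 + Y) / 800)) := by
    refine (hf₁₂.abs_charLReal_one_le_of_eq_zero hd (by linarith) hx0).trans ?_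
    rw [← hldef]
    gcongr
    have h6 : (l * (q₁ * q₂) ^ d + 1) / (1 - d) ≤ (2 * l + 2) * (q₁ * q₂) ^ d := by
      rw [div_le_iff₀ (by linarith)]
      have h7 : l + 1 ≤ (2 * l + 2) * (1 - d) := by nlinarith
      nlinarith
    calc _ ≤ l ^ 2 * (q₁ * q₂) ^ d + (2 * l + 2) * (q₁ * q₂) ^ d := by gcongr
      _ ≤ (l + 2) ^ 2 * (q₁ * q₂) ^ d := by nlinarith
      _ ≤ (514 * Real.exp (Y / 513)) ^ 2 * Real.exp ((512 + Y) / 800) := by gcongr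
      _ = _ := by
        rw [mul_pow, ← Real.exp_nat_mul, mul_assoc, ← Real.exp_add]
        norm_num
        ring_nf
  rw [abs_mul] at h3
  have h5 := mul_le_mul hprod h4 (abs_nonneg _) (by positivity)
  have h6 : Real.exp (-(Y / 8)) * Real.exp (2 * Y / 513 + (512 + Y) / 800) *
      Real.exp ((2350 + 5 * Y + 1) / 1600) ≤ 8.5 := by
    rw [← Real.exp_add, ← Real.exp_add]
    refine le_trans (Real.exp_le_exp.2 (?_ : _ ≤ ((211 : ℕ) / (100 : ℕ) : ℝ)))
      (Real.exp_div_le_of_pow_le (by norm_num) (by norm_num) (by norm_num))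
    push_cast
    linarith
  have h7 := mul_le_mul_of_nonneg_right h5 (Real.exp_pos ((2350 + 5 * Y + 1) / 1600)).le
  have h8 : 19 / 20 * d ≤ d * (0.000000375 * 264196 * 8.5) :=
    calc _ ≤ _ := h3.trans h7
      _ = d * (0.000000375 * 264196 * (Real.exp (-(Y / 8)) *
        Real.exp (2 * Y / 513 + (512 + Y) / 800) * Real.exp ((2350 + 5 * Y + 1) / 1600))) := by ring
      _ ≤ _ := by gcongr
  norm_num at h8
  linarith

end IsQuadraticCharacter

end TwoCharacters

section NonresiduePrimes

open scoped NumberTheorySymbols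

theorem jacobiSym_eq_one_of_modEq_one {c : ℤ} {n : ℕ} (hn : Odd n)
    (h : n ≡ 1 [MOD 4 * c.natAbs]) : jacobiSym c n = 1 := by
  rw [jacobiSym.mod_right c hn, h]
  rcases Nat.eq_zero_or_pos c.natAbs with h0 | h0
  · simp [h0]
  · rw [Nat.mod_eq_of_lt (by omega), jacobiSym.one_right]

/-- A prime in a suitable residue class at which a squarefree `m` with an odd prime factor is a
quadratic nonresidue. -/
theorem exists_prime_jacobiSym_eq_neg_one_of_mul {p : ℕ} [hp : Fact p.Prime] (hp2 : p ≠ 2) {c : ℤ}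
    (hc0 : c ≠ 0) (hpc : ¬ (p : ℤ) ∣ c) (N : ℕ) :
    ∃ n > N, n.Prime ∧ Odd n ∧ jacobiSym (p * c) n = -1 := by
  obtain ⟨u, hu⟩ := FiniteField.exists_nonsquare (F := ZMod p) (by rwa [ZMod.ringChar_zmod_n])
  have hcop : Nat.Coprime (4 * c.natAbs) p := by
    refine Nat.Coprime.symm ((Nat.Prime.coprime_iff_not_dvd hp.out).2 fun h ↦ ?_)
    rcases (Nat.Prime.dvd_mul hp.out).1 h with h | h
    · exact hp2 ((Nat.prime_dvd_prime_iff_eq hp.out Nat.prime_two).1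
        (hp.out.dvd_of_dvd_pow (n := 2) (by simpa using h)))
    · exact hpc (Int.natCast_dvd.2 h)
  obtain ⟨k, hk1, hk2⟩ := Nat.chineseRemainder hcop 1 u.val
  have hu0 : u ≠ 0 := by
    rintro rfl
    exact hu (IsSquare.zero)
  have hkp : k.Coprime p := by
    refine Nat.Coprime.symm ((Nat.Prime.coprime_iff_not_dvd hp.out).2 fun h ↦ hu0 ?_)
    have h1 := (ZMod.natCast_eq_natCast_iff _ _ _).2 hk2
    rw [ZMod.natCast_zmod_val, (ZMod.natCast_eq_zero_iff k p).2 h] at h1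
    exact h1.symm
  have hk4 : k.Coprime (4 * c.natAbs) := by
    rw [Nat.Coprime, hk1.gcd_eq, Nat.gcd_one_left]
  have hc0' : c.natAbs ≠ 0 := Int.natAbs_ne_zero.2 hc0
  obtain ⟨n, hn, hnp, hnk⟩ := Nat.forall_exists_prime_gt_and_modEq N
    (q := 4 * c.natAbs * p) (a := k) (by simp [hc0', hp.out.ne_zero]) (hk4.mul_right hkp)
  have hn1 : n ≡ 1 [MOD 4 * c.natAbs] := (hnk.of_mul_right _).trans hk1
  have hn4 : n % 4 = 1 := (hn1.of_mul_right _ : n ≡ 1 [MOD 4])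
  have hnodd : Odd n := Nat.odd_iff.2 (by omega)
  refine ⟨n, hn, hnp, hnodd, ?_⟩
  rw [jacobiSym.mul_left, jacobiSym_eq_one_of_modEq_one hnodd hn1, mul_one,
    jacobiSym.quadratic_reciprocity_one_mod_four' (hp.out.odd_of_ne_two hp2) hn4]
  rw [ZMod.nonsquare_iff_jacobiSym_eq_neg_one]
  have h1 := (ZMod.natCast_eq_natCast_iff _ _ _).2 ((hnk.of_mul_left _).trans hk2)
  rw [ZMod.natCast_zmod_val] at h1
  rwa [Int.cast_natCast, h1]

theorem exists_prime_jacobiSym_eq_neg_one_of_squarefree {m : ℤ} (hm : Squarefree m) (hm1 : m ≠ 1)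
    (N : ℕ) : ∃ n > N, n.Prime ∧ Odd n ∧ jacobiSym m n = -1 := by
  by_cases h : ∃ p : ℕ, p.Prime ∧ p ≠ 2 ∧ (p : ℤ) ∣ m
  · obtain ⟨p, hp, hp2, c, rfl⟩ := h
    have : Fact p.Prime := ⟨hp⟩
    refine exists_prime_jacobiSym_eq_neg_one_of_mul hp2 (right_ne_zero_of_mul hm.ne_zero) ?_ N
    rintro ⟨d, rfl⟩
    have := hm p ⟨d, by ring⟩
    exact hp.one_lt.ne' (by simpa using Int.isUnit_iff_natAbs_eq.1 this)
  · push Not at h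
    have hm2 : m.natAbs ∣ 2 := by
      rw [← Nat.prod_primeFactors_of_squarefree (Int.squarefree_natAbs.2 hm),
        ← Finset.prod_singleton (fun p : ℕ ↦ p) 2]
      refine Finset.prod_dvd_prod_of_subset _ _ _ fun p hp ↦ ?_
      rw [Finset.mem_singleton]
      by_contra hp2
      exact h p (Nat.prime_of_mem_primeFactors hp) hp2
        (Int.natCast_dvd.2 (Nat.dvd_of_mem_primeFactors hp))
    obtain ⟨n, hn, hnp, hn8⟩ := Nat.forall_exists_prime_gt_and_modEq N
      (q := 8) (a := if m = -1 then 3 else 5) (by norm_num) (by split_ifs <;> norm_num)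
    have hn8' : n % 8 = (if m = -1 then 3 else 5) % 8 := hn8
    have hodd : Odd n := by
      rw [Nat.odd_iff]
      split_ifs at hn8' <;> omega
    refine ⟨n, hn, hnp, hodd, ?_⟩
    have h3 : m = -1 ∨ m = 2 ∨ m = -2 := by
      have := Nat.le_of_dvd two_pos hm2
      have := hm.ne_zero
      omega
    rcases h3 with rfl | rfl | rfl
    · simp only [if_true] at hn8'
      rw [jacobiSym.at_neg_one hodd, ZMod.χ₄_nat_three_mod_four (by omega)]
    · norm_num at hn8'
      rw [jacobiSym.at_two hodd, ZMod.χ₈_nat_eq_if_mod_eight]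
      simp [hn8']
      omega
    · norm_num at hn8'
      rw [jacobiSym.at_neg_two hodd, ZMod.χ₈'_nat_eq_if_mod_eight]
      simp [hn8']
      omega

theorem exists_prime_jacobiSym_eq_neg_one {a : ℤ} (ha : ¬ IsSquare a) :
    ∃ n : ℕ, n.Prime ∧ Odd n ∧ jacobiSym a n = -1 := by
  have ha0 : a ≠ 0 := by rintro rfl; exact ha IsSquare.zero
  obtain ⟨m, b, hmb, hm⟩ := Nat.sq_mul_squarefree a.natAbs
  have hab : a = (a.sign * m) * (b : ℤ) ^ 2 := by
    rw [mul_assoc, ← Nat.cast_pow, ← Nat.cast_mul, mul_comm m, hmb, Int.sign_mul_natAbs]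
  have hsq : Squarefree (a.sign * m : ℤ) := by
    rw [← Int.squarefree_natAbs, Int.natAbs_mul, Int.natAbs_sign_of_ne_zero ha0]
    simpa using hm
  obtain ⟨n, hn, hnp, hodd, hJ⟩ := exists_prime_jacobiSym_eq_neg_one_of_squarefree hsq
    (fun h ↦ ha ⟨b, by rw [hab, h]; ring⟩) b
  have hb0 : b ≠ 0 := by
    rintro rfl
    simp at hab
    exact ha0 hab
  refine ⟨n, hnp, hodd, ?_⟩
  rw [hab, jacobiSym.mul_left, hJ, jacobiSym.sq_one', mul_one]
  rw [Int.gcd_natCast_natCast]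
  exact ((Nat.Prime.coprime_iff_not_dvd hnp).2 fun h ↦
    absurd (Nat.le_of_dvd (Nat.pos_of_ne_zero hb0) h) (by omega)).symm

end NonresiduePrimes

section OddJacobi

open Filter Topology Finset

/-- The Jacobi symbol `(a / n)`, extended by zero to even `n`. -/
noncomputable def oddJacobi (a : ℤ) (n : ℕ) : ℤ := if Odd n then jacobiSym a n else 0

theorem oddJacobi_of_odd (a : ℤ) {n : ℕ} (hn : Odd n) : oddJacobi a n = jacobiSym a n := if_pos hn

theorem oddJacobi_mul_left (a b : ℤ) (n : ℕ) :
    oddJacobi (a * b) n = oddJacobi a n * oddJacobi b n := by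
  unfold oddJacobi
  split_ifs <;> simp [jacobiSym.mul_left]

theorem oddJacobi_mul_right (a : ℤ) (m n : ℕ) :
    oddJacobi a (m * n) = oddJacobi a m * oddJacobi a n := by
  unfold oddJacobi
  by_cases hm : Odd m <;> by_cases hn : Odd n <;> simp [Nat.odd_mul, hm, hn]
  exact jacobiSym.mul_right' a (Nat.ne_of_odd_add hm) (Nat.ne_of_odd_add hn)

theorem abs_oddJacobi_le (a : ℤ) (n : ℕ) : |oddJacobi a n| ≤ 1 := by
  unfold oddJacobi
  split_ifs
  · rcases jacobiSym.trichotomy a n with h | h | h <;> simp [h]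
  · simp

theorem oddJacobi_mod (a : ℤ) (n : ℕ) : oddJacobi a (n % (4 * a.natAbs)) = oddJacobi a n := by
  have h : Odd (n % (4 * a.natAbs)) ↔ Odd n := by
    rw [Nat.odd_iff, Nat.odd_iff, Nat.mod_mod_of_dvd _ (dvd_mul_of_dvd_left (by norm_num) _)]
  unfold oddJacobi
  simp only [h]
  split_ifs with hn
  · exact (jacobiSym.mod_right a hn).symm
  · rfl

variable {a : ℤ}

theorem oddJacobi_eq_zero {n : ℕ} (h : ¬ n.Coprime (4 * a.natAbs)) : oddJacobi a n = 0 := by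
  unfold oddJacobi
  split_ifs with hn
  · refine jacobiSym.eq_zero_iff.2 ⟨fun h0 ↦ by simp [h0] at hn, fun hg ↦ h ?_⟩
    refine Nat.Coprime.mul_right ?_ ?_
    · exact (Nat.coprime_two_right.2 hn).pow_right 2
    · rw [Nat.coprime_comm]
      exact hg
  · rfl

/-- `oddJacobi a` as a Dirichlet character modulo `4|a|`. -/
noncomputable def oddJacobiChar (a : ℤ) [NeZero (4 * a.natAbs)] :
    DirichletCharacter ℤ (4 * a.natAbs) where
  toFun x := oddJacobi a x.val
  map_one' := by
    rw [← Nat.cast_one, ZMod.val_natCast, oddJacobi_mod, oddJacobi_of_odd a odd_one,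
      jacobiSym.one_right]
  map_mul' x y := by rw [ZMod.val_mul, oddJacobi_mod, oddJacobi_mul_right]
  map_nonunit' x hx := oddJacobi_eq_zero fun h ↦ hx (by
    rw [← ZMod.natCast_zmod_val x]
    exact (ZMod.isUnit_iff_coprime _ _).2 h)

theorem oddJacobiChar_natCast [NeZero (4 * a.natAbs)] (n : ℕ) :
    oddJacobiChar a n = oddJacobi a n := by
  change oddJacobi a (n : ZMod (4 * a.natAbs)).val = _
  rw [ZMod.val_natCast, oddJacobi_mod]

theorem oddJacobiChar_ne_one [NeZero (4 * a.natAbs)] (ha : ¬ IsSquare a) :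
    oddJacobiChar a ≠ 1 := by
  obtain ⟨n, -, hn, hJ⟩ := exists_prime_jacobiSym_eq_neg_one ha
  intro h
  have h1 := oddJacobiChar_natCast (a := a) n
  rw [h, oddJacobi_of_odd a hn, hJ] at h1
  by_cases hu : IsUnit (n : ZMod (4 * a.natAbs))
  · rw [MulChar.one_apply hu] at h1
    norm_num at h1
  · rw [MulChar.map_nonunit _ hu] at h1
    norm_num at h1

theorem sum_range_of_periodic {f : ℕ → ℤ} {N : ℕ} (hf : ∀ n, f (n % N) = f n)
    (h0 : ∑ k ∈ range N, f k = 0) (n : ℕ) : ∑ k ∈ range n, f k = ∑ k ∈ range (n % N), f k := by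
  have hper (m k : ℕ) : f (N * m + k) = f k := by rw [← hf, Nat.mul_add_mod, hf]
  have hmul (m : ℕ) : ∑ k ∈ range (N * m), f k = 0 := by
    induction m with
    | zero => simp
    | succ m ih => simp only [mul_add, mul_one, sum_range_add, ih, hper, h0, add_zero]
  conv_lhs => rw [← Nat.div_add_mod n N, sum_range_add, hmul, zero_add]
  simp only [hper]

theorem sum_range_oddJacobi [NeZero (4 * a.natAbs)] (ha : ¬ IsSquare a) :
    ∑ k ∈ range (4 * a.natAbs), oddJacobi a k = 0 := by
  rw [← MulChar.sum_eq_zero_of_ne_one (oddJacobiChar_ne_one ha)]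
  refine sum_nbij' (fun k ↦ (k : ZMod (4 * a.natAbs))) ZMod.val (by simp)
    (by simp [ZMod.val_lt]) (fun k hk ↦ ZMod.val_cast_of_lt (mem_range.1 hk)) (by simp)
    (fun k _ ↦ (oddJacobiChar_natCast k).symm)

theorem isQuadraticCharacter_oddJacobi (ha : ¬ IsSquare a) {q : ℝ} (hq : 4 * |(a : ℝ)| ≤ q) :
    IsQuadraticCharacter (oddJacobi a) q := by
  have ha0 : a ≠ 0 := by rintro rfl; exact ha IsSquare.zero
  have ha0' : 0 < a.natAbs := Int.natAbs_pos.2 ha0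
  have : NeZero (4 * a.natAbs) := ⟨by positivity⟩
  have hcast : ((4 * a.natAbs : ℕ) : ℝ) ≤ q := by
    rw [Nat.cast_mul, Nat.cast_natAbs, Int.cast_abs]
    exact_mod_cast hq
  refine ⟨?_, by simp [oddJacobi], ?_, oddJacobi_mul_right a, abs_oddJacobi_le a, fun n ↦ ?_⟩
  · refine le_trans ?_ hcast
    exact_mod_cast Nat.pos_of_ne_zero (NeZero.ne _)
  · rw [oddJacobi_of_odd a odd_one, jacobiSym.one_right]
  · have h1 : ∑ k ∈ Icc 1 n, oddJacobi a k = ∑ k ∈ range (n + 1), oddJacobi a k := by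
      rw [range_eq_Ico, sum_eq_sum_Ico_succ_bot (by omega)]
      simp [oddJacobi]
      rfl
    rw [h1, sum_range_of_periodic (oddJacobi_mod a) (sum_range_oddJacobi ha)]
    refine le_trans ?_ hcast
    rw [← Int.cast_abs]
    have h2 : |∑ k ∈ range ((n + 1) % (4 * a.natAbs)), oddJacobi a k| ≤ (4 * a.natAbs : ℕ) := by
      refine (abs_sum_le_sum_abs _ _).trans ((sum_le_sum fun k _ ↦ abs_oddJacobi_le a k).trans ?_)
      rw [sum_const, card_range, nsmul_eq_mul, mul_one, Nat.cast_le]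
      exact (Nat.mod_lt _ (Nat.pos_of_ne_zero (NeZero.ne _))).le
    rw [← Int.cast_natCast (R := ℝ)]
    exact Int.cast_le.2 h2

theorem charLReal_oddJacobi_one_ne_zero (ha : ¬ IsSquare a) : charLReal (oddJacobi a) 1 ≠ 0 := by
  have ha0 : a ≠ 0 := by rintro rfl; exact ha IsSquare.zero
  have : NeZero (4 * a.natAbs) := ⟨by simpa using ha0⟩
  have hf := isQuadraticCharacter_oddJacobi ha le_rfl
  set χ : DirichletCharacter ℂ (4 * a.natAbs) :=
    (oddJacobiChar a).ringHomComp (Int.castRingHom ℂ) with hχ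
  have hχ1 : χ ≠ 1 := (MulChar.ringHomComp_ne_one_iff Int.cast_injective).2
    (oddJacobiChar_ne_one ha)
  have heq {s : ℂ} (hs : 1 < s.re) : charL (oddJacobi a) s = χ.LFunction s := by
    rw [← hf.LSeries_eq hs, χ.LFunction_eq_LSeries hs]
    congr 1
    ext n
    simp [hχ, oddJacobiChar_natCast]
  have h1 : Tendsto (fun x : ℝ ↦ (x : ℂ)) (𝓝[>] 1) (𝓝 1) := by
    simpa using (Complex.continuous_ofReal.tendsto (1 : ℝ)).mono_left
      (nhdsWithin_le_nhds (s := Set.Ioi 1))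
  have h2 := ((hf.differentiableAt_charL (s := 1) (by simp)).continuousAt.tendsto).comp h1
  have h3 := ((DirichletCharacter.differentiable_LFunction hχ1).continuous.tendsto 1).comp h1
  have h4 : charL (oddJacobi a) 1 = χ.LFunction 1 := by
    refine tendsto_nhds_unique_of_eventuallyEq h2 h3 ?_
    filter_upwards [self_mem_nhdsWithin] with x (hx : 1 < x)
    exact heq (by simpa using hx)
  have h5 := DirichletCharacter.LFunction_apply_one_ne_zero hχ1
  rw [← h4, IsQuadraticCharacter.charL_one] at h5
  exact_mod_cast h5

end OddJacobi

section ImaginaryQuadraticField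

open QuadraticAlgebra Module

/-- The pairs `(a, b)` for which `X ^ 2 - b X - a` is the minimal polynomial of the standard
generator of the ring of integers of an imaginary quadratic field. -/
structure IsImaginaryQuadraticPair (a b : ℤ) : Prop where
  neg : b ^ 2 + 4 * a < 0
  cases : (b = 1 ∧ Squarefree (b ^ 2 + 4 * a)) ∨ (b = 0 ∧ Squarefree a ∧ (a % 4 = 2 ∨ a % 4 = 3))

theorem Squarefree.exists_int_of_mul_sq {d : ℤ} (hd : Squarefree d) {y : ℚ} {N : ℤ}
    (h : d * y ^ 2 = N) : ∃ n : ℤ, y = n := by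
  have hden : (y.den : ℚ) ≠ 0 := by exact_mod_cast y.den_ne_zero
  have h1 : (d * y.num ^ 2 : ℤ) = N * y.den ^ 2 := by
    have : (d : ℚ) * y.num ^ 2 = N * y.den ^ 2 := by
      rw [← h, mul_assoc, ← mul_pow, Rat.mul_den_eq_num]
    exact_mod_cast this
  have h2 : ((y.den : ℤ) ^ 2) ∣ d := by
    have hcop : IsCoprime ((y.den : ℤ) ^ 2) (y.num ^ 2) := (Int.isCoprime_iff_gcd_eq_one.2 (by
      rw [Int.gcd_comm]; exact y.reduced)).pow
    exact hcop.dvd_of_dvd_mul_right ⟨N, by rw [h1, mul_comm]⟩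
  have h3 := hd y.den (by rwa [← sq])
  refine ⟨y.num, ?_⟩
  exact ((Rat.den_eq_one_iff y).1 (by simpa using Int.isUnit_iff_natAbs_eq.1 h3)).symm

namespace IsImaginaryQuadraticPair

variable {a b : ℤ}

theorem fact (h : IsImaginaryQuadraticPair a b) :
    Fact (∀ r : ℚ, r ^ 2 ≠ (a : ℚ) + (b : ℚ) * r) := by
  refine ⟨fun r hr ↦ ?_⟩
  have h1 : ((b : ℚ) ^ 2 + 4 * a) < 0 := by exact_mod_cast h.neg
  nlinarith [sq_nonneg (2 * r - b)]

theorem exists_int (h : IsImaginaryQuadraticPair a b) {x y : ℚ} {T N : ℤ} (hT : 2 * x + b * y = T)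
    (hN : x ^ 2 + b * x * y - a * y ^ 2 = N) : ∃ m n : ℤ, x = m ∧ y = n := by
  have key : ((b : ℚ) ^ 2 + 4 * a) * y ^ 2 = T ^ 2 - 4 * N := by
    rw [← hT, ← hN]; ring
  rcases h.cases with ⟨rfl, hsq⟩ | ⟨rfl, hsq, ha⟩
  · obtain ⟨n, rfl⟩ := hsq.exists_int_of_mul_sq (y := y) (N := T ^ 2 - 4 * N)
      (by push_cast at key ⊢; exact key)
    have h2 : ((1 : ℤ) ^ 2 + 4 * a) * n ^ 2 = T ^ 2 - 4 * N := by exact_mod_cast key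
    have h3 : (T - n) % 2 = 0 := by
      have h4 : (T - n) * (T + n) = 4 * (a * n ^ 2 + N) := by linarith
      rcases Int.emod_two_eq_zero_or_one (T - n) with h5 | h5
      · exact h5
      · have h6 : ((T - n) * (T + n)) % 2 = 1 := by
          rw [Int.mul_emod, h5, show (T + n) % 2 = 1 by omega]; rfl
        omega
    obtain ⟨m, hm⟩ := Int.dvd_of_emod_eq_zero h3
    refine ⟨m, n, ?_, rfl⟩
    have : (T : ℚ) - n = 2 * m := by exact_mod_cast hm
    push_cast at hT
    linarith
  · obtain ⟨Y, hY⟩ := hsq.exists_int_of_mul_sq (y := 2 * y) (N := T ^ 2 - 4 * N)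
      (by push_cast at key ⊢; linarith)
    have h2 : a * Y ^ 2 = T ^ 2 - 4 * N := by
      have : (a : ℚ) * Y ^ 2 = T ^ 2 - 4 * N := by
        rw [← hY]; push_cast at key; linarith
      exact_mod_cast this
    have hmod : T % 2 = 0 ∧ Y % 2 = 0 := by
      have h3 : (T ^ 2 - a * Y ^ 2) % 4 = 0 := by omega
      have h4 : (T ^ 2 - a * Y ^ 2) % 4 =
          ((T % 4) ^ 2 - (a % 4) * (Y % 4) ^ 2) % 4 := by
        simp [Int.sub_emod, Int.mul_emod, pow_two]
      rw [h4] at h3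
      have hT4 : T % 4 = 0 ∨ T % 4 = 1 ∨ T % 4 = 2 ∨ T % 4 = 3 := by omega
      have hY4 : Y % 4 = 0 ∨ Y % 4 = 1 ∨ Y % 4 = 2 ∨ Y % 4 = 3 := by omega
      rcases ha with ha | ha <;> rcases hT4 with h5 | h5 | h5 | h5 <;>
        rcases hY4 with h6 | h6 | h6 | h6 <;> rw [ha, h5, h6] at h3 <;> omega
    obtain ⟨m, hm⟩ := Int.dvd_of_emod_eq_zero hmod.1
    obtain ⟨n, hn⟩ := Int.dvd_of_emod_eq_zero hmod.2
    refine ⟨m, n, ?_, ?_⟩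
    · have : (T : ℚ) = 2 * m := by exact_mod_cast hm
      push_cast at hT
      linarith
    · have : (Y : ℚ) = 2 * n := by exact_mod_cast hn
      linarith

/-- The inclusion of the order into the field. -/
def toField (a b : ℤ) : QuadraticAlgebra ℤ a b →+* QuadraticAlgebra ℚ (a : ℚ) (b : ℚ) where
  toFun z := ⟨z.re, z.im⟩
  map_one' := by ext <;> simp
  map_zero' := by ext <;> simp
  map_add' z w := by ext <;> simp
  map_mul' z w := by ext <;> simp

theorem isIntegral_int_iff (h : IsImaginaryQuadraticPair a b)
    (z : QuadraticAlgebra ℚ (a : ℚ) (b : ℚ)) : IsIntegral ℤ z ↔ ∃ w, toField a b w = z := by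
  constructor
  · intro hz
    have hs : IsIntegral ℤ (star z) := by
      have := hz.map (starRingEnd (QuadraticAlgebra ℚ (a : ℚ) (b : ℚ))).toIntAlgHom
      exact this
    have int_of {r : ℚ} (hr : IsIntegral ℤ (algebraMap ℚ (QuadraticAlgebra ℚ (a : ℚ) (b : ℚ)) r)) :
        ∃ n : ℤ, r = n := by
      have h1 := (isIntegral_algebraMap_iff (algebraMap_injective)).1 hr
      obtain ⟨n, hn⟩ := IsIntegrallyClosed.isIntegral_iff.1 h1
      exact ⟨n, by simpa using hn.symm⟩
    obtain ⟨T, hT⟩ := int_of (r := z.trace) (by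
      rw [algebraMap_trace_eq_add_star]; exact hz.add hs)
    obtain ⟨N, hN⟩ := int_of (r := z.norm) (by
      rw [algebraMap_norm_eq_mul_star]; exact hz.mul hs)
    obtain ⟨m, n, hm, hn⟩ := h.exists_int (x := z.re) (y := z.im) (T := T) (N := N)
      (by rw [← hT, trace_def]) (by rw [← hN, norm_def]; ring)
    exact ⟨⟨m, n⟩, by ext <;> simp [toField, hm, hn]⟩
  · rintro ⟨w, rfl⟩
    have : IsIntegral ℤ w := Algebra.IsIntegral.isIntegral w
    exact this.map (toField a b).toIntAlgHom

end IsImaginaryQuadraticPair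

end ImaginaryQuadraticField

section ImaginaryQuadraticField

open QuadraticAlgebra Module

theorem QuadraticAlgebra.discr_basis {R : Type*} [CommRing R] (a b : R) :
    Algebra.discr R (QuadraticAlgebra.basis a b) = b ^ 2 + 4 * a := by
  have htr : ∀ z : QuadraticAlgebra R a b, Algebra.trace R _ z = 2 * z.re + b * z.im := by
    intro z
    rw [Algebra.trace_eq_matrix_trace (QuadraticAlgebra.basis a b)]
    simp [Matrix.trace, Fin.sum_univ_two, Algebra.leftMulMatrix_eq_repr_mul, QuadraticAlgebra.basis]
    ring
  rw [Algebra.discr_def, Matrix.det_fin_two]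
  simp only [Algebra.traceMatrix_apply, Algebra.traceForm_apply, htr]
  simp [QuadraticAlgebra.basis]
  ring

namespace IsImaginaryQuadraticPair

variable {a b : ℤ}

theorem exists_numberField (h : IsImaginaryQuadraticPair a b) :
    ∃ (K : Type) (_ : Field K) (_ : NumberField K), finrank ℚ K = 2 ∧
      NumberField.discr K = b ^ 2 + 4 * a ∧ Nonempty (QuadraticAlgebra ℤ a b ≃+* 𝓞 K) := by
  have := h.fact
  let K := QuadraticAlgebra ℚ (a : ℚ) (b : ℚ)
  have : CharZero K := inferInstance
  have hfin : Module.Finite ℚ K := by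
    convert (inferInstance : @Module.Finite ℚ K _ _ (QuadraticAlgebra.instModule)) 
  have hrank : finrank ℚ K = 2 := by
    convert QuadraticAlgebra.finrank_eq_two (R := ℚ) (a : ℚ) (b : ℚ)
  have : NumberField K := { to_charZero := inferInstance, to_finiteDimensional := hfin }
  let : Algebra (QuadraticAlgebra ℤ a b) K := (toField a b).toAlgebra
  have : IsIntegralClosure (QuadraticAlgebra ℤ a b) ℤ K :=
    { algebraMap_injective := by
        intro x y hxy
        have h1 := congrArg QuadraticAlgebra.re hxy
        have h2 := congrArg QuadraticAlgebra.im hxy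
        ext
        · exact Int.cast_injective (α := ℚ) h1
        · exact Int.cast_injective (α := ℚ) h2
      isIntegral_iff := by
        intro x
        exact h.isIntegral_int_iff x }
  let e : QuadraticAlgebra ℤ a b ≃ₐ[ℤ] 𝓞 K := IsIntegralClosure.equiv ℤ _ K _
  refine ⟨K, inferInstance, inferInstance, hrank, ?_, ⟨e.toRingEquiv⟩⟩
  rw [← NumberField.discr_eq_discr K ((QuadraticAlgebra.basis a b).map e.toLinearEquiv),
    ← QuadraticAlgebra.discr_basis, Algebra.discr_eq_discr_of_algEquiv _ e]
  rfl

end IsImaginaryQuadraticPair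

end ImaginaryQuadraticField

section ImaginaryQuadraticResidue

open NumberField.InfinitePlace NumberField.Units Real

theorem NumberField.dedekindZeta_residue_le_of_imaginary_quadratic {K : Type*} [Field K]
    [NumberField K] (hK : Module.finrank ℚ K = 2) (hD : NumberField.discr K < 0) :
    dedekindZeta_residue K ≤ π * classNumber K / √|(NumberField.discr K : ℝ)| := by
  have hcard := card_add_two_mul_card_eq_rank K
  have hsign := sign_discr K
  rw [Int.sign_eq_neg_one_of_neg hD] at hsign
  have hc : nrComplexPlaces K = 1 := by
    have : nrComplexPlaces K ≠ 0 := by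
      intro h0
      rw [h0] at hsign
      norm_num at hsign
    omega
  have hr : nrRealPlaces K = 0 := by omega
  have hrank : rank K = 0 := by
    rw [rank, card_eq_nrRealPlaces_add_nrComplexPlaces, hc, hr]
  have hreg : regulator K = 1 := by
    have : IsEmpty (Fin (rank K)) := by rw [hrank]; infer_instance
    have : IsEmpty {w : InfinitePlace K // w ≠ dirichletUnitTheorem.w₀} :=
      (Units.equivFinRank K).symm.isEmpty
    rw [regulator_eq_det' K]
    simp
  have htors : (2 : ℝ) ≤ torsionOrder K := by
    have := even_torsionOrder K
    have h2 := torsionOrder_pos K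
    exact_mod_cast (show 2 ≤ torsionOrder K by grind)
  have hsqrt : 0 < √|(NumberField.discr K : ℝ)| :=
    Real.sqrt_pos.2 (abs_pos.2 (by exact_mod_cast hD.ne))
  rw [dedekindZeta_residue_def, hr, hc, hreg]
  rw [div_le_div_iff₀ (by positivity) hsqrt]
  have : 0 ≤ π * classNumber K * √|(NumberField.discr K : ℝ)| := by positivity
  simp only [pow_zero, one_mul, pow_one, mul_one]
  nlinarith

end ImaginaryQuadraticResidue

section TwoTorsion

open QuadraticAlgebra

theorem Nat.card_le_pow_of_pow_two_pow_eq_one {G : Type*} [CommGroup G] [Finite G] {k : ℕ}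
    (hk : Nat.card {g : G // g ^ 2 = 1} ≤ k) {n : ℕ} (hG : ∀ g : G, g ^ 2 ^ n = 1) :
    Nat.card G ≤ k ^ n := by
  classical
  have := Fintype.ofFinite G
  have hfib (h : G) : (Finset.univ.filter fun g : G ↦ g ^ 2 = h).card ≤ k := by
    rcases (Finset.univ.filter fun g : G ↦ g ^ 2 = h).eq_empty_or_nonempty with h0 | ⟨g₀, hg₀⟩
    · simp [h0]
    refine le_trans ?_ hk
    rw [Nat.card_eq_fintype_card, Fintype.card_subtype]
    refine Finset.card_le_card_of_injOn (fun g ↦ g * g₀⁻¹) (fun g hg ↦ ?_)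
      (fun x _ y _ hxy ↦ mul_right_cancel hxy)
    simp only [Finset.coe_filter, Finset.mem_univ, true_and, Set.mem_ofPred_eq,
      Finset.mem_filter] at hg hg₀ ⊢
    rw [mul_pow, inv_pow, hg, hg₀, mul_inv_cancel]
  have main (m : ℕ) : (Finset.univ.filter fun g : G ↦ g ^ 2 ^ m = 1).card ≤ k ^ m := by
    induction m with
    | zero =>
      simp only [pow_zero, pow_one]
      exact Finset.card_le_one.2 (by simp)
    | succ m ih =>
      calc _ ≤ k * (Finset.univ.filter fun g : G ↦ g ^ 2 ^ m = 1).card := by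
            refine Finset.card_le_mul_card_image_of_maps_to (f := fun g ↦ g ^ 2) ?_ _ ?_
            · intro g hg
              simpa [← pow_mul, ← pow_succ'] using hg
            · intro h _
              exact (Finset.card_le_card
                (Finset.filter_subset_filter _ (Finset.filter_subset _ _))).trans (hfib h)
        _ ≤ k ^ (m + 1) := by rw [pow_succ']; gcongr
  have := main n
  rwa [Finset.filter_true_of_mem fun g _ ↦ hG g, Finset.card_univ,
    ← Nat.card_eq_fintype_card] at this

theorem QuadraticAlgebra.algebraNorm_eq_norm {R : Type*} [CommRing R] {a b : R}
    (z : QuadraticAlgebra R a b) : Algebra.norm R z = z.norm := by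
  rw [← det_toLinearMap_eq_norm, Algebra.norm_apply]
  rfl

theorem QuadraticAlgebra.norm_pos_of_neg {a b : ℤ} (h : b ^ 2 + 4 * a < 0)
    {z : QuadraticAlgebra ℤ a b} (hz : z ≠ 0) : 0 < z.norm := by
  rw [norm_def]
  by_contra hle
  have h1 : (2 * z.re + b * z.im) ^ 2 + (-(b ^ 2 + 4 * a)) * z.im ^ 2 ≤ 0 := by nlinarith
  have h2 : z.im = 0 := by
    by_contra h0
    have := sq_pos_of_ne_zero h0
    nlinarith [sq_nonneg (2 * z.re + b * z.im)]
  have h3 : z.re = 0 := by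
    rw [h2] at h1
    have : z.re ^ 2 ≤ 0 := by nlinarith
    exact pow_eq_zero_iff two_ne_zero |>.1 (le_antisymm this (sq_nonneg _))
  exact hz (by ext <;> simp [h2, h3])

namespace IsImaginaryQuadraticPair

variable {a b : ℤ} [IsDedekindDomain (QuadraticAlgebra ℤ a b)]

/-- Every ideal class of order at most two contains an ideal whose square is generated by a positive
rational integer. -/
theorem exists_sq_eq_span_natCast (h : IsImaginaryQuadraticPair a b)
    {c : ClassGroup (QuadraticAlgebra ℤ a b)} (hc : c ^ 2 = 1) :
    ∃ (J : nonZeroDivisors (Ideal (QuadraticAlgebra ℤ a b))) (n : ℕ), n ≠ 0 ∧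
      (J : Ideal (QuadraticAlgebra ℤ a b)) ^ 2 = Ideal.span {(n : QuadraticAlgebra ℤ a b)} ∧
      ClassGroup.mk0 J = c := by
  obtain ⟨I, rfl⟩ := ClassGroup.mk0_surjective c
  rw [← map_pow, ClassGroup.mk0_eq_one_iff] at hc
  obtain ⟨α, hα⟩ := (Submodule.isPrincipal_iff _).1 hc
  have hI : (I : Ideal (QuadraticAlgebra ℤ a b)) ≠ 0 := nonZeroDivisors.coe_ne_zero I
  change (I : Ideal (QuadraticAlgebra ℤ a b)) ^ 2 = Ideal.span {α} at hα
  have hα0 : α ≠ 0 := by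
    rintro rfl
    simp only [Ideal.span_singleton_zero] at hα
    exact pow_ne_zero 2 hI hα
  have hnorm : α.norm = (Ideal.absNorm (I : Ideal (QuadraticAlgebra ℤ a b)) : ℤ) ^ 2 := by
    have h1 := congrArg Ideal.absNorm hα
    rw [map_pow, Ideal.absNorm_span_singleton, algebraNorm_eq_norm] at h1
    have h2 := norm_pos_of_neg h.neg hα0
    zify at h1
    rw [abs_of_pos h2] at h1
    exact h1.symm
  set k := Ideal.absNorm (I : Ideal (QuadraticAlgebra ℤ a b)) with hk
  have hk0 : k ≠ 0 := Ideal.absNorm_ne_zero_of_nonZeroDivisors I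
  have hmul : α * star α = (k : QuadraticAlgebra ℤ a b) ^ 2 := by
    rw [← algebraMap_norm_eq_mul_star, hnorm]
    simp
  by_cases hg : (k : QuadraticAlgebra ℤ a b) + star α = 0
  · refine ⟨I, k, hk0, ?_, rfl⟩
    have : α = -(k : QuadraticAlgebra ℤ a b) := by
      have := congrArg star hg
      simp only [star_add, star_natCast, star_star, star_zero] at this
      linear_combination this
    rw [hα, this, Ideal.span_singleton_neg]
  · have hg' : Ideal.span {(k : QuadraticAlgebra ℤ a b) + star α} ∈
        nonZeroDivisors (Ideal (QuadraticAlgebra ℤ a b)) :=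
      mem_nonZeroDivisors_of_ne_zero (by simpa using hg)
    have hsq : ((⟨_, hg'⟩ * I : nonZeroDivisors (Ideal (QuadraticAlgebra ℤ a b))) :
        Ideal (QuadraticAlgebra ℤ a b)) ^ 2 =
        Ideal.span {(((k ^ 2 * (α.trace + 2 * k) : ℤ)) : QuadraticAlgebra ℤ a b)} := by
      rw [Submonoid.coe_mul, mul_pow, hα, Ideal.span_singleton_pow,
        Ideal.span_singleton_mul_span_singleton]
      congr 2
      have htr : (α.trace : QuadraticAlgebra ℤ a b) = α + star α := by
        rw [← algebraMap_trace_eq_add_star]; simp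
      push_cast
      rw [htr]
      linear_combination (2 * (k : QuadraticAlgebra ℤ a b) + star α) * hmul
    refine ⟨⟨_, hg'⟩ * I, (k ^ 2 * (α.trace + 2 * k) : ℤ).natAbs, ?_, ?_, ?_⟩
    · intro h0
      rw [Int.natAbs_eq_zero] at h0
      rw [h0] at hsq
      simp only [Int.cast_zero, Ideal.span_singleton_zero] at hsq
      exact pow_ne_zero 2 (nonZeroDivisors.coe_ne_zero _) hsq
    · rw [hsq]
      rcases Int.natAbs_eq (k ^ 2 * (α.trace + 2 * k) : ℤ) with h1 | h1
      · conv_lhs => rw [h1]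
        simp
      · conv_lhs => rw [h1]
        rw [Int.cast_neg, Ideal.span_singleton_neg]
        simp
    · rw [map_mul, (ClassGroup.mk0_eq_one_iff hg').2 ⟨⟨_, rfl⟩⟩, one_mul]

theorem mk0_eq_mk0_of_sq {J₁ J₂ : nonZeroDivisors (Ideal (QuadraticAlgebra ℤ a b))} {n₁ n₂ k : ℕ}
    (h₁ : (J₁ : Ideal (QuadraticAlgebra ℤ a b)) ^ 2 = Ideal.span {(n₁ : QuadraticAlgebra ℤ a b)})
    (h₂ : (J₂ : Ideal (QuadraticAlgebra ℤ a b)) ^ 2 = Ideal.span {(n₂ : QuadraticAlgebra ℤ a b)})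
    (hk : n₁ * n₂ = k * k) : ClassGroup.mk0 J₁ = ClassGroup.mk0 J₂ := by
  have hinv : (ClassGroup.mk0 J₂) = (ClassGroup.mk0 J₂)⁻¹ := by
    rw [eq_inv_iff_mul_eq_one, ← sq, ← map_pow, ClassGroup.mk0_eq_one_iff]
    exact ⟨⟨_, h₂⟩⟩
  rw [hinv, eq_inv_iff_mul_eq_one, ← map_mul, ClassGroup.mk0_eq_one_iff]
  have h3 : ((J₁ * J₂ : nonZeroDivisors (Ideal (QuadraticAlgebra ℤ a b))) :
      Ideal (QuadraticAlgebra ℤ a b)) ^ 2 = Ideal.span {(k : QuadraticAlgebra ℤ a b)} ^ 2 := by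
    rw [Submonoid.coe_mul, mul_pow, h₁, h₂, Ideal.span_singleton_mul_span_singleton,
      Ideal.span_singleton_pow, sq]
    congr 2
    exact_mod_cast hk
  have h4 := dvd_antisymm
    ((UniqueFactorizationMonoid.pow_dvd_pow_iff_dvd two_ne_zero).1 h3.dvd)
    ((UniqueFactorizationMonoid.pow_dvd_pow_iff_dvd two_ne_zero).1 h3.symm.dvd)
  exact ⟨⟨_, h4⟩⟩

/-- If the square of an ideal is generated by `n`, then the primes occurring to an odd power
in `n` are ramified. -/
theorem dvd_discr_of_odd_factorization {J : Ideal (QuadraticAlgebra ℤ a b)} {n p : ℕ} (hn : n ≠ 0)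
    (hJ : J ^ 2 = Ideal.span {(n : QuadraticAlgebra ℤ a b)}) (hp : p.Prime)
    (hodd : Odd (n.factorization p)) : (p : ℤ) ∣ b ^ 2 + 4 * a := by
  obtain ⟨k, hk⟩ := hodd
  obtain ⟨e, m, hpm, hm⟩ := Nat.exists_eq_pow_mul_and_not_dvd hn p hp.ne_one
  have he : e = 2 * k + 1 := by
    rw [← hk, hm, Nat.factorization_mul (by simp [hp.ne_zero]) (by rintro rfl; simp at hpm),
      hp.factorization_pow]
    simp [Nat.factorization_eq_zero_of_not_dvd hpm]
  have hp0 : (p : QuadraticAlgebra ℤ a b) ≠ 0 := by exact_mod_cast hp.ne_zero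
  have hpk : Ideal.span {(p : QuadraticAlgebra ℤ a b) ^ k} ≠ 0 := by simpa using pow_ne_zero k hp0
  have hn' : Ideal.span {(n : QuadraticAlgebra ℤ a b)} =
      Ideal.span {(p : QuadraticAlgebra ℤ a b) ^ k} ^ 2 *
        Ideal.span {((p * m : ℕ) : QuadraticAlgebra ℤ a b)} := by
    rw [Ideal.span_singleton_pow, Ideal.span_singleton_mul_span_singleton, hm, he]
    congr 2
    push_cast
    ring
  obtain ⟨J', hJ'⟩ := (UniqueFactorizationMonoid.pow_dvd_pow_iff_dvd two_ne_zero).1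
    (show Ideal.span {(p : QuadraticAlgebra ℤ a b) ^ k} ^ 2 ∣ J ^ 2 from ⟨_, hJ.trans hn'⟩)
  have hsq : J' ^ 2 = Ideal.span {((p * m : ℕ) : QuadraticAlgebra ℤ a b)} := by
    apply mul_left_cancel₀ (pow_ne_zero 2 hpk)
    rw [← hn', ← hJ, hJ', mul_pow]
  by_contra hD
  have hpZ : Prime (p : ℤ) := Nat.prime_iff_prime_int.1 hp
  have hdvd (z : QuadraticAlgebra ℤ a b) :
      (p : QuadraticAlgebra ℤ a b) ∣ z ↔ (p : ℤ) ∣ z.re ∧ (p : ℤ) ∣ z.im := by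
    rw [← algebraMap_dvd_iff]; simp
  have hle : J' ≤ Ideal.span {(p : QuadraticAlgebra ℤ a b)} := by
    intro z hz
    rw [Ideal.mem_span_singleton, hdvd]
    have h1 : z ^ 2 ∈ J' ^ 2 := Ideal.pow_mem_pow hz 2
    rw [hsq, Ideal.mem_span_singleton, Nat.cast_mul] at h1
    obtain ⟨h2, h3⟩ := (hdvd _).1 (dvd_of_mul_right_dvd h1)
    simp only [sq, re_mul, im_mul] at h2 h3
    have h4 : (p : ℤ) ∣ z.im := by
      by_contra h5
      have h6 : (p : ℤ) ∣ 2 * z.re + b * z.im :=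
        (hpZ.dvd_or_dvd (show (p : ℤ) ∣ z.im * (2 * z.re + b * z.im) by
          convert h3 using 1; ring)).resolve_left h5
      have h7 : (p : ℤ) ∣ (b ^ 2 + 4 * a) * z.im ^ 2 := by
        have : (b ^ 2 + 4 * a) * z.im ^ 2 = 4 * (z.re * z.re + a * z.im * z.im) -
          (2 * z.re + b * z.im) * (2 * z.re - b * z.im) := by ring
        rw [this]
        exact dvd_sub (h2.mul_left _) (h6.mul_right _)
      exact (hpZ.dvd_or_dvd h7).elim hD fun h8 ↦ h5 (hpZ.dvd_of_dvd_pow h8)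
    refine ⟨?_, h4⟩
    have h5 := (dvd_add_left ((h4.mul_left (a * z.im)))).1 h2
    exact (hpZ.dvd_or_dvd h5).elim id id
  have h1 := pow_dvd_pow_of_dvd (Ideal.dvd_iff_le.2 hle) 2
  rw [hsq, Ideal.span_singleton_pow, Ideal.dvd_span_singleton, Ideal.mem_span_singleton,
    Nat.cast_mul, sq] at h1
  have h2 := (mul_dvd_mul_iff_left hp0).1 h1
  have h3 := ((hdvd _).1 h2).1
  rw [re_natCast] at h3
  exact hpm (by exact_mod_cast h3)

/-- The primes occurring to an odd power determine a number up to squares. -/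
theorem _root_.Nat.exists_mul_self_of_odd_factorization_iff {m n : ℕ} (hm : m ≠ 0) (hn : n ≠ 0)
    (h : ∀ p, p.Prime → (Odd (m.factorization p) ↔ Odd (n.factorization p))) :
    ∃ k, m * n = k * k := by
  have hev : ∀ p, Even ((m * n).factorization p) := by
    intro p
    rw [Nat.factorization_mul hm hn, Finsupp.add_apply]
    by_cases hp : p.Prime
    · have := h p hp
      grind
    · simp [Nat.factorization_eq_zero_of_not_prime _ hp]
  refine ⟨∏ p ∈ (m * n).primeFactors, p ^ ((m * n).factorization p / 2), ?_⟩
  conv_lhs => rw [← Nat.prod_factorization_pow_eq_self (mul_ne_zero hm hn)]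
  rw [Finsupp.prod, Nat.support_factorization, ← Finset.prod_mul_distrib]
  refine Finset.prod_congr rfl fun p _ ↦ ?_
  rw [← pow_add]
  congr 1
  have := hev p
  grind

theorem exists_sq_eq_neg (h : IsImaginaryQuadraticPair a b) (hD : b ^ 2 + 4 * a < -4) :
    ∃ (θ : QuadraticAlgebra ℤ a b) (m : ℕ), θ ^ 2 = -(m : QuadraticAlgebra ℤ a b) ∧
      Squarefree m ∧ 1 < m := by
  rcases h.cases with ⟨rfl, hsq⟩ | ⟨rfl, hsq, -⟩
  · refine ⟨2 * omega - 1, (1 ^ 2 + 4 * a).natAbs, ?_, Int.squarefree_natAbs.2 hsq, by omega⟩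
    ext <;> simp [sq]
    rw [abs_of_nonpos (by omega)]
    ring
  · refine ⟨omega, a.natAbs, ?_, Int.squarefree_natAbs.2 hsq, by omega⟩
    ext <;> simp [sq]
    rw [abs_of_nonpos (by omega), neg_neg]

theorem two_mul_card_two_torsion_le (h : IsImaginaryQuadraticPair a b)
    (hD : b ^ 2 + 4 * a < -4) :
    2 * Nat.card {c : ClassGroup (QuadraticAlgebra ℤ a b) // c ^ 2 = 1} ≤
      2 ^ (b ^ 2 + 4 * a).natAbs.primeFactors.card := by
  classical
  obtain ⟨θ, m, hθ, hm, hm1⟩ := h.exists_sq_eq_neg hD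
  choose J n hn hJ hc using fun c : {c : ClassGroup (QuadraticAlgebra ℤ a b) // c ^ 2 = 1} ↦
    h.exists_sq_eq_span_natCast c.2
  set S := (b ^ 2 + 4 * a).natAbs.primeFactors with hS
  have hm0 : m ≠ 0 := by omega
  have hθ0 : θ ≠ 0 := by
    rintro rfl
    have h0 : (m : QuadraticAlgebra ℤ a b) = 0 := by
      rw [← neg_eq_zero, ← hθ]; simp
    exact hm0 (by exact_mod_cast h0)
  have hθ' : Ideal.span {θ} ∈ nonZeroDivisors (Ideal (QuadraticAlgebra ℤ a b)) :=
    mem_nonZeroDivisors_of_ne_zero (by simpa using hθ0)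
  let I (x : {c : ClassGroup (QuadraticAlgebra ℤ a b) // c ^ 2 = 1} × Bool) :
      nonZeroDivisors (Ideal (QuadraticAlgebra ℤ a b)) := if x.2 then ⟨_, hθ'⟩ * J x.1 else J x.1
  let N (x : {c : ClassGroup (QuadraticAlgebra ℤ a b) // c ^ 2 = 1} × Bool) : ℕ :=
    if x.2 then m * n x.1 else n x.1
  have hI (x) : ClassGroup.mk0 (I x) = x.1 := by
    dsimp only [I]
    split_ifs
    · rw [map_mul, (ClassGroup.mk0_eq_one_iff hθ').2 ⟨⟨_, rfl⟩⟩, one_mul, hc]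
    · rw [hc]
  have hIN (x) : (I x : Ideal (QuadraticAlgebra ℤ a b)) ^ 2 =
      Ideal.span {(N x : QuadraticAlgebra ℤ a b)} := by
    dsimp only [I, N]
    split_ifs
    · rw [Submonoid.coe_mul, mul_pow, hJ, Ideal.span_singleton_pow, hθ, Ideal.span_singleton_neg,
        Ideal.span_singleton_mul_span_singleton, Nat.cast_mul]
    · rw [hJ]
  have hN0 (x) : N x ≠ 0 := by
    dsimp only [N]
    split_ifs
    · exact mul_ne_zero hm0 (hn _)
    · exact hn _
  have hNS (x) {p : ℕ} (hp : p.Prime) (ho : Odd ((N x).factorization p)) : p ∈ S := by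
    rw [hS, Nat.mem_primeFactors]
    exact ⟨hp, Int.natCast_dvd.1 (dvd_discr_of_odd_factorization (hN0 x) (hIN x) hp ho), by omega⟩
  have hsqm : ¬ ∃ k, m = k * k := by
    rintro ⟨k, hk⟩
    have h2 := Nat.isUnit_iff.1 (hm k ⟨1, by rw [← hk, mul_one]⟩)
    rw [h2] at hk
    omega
  have hsqm' {l k : ℕ} (hl : l ≠ 0) (hk : m * l * l = k * k) : False := by
    obtain ⟨r, rfl⟩ := (Nat.pow_dvd_pow_iff two_ne_zero).1
      (show l ^ 2 ∣ k ^ 2 from ⟨m, by rw [sq, sq, ← hk]; ring⟩)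
    refine hsqm ⟨r, ?_⟩
    apply Nat.eq_of_mul_eq_mul_left (Nat.pos_of_ne_zero (mul_ne_zero hl hl))
    linarith
  let F (x : {c : ClassGroup (QuadraticAlgebra ℤ a b) // c ^ 2 = 1} × Bool) : S.powerset :=
    ⟨S.filter fun p ↦ Odd ((N x).factorization p), by simp [Finset.filter_subset]⟩
  have hF : Function.Injective F := by
    intro x y hxy
    have hodd : ∀ p, p.Prime → (Odd ((N x).factorization p) ↔ Odd ((N y).factorization p)) := by
      intro p hp
      have h1 : p ∈ (F x : Finset ℕ) ↔ p ∈ (F y : Finset ℕ) := by rw [hxy]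
      simp only [F, Finset.mem_filter] at h1
      exact ⟨fun ho ↦ (h1.1 ⟨hNS x hp ho, ho⟩).2, fun ho ↦ (h1.2 ⟨hNS y hp ho, ho⟩).2⟩
    obtain ⟨k, hk⟩ := Nat.exists_mul_self_of_odd_factorization_iff (hN0 x) (hN0 y) hodd
    have hxy1 : x.1 = y.1 := by
      apply Subtype.ext
      rw [← hI, ← hI, mk0_eq_mk0_of_sq (hIN x) (hIN y) hk]
    refine Prod.ext hxy1 ?_
    by_contra hne
    dsimp only [N] at hk
    rw [hxy1] at hk
    rcases hx : x.2 <;> rcases hy : y.2 <;> simp only [hx, hy] at hk hne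
    · exact hne trivial
    · exact hsqm' (hn y.1) (k := k) (by simpa [mul_comm, mul_left_comm] using hk)
    · exact hsqm' (hn y.1) (k := k) (by simpa using hk)
    · exact hne trivial
  have hcard := Nat.card_le_card_of_injective F hF
  rwa [Nat.card_prod, Nat.card_eq_fintype_card (α := Bool), Fintype.card_bool, mul_comm,
    Nat.card_eq_fintype_card (α := S.powerset), Fintype.card_coe, Finset.card_powerset] at hcard

/-- A class group of exponent dividing eight is small. -/
theorem card_classGroup_le (h : IsImaginaryQuadraticPair a b) (hD : b ^ 2 + 4 * a < -4)
    [Finite (ClassGroup (QuadraticAlgebra ℤ a b))]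
    (hexp : ∀ c : ClassGroup (QuadraticAlgebra ℤ a b), c ^ 8 = 1) :
    8 * Nat.card (ClassGroup (QuadraticAlgebra ℤ a b)) ≤
      8 ^ (b ^ 2 + 4 * a).natAbs.primeFactors.card := by
  have h1 := Nat.card_le_pow_of_pow_two_pow_eq_one le_rfl (n := 3) hexp
  calc 8 * Nat.card (ClassGroup (QuadraticAlgebra ℤ a b))
      ≤ (2 * Nat.card {c : ClassGroup (QuadraticAlgebra ℤ a b) // c ^ 2 = 1}) ^ 3 := by
        rw [mul_pow]; gcongr; norm_num
    _ ≤ (2 ^ (b ^ 2 + 4 * a).natAbs.primeFactors.card) ^ 3 := by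
        gcongr
        exact h.two_mul_card_two_torsion_le hD
    _ = _ := by rw [← pow_mul, mul_comm, pow_mul]; norm_num

end IsImaginaryQuadraticPair

end TwoTorsion

section IdealCount

open QuadraticAlgebra

/-- The number of ideals of a given norm. -/
noncomputable def idealCount (R : Type*) [CommRing R] [IsDedekindDomain R] [Module.Free ℤ R]
    (n : ℕ) : ℕ :=
  Nat.card {I : Ideal R // Ideal.absNorm I = n}

section General

variable {R : Type*} [CommRing R] [IsDedekindDomain R] [Module.Free ℤ R]

theorem Ideal.eq_mul_sup_span_of_coprime {I J : Ideal R}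
    (h : (Ideal.absNorm I).Coprime (Ideal.absNorm J)) :
    I = I * J ⊔ Ideal.span {(Ideal.absNorm I : R)} := by
  apply le_antisymm
  · have htop : J ⊔ Ideal.span {(Ideal.absNorm I : R)} = ⊤ := by
      rw [Ideal.eq_top_iff_one]
      obtain ⟨u, v, huv⟩ := Nat.isCoprime_iff_coprime.2 h
      have : (1 : R) = v * (Ideal.absNorm J : R) + u * (Ideal.absNorm I : R) := by
        have := congrArg (Int.cast : ℤ → R) huv
        push_cast at this
        rw [← this, add_comm]
      rw [this]
      exact Submodule.add_mem_sup (Ideal.mul_mem_left _ _ (Ideal.absNorm_mem J))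
        (Ideal.mul_mem_left _ _ (Ideal.mem_span_singleton_self _))
    calc I = I * (J ⊔ Ideal.span {(Ideal.absNorm I : R)}) := by rw [htop, Ideal.mul_top]
      _ ≤ _ := by
        rw [Ideal.mul_sup]
        exact sup_le_sup le_rfl Ideal.mul_le_right
  · exact sup_le Ideal.mul_le_left (Ideal.span_singleton_absNorm_le I)

variable [Module.Finite ℤ R] [CharZero R]

instance finite_idealsOfNorm (n : ℕ) : Finite {I : Ideal R // Ideal.absNorm I = n} :=
  Ideal.finite_setOfPred_absNorm_eq n

theorem idealCount_mul_le {m n : ℕ} (h : m.Coprime n) :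
    idealCount R m * idealCount R n ≤ idealCount R (m * n) := by
  rw [idealCount, idealCount, idealCount, ← Nat.card_prod]
  refine Nat.card_le_card_of_injective (fun x ↦ ⟨x.1 * x.2, by rw [map_mul, x.1.2, x.2.2]⟩) ?_
  rintro ⟨⟨I, hI⟩, ⟨J, hJ⟩⟩ ⟨⟨I', hI'⟩, ⟨J', hJ'⟩⟩ hxy
  have hmul : I * J = I' * J' := congrArg Subtype.val hxy
  have h1 : I = I' := by
    rw [Ideal.eq_mul_sup_span_of_coprime (I := I) (J := J) (by rwa [hI, hJ]),
      Ideal.eq_mul_sup_span_of_coprime (I := I') (J := J') (by rwa [hI', hJ']), hmul, hI, hI']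
  have h2 : J = J' := by
    rw [Ideal.eq_mul_sup_span_of_coprime (I := J) (J := I) (by rw [hI, hJ]; exact h.symm),
      Ideal.eq_mul_sup_span_of_coprime (I := J') (J := I') (by rw [hI', hJ']; exact h.symm),
      mul_comm J, mul_comm J', hmul, hJ, hJ']
  subst h1 h2
  rfl

theorem one_le_idealCount {n : ℕ} (I : Ideal R) (h : Ideal.absNorm I = n) : 1 ≤ idealCount R n :=
  have : Nonempty {I : Ideal R // Ideal.absNorm I = n} := ⟨⟨I, h⟩⟩
  Nat.card_pos

theorem succ_le_idealCount_pow {p : ℕ} (hp : p.Prime) {P Q : Ideal R} (hPQ : P ≠ Q)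
    (hP : Ideal.absNorm P = p) (hQ : Ideal.absNorm Q = p) (k : ℕ) :
    k + 1 ≤ idealCount R (p ^ k) := by
  have hprime {P : Ideal R} (hP : Ideal.absNorm P = p) : P.IsPrime :=
    Ideal.isPrime_of_irreducible_absNorm (by rw [hP]; exact hp)
  have hne {P : Ideal R} (hP : Ideal.absNorm P = p) : P ≠ 0 := by
    rintro rfl
    rw [Ideal.zero_eq_bot, Ideal.absNorm_bot] at hP
    exact hp.ne_zero hP.symm
  have hPp := Ideal.prime_of_isPrime (hne hP) (hprime hP)
  have hmax := (hprime hQ).isMaximal (hne hQ)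
  have hndvd : ¬ P ∣ Q := fun hd ↦
    hPQ (hmax.eq_of_le (hprime hP).ne_top (Ideal.dvd_iff_le.1 hd)).symm
  have key {i j : ℕ} (hi : i ≤ k) (hj : j ≤ k)
      (h : P ^ i * Q ^ (k - i) = P ^ j * Q ^ (k - j)) : ¬ i < j := by
    intro hij
    have h1 : P ^ i * Q ^ (k - i) = P ^ i * (P ^ (j - i) * Q ^ (k - j)) := by
      rw [h, ← mul_assoc, ← pow_add, Nat.add_sub_cancel' hij.le]
    have h2 := mul_left_cancel₀ (pow_ne_zero i (hne hP)) h1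
    have h3 : P ∣ Q ^ (k - i) := by
      rw [h2]
      exact (dvd_pow_self P (by omega)).mul_right _
    exact hndvd (hPp.dvd_of_dvd_pow h3)
  have := Nat.card_le_card_of_injective
    (fun i : Fin (k + 1) ↦ (⟨P ^ (i : ℕ) * Q ^ (k - i), by
      rw [map_mul, map_pow, map_pow, hP, hQ, ← pow_add, Nat.add_sub_cancel' (by omega)]⟩ :
        {I : Ideal R // Ideal.absNorm I = p ^ k})) (by
    intro i j hij
    have h := congrArg Subtype.val hij
    apply Fin.ext
    have h1 := key (by omega) (by omega) h
    have h2 := key (by omega) (by omega) h.symm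
    omega)
  simpa [idealCount] using this

end General

variable {a b : ℤ} [IsDedekindDomain (QuadraticAlgebra ℤ a b)]

/-- Reduction modulo `p` at a root of the defining polynomial. -/
theorem QuadraticAlgebra.exists_ideal_of_root {p : ℕ} [Fact p.Prime] {r : ZMod p}
    (hr : r * r = a + b * r) :
    ∃ P : Ideal (QuadraticAlgebra ℤ a b), Ideal.absNorm P = p ∧
      ∀ n : ℤ, (omega : QuadraticAlgebra ℤ a b) - n ∈ P ↔ (n : ZMod p) = r := by
  let φ : QuadraticAlgebra ℤ a b →ₐ[ℤ] ZMod p := QuadraticAlgebra.lift ⟨r, by simpa using hr⟩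
  have hφ : φ omega = r := by simp [φ, QuadraticAlgebra.lift]
  have hsurj : Function.Surjective φ := by
    intro x
    obtain ⟨n, rfl⟩ := ZMod.intCast_surjective x
    exact ⟨n, by simp⟩
  refine ⟨RingHom.ker φ, ?_, fun n ↦ ?_⟩
  · rw [Ideal.absNorm_apply, Submodule.cardQuot_apply]
    exact (Nat.card_congr (RingHom.quotientKerEquivOfSurjective
      (f := (φ : QuadraticAlgebra ℤ a b →+* ZMod p)) hsurj).toEquiv).trans (Nat.card_zmod p)
  · rw [RingHom.mem_ker, map_sub, hφ, map_intCast, sub_eq_zero, eq_comm]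

theorem QuadraticAlgebra.sum_jacobiSym_pow_le_idealCount {p : ℕ} (hp : p.Prime) (hp2 : p ≠ 2)
    (k : ℕ) : ∑ i ∈ Finset.range (k + 1), jacobiSym (b ^ 2 + 4 * a) p ^ i ≤
      idealCount (QuadraticAlgebra ℤ a b) (p ^ k) := by
  have := Fact.mk hp
  have h2 : (2 : ZMod p) ≠ 0 := by
    intro h0
    have : ((2 : ℕ) : ZMod p) = 0 := by exact_mod_cast h0
    rw [ZMod.natCast_eq_zero_iff] at this
    exact hp2 ((Nat.prime_dvd_prime_iff_eq hp Nat.prime_two).1 this)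
  have root {s : ZMod p} (hs : (b ^ 2 + 4 * a : ZMod p) = s * s) :
      ((b + s) / 2) * ((b + s) / 2) = (a + b * ((b + s) / 2) : ZMod p) := by
    field_simp
    linear_combination -hs
  rw [← jacobiSym.legendreSym.to_jacobiSym]
  by_cases h0 : ((b ^ 2 + 4 * a : ℤ) : ZMod p) = 0
  · rw [(legendreSym.eq_zero_iff p _).2 h0]
    obtain ⟨P, hP, -⟩ := exists_ideal_of_root (a := a) (b := b)
      (root (s := 0) (by push_cast at h0; simpa using h0))
    have := one_le_idealCount (P ^ k) (n := p ^ k) (by rw [map_pow, hP])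
    rw [Finset.sum_range_succ']
    simpa using this
  rcases legendreSym.eq_one_or_neg_one p h0 with h1 | h1
  · obtain ⟨s, hs⟩ := (legendreSym.eq_one_iff p h0).1 h1
    have hs0 : s ≠ 0 := by
      rintro rfl
      exact h0 (by simpa using hs)
    push_cast at hs
    obtain ⟨P, hP, hPr⟩ := exists_ideal_of_root (root hs)
    obtain ⟨Q, hQ, hQr⟩ := exists_ideal_of_root (root (s := -s) (by simpa using hs))
    have hPQ : P ≠ Q := by
      rintro rfl
      obtain ⟨n, hn⟩ := ZMod.intCast_surjective ((b + s) / 2 : ZMod p)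
      have h3 := (hQr n).1 ((hPr n).2 hn)
      rw [hn] at h3
      field_simp at h3
      have h4 : 2 * s = 0 := by linear_combination h3
      exact (mul_ne_zero h2 hs0) h4
    rw [h1]
    simpa using (by exact_mod_cast succ_le_idealCount_pow hp hPQ hP hQ k :
      ((k : ℤ) + 1) ≤ idealCount (QuadraticAlgebra ℤ a b) (p ^ k))
  · rw [h1]
    rcases Nat.even_or_odd k with hk | hk
    · obtain ⟨j, hj⟩ := hk
      have := one_le_idealCount (R := QuadraticAlgebra ℤ a b)
        (Ideal.span {(p : QuadraticAlgebra ℤ a b)} ^ j) (n := p ^ k) (by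
          rw [map_pow, Ideal.absNorm_span_singleton, algebraNorm_eq_norm, norm_natCast, hj,
            Int.natAbs_pow, Int.natAbs_natCast, ← pow_mul, two_mul])
      rw [neg_one_geom_sum, if_neg (by grind)]
      exact_mod_cast this
    · rw [neg_one_geom_sum, if_pos (by grind)]
      positivity

end IdealCount

section LValueBound

open ArithmeticFunction Filter Topology
open scoped ArithmeticFunction.zeta

section

variable {a b : ℤ} [IsDedekindDomain (QuadraticAlgebra ℤ a b)] {q : ℝ}

theorem zeta_mul_oddJacobi_le_idealCount_of_odd
    (hf : IsQuadraticCharacter (oddJacobi (b ^ 2 + 4 * a)) q) {m : ℕ} (hm : Odd m) :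
    ((ζ : ArithmeticFunction ℤ) * hf.toArith) m ≤ idealCount (QuadraticAlgebra ℤ a b) m := by
  induction m using Nat.recOnPosPrimePosCoprime with
  | zero => simp at hm
  | one =>
    rw [hf.zeta_mul_isMultiplicative.1]
    exact_mod_cast one_le_idealCount ⊤ Ideal.absNorm_top
  | prime_pow p n hp hn =>
    have hp2 : p ≠ 2 := by
      rintro rfl
      exact absurd hm (by simp [Nat.odd_pow_iff hn.ne'])
    rw [hf.zeta_mul_prime_pow hp, oddJacobi_of_odd _ (hp.odd_of_ne_two hp2)]
    exact QuadraticAlgebra.sum_jacobiSym_pow_le_idealCount hp hp2 n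
  | coprime m n _ _ hmn ihm ihn =>
    rw [Nat.odd_mul] at hm
    rw [hf.zeta_mul_isMultiplicative.2 hmn]
    calc _ ≤ (idealCount (QuadraticAlgebra ℤ a b) m * idealCount (QuadraticAlgebra ℤ a b) n : ℤ) :=
          mul_le_mul (ihm hm.1) (ihn hm.2) (hf.zeta_mul_nonneg n) (by positivity)
      _ ≤ _ := by exact_mod_cast idealCount_mul_le hmn

theorem idealCount_le_idealCount_two_pow_mul {m j : ℕ} (hm : Odd m) (hj : Even j) :
    idealCount (QuadraticAlgebra ℤ a b) m ≤ idealCount (QuadraticAlgebra ℤ a b) (2 ^ j * m) := by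
  obtain ⟨i, rfl⟩ := hj
  refine le_trans ?_ (idealCount_mul_le (hm.coprime_two_left.pow_left _))
  refine Nat.le_mul_of_pos_left _
    (one_le_idealCount (Ideal.span {((2 : ℕ) : QuadraticAlgebra ℤ a b)} ^ i) ?_)
  rw [map_pow, Ideal.absNorm_span_singleton, QuadraticAlgebra.algebraNorm_eq_norm,
    QuadraticAlgebra.norm_natCast, Int.natAbs_pow, Int.natAbs_natCast, ← pow_mul, two_mul]

theorem zeta_mul_oddJacobi_le_idealCount
    (hf : IsQuadraticCharacter (oddJacobi (b ^ 2 + 4 * a)) q) {n : ℕ} (hn : n ≠ 0) :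
    ((ζ : ArithmeticFunction ℤ) * hf.toArith) n ≤ idealCount (QuadraticAlgebra ℤ a b) n +
      if Even n then (idealCount (QuadraticAlgebra ℤ a b) (n / 2) : ℤ) else 0 := by
  obtain ⟨j, m, hm, rfl⟩ := Nat.exists_eq_two_pow_mul_odd hn
  have h2 : ((ζ : ArithmeticFunction ℤ) * hf.toArith) (2 ^ j) = 1 := by
    rw [hf.zeta_mul_prime_pow Nat.prime_two, Finset.sum_range_succ']
    simp [oddJacobi]
  rw [hf.zeta_mul_isMultiplicative.2 (hm.coprime_two_left.pow_left _), h2, one_mul]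
  refine (zeta_mul_oddJacobi_le_idealCount_of_odd hf hm).trans ?_
  rcases Nat.even_or_odd j with hj | hj
  · have : (idealCount (QuadraticAlgebra ℤ a b) m : ℤ) ≤ _ :=
      Nat.cast_le.2 (idealCount_le_idealCount_two_pow_mul hm hj)
    split_ifs
    · exact this.trans (le_add_of_nonneg_right (by positivity))
    · simpa using this
  · obtain ⟨i, rfl⟩ := hj
    have he : Even (2 ^ (2 * i + 1) * m) := by simp [Nat.even_pow]
    have hd : 2 ^ (2 * i + 1) * m / 2 = 2 ^ (2 * i) * m := by
      rw [pow_succ, mul_right_comm, Nat.mul_div_cancel _ two_pos]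
    have : (idealCount (QuadraticAlgebra ℤ a b) m : ℤ) ≤ _ :=
      Nat.cast_le.2 (idealCount_le_idealCount_two_pow_mul hm (even_two_mul i))
    rw [if_pos he, hd]
    exact this.trans (le_add_of_nonneg_left (by positivity))

end

theorem IsDedekindDomain.of_ringEquiv {R S : Type*} [CommRing R] [IsDedekindDomain R] [CommRing S]
    (e : R ≃+* S) : IsDedekindDomain S :=
  have := e.symm.toMulEquiv.isDomain
  have := isNoetherianRing_of_ringEquiv R e
  have := Ring.DimensionLEOne.of_ringEquiv e.symm
  have := IsIntegrallyClosed.of_equiv e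
  { }

theorem idealCount_congr {R S : Type*} [CommRing R] [IsDedekindDomain R] [Module.Free ℤ R]
    [CommRing S] [IsDedekindDomain S] [Module.Free ℤ S] (e : R ≃+* S) (n : ℕ) :
    idealCount R n = idealCount S n := by
  let E : Ideal R ≃ Ideal S :=
    { toFun := Ideal.map (e : R →+* S)
      invFun := Ideal.map (e.symm : S →+* R)
      left_inv := fun I ↦ Ideal.map_of_equiv e
      right_inv := fun I ↦ Ideal.map_of_equiv e.symm }
  refine Nat.card_congr (E.subtypeEquiv fun I ↦ ?_)
  suffices Ideal.absNorm (E I) = Ideal.absNorm I by rw [this]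
  rw [Ideal.absNorm_apply, Submodule.cardQuot_apply, Ideal.absNorm_apply, Submodule.cardQuot_apply]
  exact (Nat.card_congr (Ideal.quotientEquiv I (E I) e rfl).toEquiv).symm

theorem LSeries.term_ofReal (u : ℕ → ℝ) {s : ℝ} (hs : s ≠ 0) (n : ℕ) :
    LSeries.term (fun n ↦ (u n : ℂ)) s n = ((u n * (n : ℝ) ^ (-s) : ℝ) : ℂ) := by
  rcases eq_or_ne n 0 with rfl | hn
  · simp [Real.zero_rpow (neg_ne_zero.2 hs)]
  · rw [LSeries.term_of_ne_zero hn, Complex.ofReal_mul, Complex.ofReal_cpow (by positivity)]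
    push_cast
    rw [Complex.cpow_neg, div_eq_mul_inv]

theorem LSeriesSummable_ofReal_iff (u : ℕ → ℝ) {s : ℝ} (hs : s ≠ 0) :
    LSeriesSummable (fun n ↦ (u n : ℂ)) s ↔ Summable fun n ↦ u n * (n : ℝ) ^ (-s) := by
  rw [LSeriesSummable, funext (LSeries.term_ofReal u hs), Complex.summable_ofReal]

theorem LSeries_ofReal (u : ℕ → ℝ) {s : ℝ} (hs : s ≠ 0) :
    LSeries (fun n ↦ (u n : ℂ)) s = ((∑' n, u n * (n : ℝ) ^ (-s) : ℝ) : ℂ) := by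
  rw [LSeries, funext (LSeries.term_ofReal u hs), Complex.ofReal_tsum]

/-- Comparison of Dirichlet series whose coefficients differ by an Euler factor at `2`. -/
theorem tsum_le_one_add_two_rpow_mul_tsum {u v : ℕ → ℝ} {s : ℝ} (hs : s ≠ 0)
    (h : ∀ n ≠ 0, u n ≤ v n + if Even n then v (n / 2) else 0)
    (hu : Summable fun n ↦ u n * (n : ℝ) ^ (-s)) (hv : Summable fun n ↦ v n * (n : ℝ) ^ (-s)) :
    ∑' n, u n * (n : ℝ) ^ (-s) ≤ (1 + 2 ^ (-s)) * ∑' n, v n * (n : ℝ) ^ (-s) := by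
  set w : ℕ → ℝ := fun n ↦
    if Even n then (2 : ℝ) ^ (-s) * (v (n / 2) * ((n / 2 : ℕ) : ℝ) ^ (-s)) else 0 with hw
  have hws : HasSum w (2 ^ (-s) * ∑' n, v n * (n : ℝ) ^ (-s)) := by
    have hinj : Function.Injective (fun n : ℕ ↦ 2 * n) := fun x y hxy ↦ by
      simpa using hxy
    rw [← hinj.hasSum_iff]
    · have : (w ∘ fun n ↦ 2 * n) = fun n ↦ (2 : ℝ) ^ (-s) * (v n * (n : ℝ) ^ (-s)) := by
        funext n
        simp [hw]
      rw [this]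
      exact hv.hasSum.mul_left _
    · intro n hn
      refine if_neg fun he ↦ hn ?_
      obtain ⟨k, rfl⟩ := he
      exact ⟨k, two_mul k⟩
  rw [one_add_mul]
  refine hasSum_le (fun n ↦ ?_) hu.hasSum (hv.hasSum.add hws)
  rcases eq_or_ne n 0 with rfl | hn
  · simp [hw, Real.zero_rpow (neg_ne_zero.2 hs)]
  · refine (mul_le_mul_of_nonneg_right (h n hn) (by positivity)).trans_eq ?_
    rw [add_mul]
    congr 1
    simp only [hw]
    split_ifs with he
    · obtain ⟨k, rfl⟩ := he
      have : (k + k) / 2 = k := by omega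
      rw [this, ← two_mul]
      push_cast
      rw [Real.mul_rpow (by norm_num) (by positivity)]
      ring
    · simp

theorem NumberField.tendsto_sub_one_mul_tsum_idealCount (K : Type*) [Field K] [NumberField K] :
    (∀ᶠ s : ℝ in 𝓝[>] 1, Summable fun n ↦ (idealCount (𝓞 K) n : ℝ) * (n : ℝ) ^ (-s)) ∧
    Tendsto (fun s : ℝ ↦ (s - 1) * ∑' n, (idealCount (𝓞 K) n : ℝ) * (n : ℝ) ^ (-s)) (𝓝[>] 1)
      (𝓝 (dedekindZeta_residue K)) := by
  have hlim := tendsto_sub_one_mul_dedekindZeta_nhdsGT K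
  have hzeta (s : ℂ) : dedekindZeta K s = LSeries (fun n ↦ ((idealCount (𝓞 K) n : ℝ) : ℂ)) s := by
    rw [dedekindZeta]
    rfl
  have hpos : ∀ᶠ s : ℝ in 𝓝[>] 1, 1 < s := self_mem_nhdsWithin
  constructor
  · filter_upwards [hpos, hlim.eventually_ne
      (Complex.ofReal_ne_zero.2 (dedekindZeta_residue_ne_zero K))] with s hs hne
    rw [← LSeriesSummable_ofReal_iff _ (by linarith)]
    by_contra hns
    refine hne ?_
    rw [hzeta, LSeries, tsum_eq_zero_of_not_summable hns, mul_zero]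
  · rw [← Filter.tendsto_ofReal_iff]
    refine hlim.congr' ?_
    filter_upwards [hpos] with s hs
    rw [hzeta, LSeries_ofReal _ (by linarith)]
    push_cast
    rfl

theorem IsQuadraticCharacter.tendsto_sub_one_mul_tsum {f : ℕ → ℤ} {q : ℝ}
    (hf : IsQuadraticCharacter f q) :
    (∀ s : ℝ, 1 < s → Summable fun n ↦
      ((((ζ : ArithmeticFunction ℤ) * hf.toArith) n : ℤ) : ℝ) * (n : ℝ) ^ (-s)) ∧
    Tendsto (fun s : ℝ ↦ (s - 1) *
      ∑' n, ((((ζ : ArithmeticFunction ℤ) * hf.toArith) n : ℤ) : ℝ) * (n : ℝ) ^ (-s)) (𝓝[>] 1)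
      (𝓝 (charLReal f 1)) := by
  set g : ArithmeticFunction ℤ := (ζ : ArithmeticFunction ℤ) * hf.toArith with hg
  have hgc : (fun n ↦ ((g n : ℝ) : ℂ)) =
      fun n ↦ ((ζ : ArithmeticFunction ℂ) * (hf.toArith : ArithmeticFunction ℂ)) n := by
    have : (g : ArithmeticFunction ℂ) = (ζ : ArithmeticFunction ℂ) * (hf.toArith) := by
      rw [hg, intCoe_mul]
      congr 1
    rw [← this]
    ext n
    simp
  have hre {s : ℝ} (hs : 1 < s) : 1 < (s : ℂ).re := hs
  constructor
  · intro s hs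
    rw [← LSeriesSummable_ofReal_iff _ (by linarith), hgc]
    exact LSeriesSummable_mul (LSeriesSummable_natCoe_zeta (hre hs))
      (hf.LSeriesSummable_toArith (hre hs))
  · rw [← Filter.tendsto_ofReal_iff, ← IsQuadraticCharacter.charL_one]
    have h1 : Tendsto (fun s : ℝ ↦ (s : ℂ)) (𝓝[>] 1) (𝓝[≠] 1) :=
      Complex.continuous_ofReal.continuousWithinAt.tendsto_nhdsWithin fun s hs ↦ by
        simpa using (ne_of_gt hs : s ≠ 1)
    have h2 := (riemannZeta_residue_one.comp h1).mul
      ((hf.differentiableAt_charL (s := 1) (by simp)).continuousAt.tendsto.comp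
        (h1.mono_right nhdsWithin_le_nhds))
    rw [one_mul] at h2
    refine h2.congr' ?_
    filter_upwards [self_mem_nhdsWithin] with s hs
    have h3 := LSeries_ofReal (fun n ↦ (g n : ℝ)) (s := s) (by linarith [Set.mem_Ioi.1 hs])
    rw [hgc, LSeries_mul' (LSeriesSummable_natCoe_zeta (hre hs))
      (hf.LSeriesSummable_toArith (hre hs)), hf.LSeries_toArith (hre hs), LSeries_natCoe_zeta,
      LSeries_one_eq_riemannZeta (hre hs)] at h3
    rw [Complex.ofReal_mul, ← h3]
    simp [mul_assoc]

/-- The value at `1` of the `L`-function of an imaginary quadratic field, without its Euler factor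
at `2`, is bounded in terms of the residue of the Dedekind zeta function. -/
theorem charLReal_oddJacobi_one_le {a b : ℤ} {q : ℝ} {K : Type*} [Field K] [NumberField K]
    (hf : IsQuadraticCharacter (oddJacobi (b ^ 2 + 4 * a)) q)
    (e : QuadraticAlgebra ℤ a b ≃+* 𝓞 K) :
    charLReal (oddJacobi (b ^ 2 + 4 * a)) 1 ≤ 3 / 2 * dedekindZeta_residue K := by
  have : IsDedekindDomain (QuadraticAlgebra ℤ a b) := IsDedekindDomain.of_ringEquiv e.symm
  obtain ⟨hu, hulim⟩ := hf.tendsto_sub_one_mul_tsum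
  obtain ⟨hv, hvlim⟩ := NumberField.tendsto_sub_one_mul_tsum_idealCount K
  have h2 : Tendsto (fun s : ℝ ↦ 1 + (2 : ℝ) ^ (-s)) (𝓝[>] 1) (𝓝 (3 / 2)) := by
    have : ContinuousAt (fun s : ℝ ↦ 1 + (2 : ℝ) ^ (-s)) 1 := by
      fun_prop (disch := norm_num)
    convert this.tendsto.mono_left nhdsWithin_le_nhds using 2
    norm_num [Real.rpow_neg_one]
  refine le_of_tendsto_of_tendsto hulim (h2.mul hvlim) ?_
  filter_upwards [self_mem_nhdsWithin, hv] with s hs hvs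
  have hs : 1 < s := hs
  rw [mul_left_comm]
  refine mul_le_mul_of_nonneg_left (tsum_le_one_add_two_rpow_mul_tsum (by linarith)
    (fun n hn ↦ ?_) (hu s hs) hvs) (by linarith)
  have h := zeta_mul_oddJacobi_le_idealCount hf hn
  rw [idealCount_congr e, idealCount_congr e] at h
  exact_mod_cast h

end LValueBound

section Primorial

open Finset

theorem Nat.prod_range_count_nth {M : Type*} [CommMonoid M] (p : ℕ → Prop) [DecidablePred p]
    (g : ℕ → M) (N : ℕ) :
    ∏ i ∈ range (Nat.count p N), g (Nat.nth p i) = ∏ n ∈ range N with p n, g n := by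
  induction N with
  | zero => simp
  | succ N ih =>
    rw [Nat.count_succ, range_add_one, filter_insert]
    split_ifs with h
    · rw [prod_range_succ, ih, Nat.nth_count h, prod_insert (by simp), mul_comm]
    · exact ih

set_option maxRecDepth 10000 in
theorem Nat.count_prime_272 : Nat.count Nat.Prime 272 = 58 := by
  norm_num [Nat.count_succ]

set_option maxRecDepth 10000 in
theorem primesProd_58 : primesProd 58 = 316660540451402206051523961799780143689087330537799173695893334666158783075592938409825136155637880209438531070 := by
  rw [primesProd, ← Nat.count_prime_272, Nat.prod_range_count_nth _ (fun n ↦ n),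
    Finset.prod_filter]
  -- Abstracting the partial products keeps the kernel from unfolding `Finset.range 272`.
  generalize hP : (fun N ↦ ∏ n ∈ Finset.range N, if Nat.Prime n then n else 1) = P
  have h0 : P 0 = 1 := by rw [← hP]; rfl
  have hs (n : ℕ) : P (n + 1) = P n * if Nat.Prime n then n else 1 := by
    rw [← hP]
    exact Finset.prod_range_succ _ n
  rw [show ∏ n ∈ Finset.range 272, (if Nat.Prime n then n else 1) = P 272 by rw [← hP]]
  clear hP
  norm_num [h0, hs]

theorem primesProd_succ (n : ℕ) : primesProd (n + 1) = primesProd n * Nat.nth Nat.Prime n :=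
  prod_range_succ _ _

theorem primesProd_card_le_prod (S : Finset ℕ) (hS : ∀ p ∈ S, p.Prime) :
    primesProd #S ≤ ∏ p ∈ S, p := by
  induction S using Finset.induction_on_max with
  | empty => simp [primesProd]
  | insert m S hm ih =>
    have hmS : m ∉ S := fun h ↦ (hm m h).false
    rw [card_insert_of_notMem hmS, prod_insert hmS, primesProd_succ, mul_comm m]
    refine Nat.mul_le_mul (ih fun p hp ↦ hS p (mem_insert_of_mem hp)) ?_
    rw [← Nat.nth_count (hS m (mem_insert_self m S))]
    refine (Nat.nth_strictMono Nat.infinite_setOfPred_prime).monotone ?_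
    rw [Nat.count_eq_card_filter_range]
    exact card_le_card fun p hp ↦
      mem_filter.2 ⟨mem_range.2 (hm p hp), hS p (mem_insert_of_mem hp)⟩

theorem two_mul_primesProd_le {n : ℕ} (hn : n ≠ 0) (h : Odd n ∨ 4 ∣ n) (h2 : 2 ≤ #n.primeFactors) :
    2 * primesProd #n.primeFactors ≤ n := by
  rcases h with h | ⟨k, rfl⟩
  · have h2n : #(2 * n).primeFactors = #n.primeFactors + 1 := by
      rw [Nat.primeFactors_mul two_ne_zero hn, Nat.prime_two.primeFactors, ← insert_eq,
        card_insert_of_notMem]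
      exact fun hp ↦ h.not_two_dvd_nat (Nat.dvd_of_mem_primeFactors hp)
    have h1 := (primesProd_card_le_prod (2 * n).primeFactors fun p ↦
      Nat.prime_of_mem_primeFactors).trans
      (Nat.le_of_dvd (by positivity) (Nat.prod_primeFactors_dvd _))
    rw [h2n, primesProd_succ] at h1
    have h5 : 5 ≤ Nat.nth Nat.Prime #n.primeFactors := by
      rw [← Nat.count_le_iff_le_nth Nat.infinite_setOfPred_prime]
      exact h2
    nlinarith
  · have hk : k ≠ 0 := by
      rintro rfl
      simp at hn
    have h2k : (4 * k).primeFactors = (2 * k).primeFactors := by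
      rw [show 4 * k = 2 * (2 * k) by ring, Nat.primeFactors_mul (by simp) (by positivity),
        Nat.prime_two.primeFactors, union_eq_right, singleton_subset_iff]
      simp [hk, Nat.prime_two]
    have h1 := (primesProd_card_le_prod (2 * k).primeFactors fun p ↦
      Nat.prime_of_mem_primeFactors).trans
      (Nat.le_of_dvd (by positivity) (Nat.prod_primeFactors_dvd _))
    rw [h2k]
    linarith

theorem primesProd_mul_pow_le {t : ℕ} (ht : 58 ≤ t) :
    primesProd 58 * 256 ^ (t - 58) ≤ primesProd t := by
  induction t, ht using Nat.le_induction with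
  | base => simp
  | succ t ht ih =>
    rw [primesProd_succ t, Nat.sub_add_comm ht, pow_succ, ← mul_assoc]
    refine Nat.mul_le_mul ih ?_
    rw [← Nat.count_le_iff_le_nth Nat.infinite_setOfPred_prime]
    exact (Nat.count_monotone _ (by norm_num)).trans (Nat.count_prime_272.le.trans ht)

theorem pow_card_primeFactors_mul_le {n : ℕ} (h : Odd n ∨ 4 ∣ n) (hn : primesProd 58 ≤ n) :
    256 ^ #n.primeFactors * (2 * primesProd 58) ≤ 256 ^ 58 * n := by
  have hn0 : n ≠ 0 := by
    rintro rfl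
    rw [primesProd_58] at hn
    norm_num at hn
  rcases lt_or_ge #n.primeFactors 58 with ht | ht
  · calc _ ≤ 256 ^ 57 * (256 * n) :=
          Nat.mul_le_mul (Nat.pow_le_pow_right (by norm_num) (by omega)) (by omega)
      _ = _ := by ring
  · have h1 := two_mul_primesProd_le hn0 h (by omega)
    have h2 := primesProd_mul_pow_le ht
    calc 256 ^ #n.primeFactors * (2 * primesProd 58)
        = 256 ^ 58 * (2 * (primesProd 58 * 256 ^ (#n.primeFactors - 58))) := by
          rw [← Nat.add_sub_cancel' ht, pow_add, Nat.add_sub_cancel_left]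
          ring
      _ ≤ _ := Nat.mul_le_mul_left _ (by omega)

end Primorial

section FundamentalDiscriminants

namespace IsFundamentalDiscriminant

variable {D D₁ D₂ : ℤ}

theorem exists_pair (hD : IsFundamentalDiscriminant D) (h0 : D < 0) :
    ∃ a b : ℤ, IsImaginaryQuadraticPair a b ∧ b ^ 2 + 4 * a = D := by
  obtain ⟨-, ⟨h1, hs⟩ | ⟨m, rfl, hs, hm⟩⟩ := hD
  · have h : 1 ^ 2 + 4 * ((D - 1) / 4) = D := by omega
    exact ⟨(D - 1) / 4, 1, ⟨by rwa [h], .inl ⟨rfl, by rwa [h]⟩⟩, h⟩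
  · exact ⟨m, 0, ⟨by simpa using h0, .inr ⟨rfl, hs, hm⟩⟩, by ring⟩

theorem odd_or_four_dvd (hD : IsFundamentalDiscriminant D) : Odd D.natAbs ∨ 4 ∣ D.natAbs := by
  obtain ⟨-, ⟨h1, -⟩ | ⟨m, rfl, -⟩⟩ := hD
  · exact .inl (by rw [Int.natAbs_odd]; exact Int.odd_iff.2 (by omega))
  · exact .inr (by rw [Int.natAbs_mul]; exact dvd_mul_right _ _)

theorem exists_squarefree (hD : IsFundamentalDiscriminant D) :
    ∃ m s : ℤ, D = s ^ 2 * m ∧ s ≠ 0 ∧ Squarefree m ∧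
      ((s = 1 ∧ m % 4 = 1) ∨ (s = 2 ∧ m % 4 ≠ 1)) := by
  obtain ⟨-, ⟨h1, hs⟩ | ⟨m, rfl, hs, hm⟩⟩ := hD
  · exact ⟨D, 1, by ring, by norm_num, hs, .inl ⟨rfl, h1⟩⟩
  · exact ⟨m, 2, by ring, by norm_num, hs, .inr ⟨rfl, by omega⟩⟩

theorem _root_.Squarefree.dvd_of_isSquare_mul {m n : ℤ} (hm : Squarefree m)
    (h : IsSquare (m * n)) : m ∣ n := by
  obtain ⟨k, hk⟩ := h
  have hk2 : m ∣ k := (hm.dvd_pow_iff_dvd two_ne_zero).1 ⟨n, by rw [hk, sq]⟩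
  obtain ⟨l, rfl⟩ := hk2
  exact ⟨l * l, mul_left_cancel₀ hm.ne_zero (by rw [hk]; ring)⟩

theorem eq_of_isSquare_mul (h₁ : IsFundamentalDiscriminant D₁) (h₂ : IsFundamentalDiscriminant D₂)
    (hn₁ : D₁ < 0) (hn₂ : D₂ < 0) (h : IsSquare (D₁ * D₂)) : D₁ = D₂ := by
  obtain ⟨m, s, rfl, hs, hm, hsm⟩ := h₁.exists_squarefree
  obtain ⟨n, t, rfl, ht, hn, htn⟩ := h₂.exists_squarefree
  have hmn : IsSquare (m * n) := by
    obtain ⟨k, hk⟩ := h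
    have hst : (s * t) ^ 2 ∣ k ^ 2 := ⟨m * n, by rw [sq k, ← hk]; ring⟩
    obtain ⟨l, rfl⟩ := (Int.pow_dvd_pow_iff two_ne_zero).1 hst
    exact ⟨l, mul_left_cancel₀ (pow_ne_zero 2 (mul_ne_zero hs ht)) (by linear_combination hk)⟩
  have h1 := hm.dvd_of_isSquare_mul hmn
  have h2 := hn.dvd_of_isSquare_mul (by rwa [mul_comm])
  have hm0 : m < 0 := by
    by_contra! hm0
    exact hn₁.not_ge (by positivity)
  have hn0 : n < 0 := by
    by_contra! hn0
    exact hn₂.not_ge (by positivity)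
  have heq : m = n := by
    have := Int.natAbs_eq_of_dvd_dvd h1 h2
    omega
  subst heq
  have hst : s = t := by omega
  rw [hst]

end IsFundamentalDiscriminant

/-- The numerical bound on `L(1)` that the class number bound yields. -/
theorem three_halves_mul_residue_bound_le {n t : ℕ} {h : ℝ} (hn : primesProd 58 ≤ n)
    (ht : 256 ^ t * (2 * primesProd 58) ≤ 256 ^ 58 * n) (hh0 : 0 ≤ h) (hh : 8 * h ≤ 8 ^ t) :
    3 / 2 * (Real.pi * h / √(n : ℝ)) ≤
      0.000612 * Real.exp (-(Real.log (n / primesProd 58) / 8)) := by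
  have hd : (0 : ℝ) < primesProd 58 := by
    rw [primesProd_58]
    norm_num
  have hn0 : (0 : ℝ) < n := hd.trans_le (by exact_mod_cast hn)
  have ht' : (256 : ℝ) ^ t * (2 * primesProd 58) ≤ 256 ^ 58 * n := by exact_mod_cast ht
  refine le_of_pow_le_pow_left₀ (n := 8) (by norm_num) (by positivity) ?_
  have hexp : Real.exp (-(Real.log (n / primesProd 58) / 8)) ^ 8 = primesProd 58 / n := by
    rw [← Real.exp_nat_mul, Nat.cast_ofNat, show (8 : ℝ) * -(Real.log (n / primesProd 58) / 8) =
      -Real.log (n / primesProd 58) by ring, Real.exp_neg, Real.exp_log (by positivity), inv_div]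
  have hsqrt : √(n : ℝ) ^ 8 = (n : ℝ) ^ 4 := by
    rw [show 8 = 2 * 4 by norm_num, pow_mul, Real.sq_sqrt hn0.le]
  have h8 : (8 * h) ^ 8 ≤ ((256 : ℝ) ^ 58 * n / (2 * primesProd 58)) ^ 3 := by
    calc (8 * h) ^ 8 ≤ ((8 : ℝ) ^ t) ^ 8 := pow_le_pow_left₀ (by positivity) hh 8
      _ = ((256 : ℝ) ^ t) ^ 3 := by
        rw [← pow_mul, mul_comm, pow_mul, ← pow_mul _ t 3, mul_comm t 3, pow_mul]
        norm_num
      _ ≤ _ := pow_le_pow_left₀ (by positivity) ((le_div_iff₀ (by positivity)).2 ht') 3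
  have hpi : (3 / 16 * Real.pi) ^ 8 * 256 ^ 174 ≤ 8 * 0.000612 ^ 8 * (primesProd 58 : ℝ) ^ 4 := by
    calc _ ≤ (3 / 16 * 3.1416 : ℝ) ^ 8 * 256 ^ 174 := by
          gcongr
          linarith [Real.pi_lt_d4]
      _ ≤ _ := by
        rw [primesProd_58]
        norm_num
  rw [mul_pow 0.000612, hexp]
  calc (3 / 2 * (Real.pi * h / √(n : ℝ))) ^ 8 =
        (3 / 16 * Real.pi) ^ 8 * (8 * h) ^ 8 / (n : ℝ) ^ 4 := by
        rw [← hsqrt]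
        ring
    _ ≤ (3 / 16 * Real.pi) ^ 8 * ((256 : ℝ) ^ 58 * n / (2 * primesProd 58)) ^ 3 / (n : ℝ) ^ 4 := by
        gcongr
    _ = (3 / 16 * Real.pi) ^ 8 * 256 ^ 174 / (8 * (primesProd 58 : ℝ) ^ 3 * n) := by
        field_simp
        ring
    _ ≤ _ := by
        rw [div_le_iff₀ (by positivity)]
        refine hpi.trans_eq ?_
        field_simp

theorem IsImaginaryQuadraticPair.abs_charLReal_oddJacobi_one_le {a b : ℤ} {q : ℝ}
    (h : IsImaginaryQuadraticPair a b) (hf : IsQuadraticCharacter (oddJacobi (b ^ 2 + 4 * a)) q)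
    (h4 : Odd (b ^ 2 + 4 * a).natAbs ∨ 4 ∣ (b ^ 2 + 4 * a).natAbs)
    (hn : primesProd 58 ≤ (b ^ 2 + 4 * a).natAbs)
    (hK : ∀ (K : Type) [Field K] [NumberField K], Module.finrank ℚ K = 2 →
      NumberField.discr K = b ^ 2 + 4 * a → Monoid.exponent (ClassGroup (𝓞 K)) = 8) :
    |charLReal (oddJacobi (b ^ 2 + 4 * a)) 1| ≤ 0.000612 * Real.exp
      (-(Real.log ((b ^ 2 + 4 * a).natAbs / primesProd 58) / 8)) := by
  obtain ⟨K, _, _, hdeg, hdiscr, ⟨e⟩⟩ := h.exists_numberField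
  have : IsDedekindDomain (QuadraticAlgebra ℤ a b) := IsDedekindDomain.of_ringEquiv e.symm
  let E : ClassGroup (QuadraticAlgebra ℤ a b) ≃* ClassGroup (𝓞 K) := ClassGroup.mulEquiv e
  have : Finite (ClassGroup (QuadraticAlgebra ℤ a b)) := Finite.of_equiv _ E.symm.toEquiv
  have hneg := h.neg
  have hcard := h.card_classGroup_le (by rw [primesProd_58] at hn; omega) fun c ↦ E.injective (by
    rw [map_pow, map_one, ← hK K hdeg hdiscr]
    exact Monoid.pow_exponent_eq_one _)
  have hclass : Nat.card (ClassGroup (QuadraticAlgebra ℤ a b)) = classNumber K :=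
    (Nat.card_congr E.toEquiv).trans Nat.card_eq_fintype_card
  rw [hclass] at hcard
  rw [abs_of_nonneg hf.charLReal_one_nonneg]
  refine (charLReal_oddJacobi_one_le hf e).trans (le_trans ?_
    (three_halves_mul_residue_bound_le hn (pow_card_primeFactors_mul_le h4 hn)
      (Nat.cast_nonneg (classNumber K)) (by exact_mod_cast hcard)))
  have hres := NumberField.dedekindZeta_residue_le_of_imaginary_quadratic hdeg
    (by rwa [hdiscr])
  rw [hdiscr, ← Int.cast_abs, Int.abs_eq_natAbs, Int.cast_natCast] at hres
  gcongr

theorem four_mul_le_exp {n : ℕ} (hn : primesProd 58 ≤ n) :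
    4 * (n : ℝ) ≤ Real.exp (256 + Real.log (n / primesProd 58)) := by
  have hd : (0 : ℝ) < primesProd 58 := by
    rw [primesProd_58]
    norm_num
  have hn0 : (0 : ℝ) < n := hd.trans_le (by exact_mod_cast hn)
  rw [Real.exp_add, Real.exp_log (by positivity), ← mul_div_assoc, le_div_iff₀ hd, mul_right_comm]
  refine mul_le_mul_of_nonneg_right ?_ hn0.le
  calc (4 : ℝ) * primesProd 58 ≤ 2.7182818283 ^ 256 := by
        rw [primesProd_58]
        norm_num
    _ ≤ Real.exp 1 ^ 256 := by
        gcongr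
        exact Real.exp_one_gt_d9.le
    _ = Real.exp 256 := by
        rw [← Real.exp_nat_mul]
        norm_num

end FundamentalDiscriminants

/-- There is at most one fundamental discriminant `D < 0` with `|D| ≥ d_58`, the product of
the first 58 primes (which satisfies `d_58 ≤ 3.17·10^110`), whose class group has
exponent `8`. -/
theorem at_most_one_exponent_eight :
    (primesProd 58 : ℝ) ≤ 3.17 * 10 ^ 110 ∧
    {D : ℤ | IsFundamentalDiscriminant D ∧ D < 0 ∧ (primesProd 58 : ℤ) ≤ |D| ∧
      ∀ (K : Type) [Field K] [NumberField K], Module.finrank ℚ K = 2 →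
        NumberField.discr K = D →
          Monoid.exponent (ClassGroup (𝓞 K)) = 8}.Subsingleton := by
  refine ⟨by rw [primesProd_58]; norm_num, ?_⟩
  rintro D₁ ⟨hD₁, hneg₁, hd₁, hK₁⟩ D₂ ⟨hD₂, hneg₂, hd₂, hK₂⟩
  by_contra hne
  have hsq : ¬ IsSquare (D₁ * D₂) := fun h ↦ hne (hD₁.eq_of_isSquare_mul hD₂ hneg₁ hneg₂ h)
  have hq {D : ℤ} : (4 * |(D : ℝ)|) = 4 * (D.natAbs : ℝ) := by
    rw [Nat.cast_natAbs, Int.cast_abs]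
  have hlog {n : ℕ} (hn : primesProd 58 ≤ n) : 0 ≤ Real.log (n / primesProd 58) := by
    refine Real.log_nonneg ((one_le_div ?_).2 (by exact_mod_cast hn))
    rw [primesProd_58]
    norm_num
  have hchar {D : ℤ} (hneg : D < 0) : IsQuadraticCharacter (oddJacobi D) (4 * D.natAbs) :=
    isQuadraticCharacter_oddJacobi (fun h ↦ hneg.not_ge h.nonneg) hq.le
  have hbound {D : ℤ} (hD : IsFundamentalDiscriminant D) (hneg : D < 0)
      (hn : primesProd 58 ≤ D.natAbs)
      (hK : ∀ (K : Type) [Field K] [NumberField K], Module.finrank ℚ K = 2 →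
        NumberField.discr K = D → Monoid.exponent (ClassGroup (𝓞 K)) = 8) :
      |charLReal (oddJacobi D) 1| ≤
        0.000612 * Real.exp (-(Real.log (D.natAbs / primesProd 58) / 8)) := by
    have h4 := hD.odd_or_four_dvd
    obtain ⟨a, b, h, rfl⟩ := hD.exists_pair hneg
    exact h.abs_charLReal_oddJacobi_one_le (hchar hneg) h4 hn hK
  have hn₁ : primesProd 58 ≤ D₁.natAbs := by
    rwa [Int.abs_eq_natAbs, Nat.cast_le] at hd₁
  have hn₂ : primesProd 58 ≤ D₂.natAbs := by
    rwa [Int.abs_eq_natAbs, Nat.cast_le] at hd₂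
  refine (hchar hneg₁).false_of_small_pair (hchar hneg₂) (isQuadraticCharacter_oddJacobi hsq ?_)
    (oddJacobi_mul_left D₁ D₂) (hlog hn₁) (hlog hn₂) (four_mul_le_exp hn₁) (four_mul_le_exp hn₂)
    (hbound hD₁ hneg₁ hn₁ hK₁) (hbound hD₂ hneg₂ hn₂ hK₂) (charLReal_oddJacobi_one_ne_zero hsq)
  rw [← hq, ← hq]
  push_cast
  rw [abs_mul]
  nlinarith [mul_nonneg (abs_nonneg (D₁ : ℝ)) (abs_nonneg (D₂ : ℝ))]
end

section
/- Let D < 0 be a fundamental discriminant. Then the 2-rank of the class group Cl(D) of ℚ(√D) equals ω(D) − 1; that is, the quotient group Cl(D)/Cl(D)^2 is an elementary abelian 2-group of order 2^{ω(D) − 1}, where ω(D) is the number of distinct prime divisors of D. -/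
open NumberField

theorem forall_not_dvd_sq {K : Type*} [Field K] [NumberField K] {p : ℤ} (hp : Prime p) :
    ¬ p ∣ discr K ↔ ∀ P : Ideal (𝓞 K), P.IsPrime → (p : 𝓞 K) ∈ P →
      ¬ P ^ 2 ∣ Ideal.span {(p : 𝓞 K)} := by
  rw [NumberField.not_dvd_discr_iff_forall_mem K (𝓞 K) hp]
  refine forall₃_congr fun P hP hpP ↦ ?_
  have hover : P.LiesOver (Ideal.span {p}) := (Ideal.liesOver_span_iff hP.ne_top hp).mpr hpP
  have hmap : (Ideal.span {p}).map (algebraMap ℤ (𝓞 K)) = Ideal.span {(p : 𝓞 K)} := by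
    simp [Ideal.map_span]
  have h := Ideal.ramificationIdx'_ne_one_iff (p := Ideal.span {p}) (P := P)
    (by rw [hmap, Ideal.span_singleton_le_iff_mem]; exact hpP)
  rw [hmap] at h
  rw [Ideal.dvd_iff_le, ← h, not_not, ← Ideal.ramificationIdx_eq_one_iff,
    Ideal.ramificationIdx'_eq_ramificationIdx _ _ (by simpa using hp.ne_zero)]

theorem exists_sq_eq_span {K : Type*} [Field K] [NumberField K] (hdeg : Module.finrank ℚ K = 2)
    {p : ℕ} (hp : p.Prime) (h : (p : ℤ) ∣ discr K) :
    ∃ P : Ideal (𝓞 K), P ^ 2 = Ideal.span {(p : 𝓞 K)} ∧ P.absNorm = p := by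
  have h' := (forall_not_dvd_sq (K := K) (Nat.prime_iff_prime_int.mp hp)).not.mp (not_not.mpr h)
  push Not at h'
  obtain ⟨P, hP, hpP, J, hJ⟩ := h'
  simp only [Int.cast_natCast] at hJ
  have hn : P.absNorm ^ 2 * J.absNorm = p ^ 2 := by
    rw [← map_pow, ← map_mul, ← hJ, Ideal.absNorm_span_singleton,
      ← map_natCast (algebraMap ℤ (𝓞 K)), Algebra.norm_algebraMap, RingOfIntegers.rank, hdeg]
    simp [Int.natAbs_pow]
  obtain ⟨k, hk, hkp⟩ := (Nat.dvd_prime_pow hp).mp (Dvd.intro (P.absNorm * J.absNorm)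
    (by rw [← hn]; ring) : P.absNorm ∣ p ^ 2)
  have h1 : P.absNorm ≠ 1 := by
    rw [Ne, Ideal.absNorm_eq_one_iff]; exact hP.ne_top
  have hPn : P.absNorm = p := by
    interval_cases k
    · simp_all
    · simpa using hkp
    · rw [hkp] at hn
      have h4 : p ^ 2 * (p ^ 2 * J.absNorm) = p ^ 2 * 1 := by rw [← mul_assoc, ← sq, hn, mul_one]
      have h5 := Nat.eq_of_mul_eq_mul_left (pow_pos hp.pos 2) h4
      have h6 := Nat.eq_one_of_mul_eq_one_right h5
      exact absurd h6 (Nat.one_lt_pow two_ne_zero hp.one_lt).ne'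
  refine ⟨P, ?_, hPn⟩
  have hJ1 : J.absNorm = 1 := by
    rw [hPn] at hn
    exact Nat.eq_of_mul_eq_mul_left (pow_pos hp.pos 2) (by rw [hn, mul_one])
  rw [Ideal.absNorm_eq_one_iff] at hJ1
  rw [hJ, hJ1, Ideal.mul_top]

theorem nrPlaces_of_discr_neg {K : Type*} [Field K] [NumberField K]
    (hdeg : Module.finrank ℚ K = 2) (hneg : discr K < 0) :
    InfinitePlace.nrRealPlaces K = 0 ∧ InfinitePlace.nrComplexPlaces K = 1 := by
  have h1 := sign_discr K
  have h2 := InfinitePlace.card_add_two_mul_card_eq_rank K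
  rw [Int.sign_eq_neg_one_of_neg hneg] at h1
  have : InfinitePlace.nrComplexPlaces K ≠ 0 := by
    intro h; rw [h] at h1; norm_num at h1
  omega

/-- The basic properties of the nontrivial automorphism of an imaginary quadratic field. -/
theorem exists_conj {K : Type} [Field K] [NumberField K]
    (hdeg : Module.finrank ℚ K = 2) (hneg : discr K < 0) :
    ∃ σ : K ≃ₐ[ℚ] K, (∀ x, x * σ x = algebraMap ℚ K (Algebra.norm ℚ x)) ∧
      (∀ x : K, x ≠ 0 → 0 < Algebra.norm ℚ x) ∧
      (∀ x, Algebra.norm ℚ x = 1 → ∃ y : Kˣ, (y : K) / σ y = x) ∧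
      (∀ x, σ x = x → ∃ q : ℚ, algebraMap ℚ K q = x) := by
  classical
  obtain ⟨hr, -⟩ := nrPlaces_of_discr_neg hdeg hneg
  rw [NumberField.nrRealPlaces_eq_zero_iff] at hr
  have : Algebra.IsQuadraticExtension ℚ K := ⟨hdeg⟩
  have : IsGalois ℚ K := ⟨⟩
  obtain ⟨φ⟩ : Nonempty (K →+* ℂ) := inferInstance
  have hφ : ComplexEmbedding.conjugate φ ≠ φ := fun h ↦
    IsTotallyComplex.complexEmbedding_not_isReal φ h
  obtain ⟨τ, hτ⟩ := ComplexEmbedding.exists_comp_symm_eq_of_comp_eq (k := ℚ) φ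
    (ComplexEmbedding.conjugate φ) (Subsingleton.elim _ _)
  set σ := τ.symm
  have hσφ (x : K) : φ (σ x) = starRingEnd ℂ (φ x) := by
    have := RingHom.congr_fun hτ x
    simpa using this
  have hσ1 : (1 : K ≃ₐ[ℚ] K) ≠ σ := by
    rintro h
    apply hφ
    ext x
    rw [ComplexEmbedding.conjugate_coe_eq, ← hσφ, ← h, AlgEquiv.one_apply]
  have hcard : Fintype.card (K ≃ₐ[ℚ] K) = 2 := by
    rw [← Nat.card_eq_fintype_card, IsGalois.card_aut_eq_finrank, hdeg]
  have huniv : ({1, σ} : Finset (K ≃ₐ[ℚ] K)) = Finset.univ := by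
    rw [← Finset.card_eq_iff_eq_univ, Finset.card_pair hσ1, hcard]
  have hall (g : K ≃ₐ[ℚ] K) : g = 1 ∨ g = σ := by
    have : g ∈ ({1, σ} : Finset (K ≃ₐ[ℚ] K)) := huniv ▸ Finset.mem_univ g
    simpa using this
  have hgen : ∀ g, g ∈ Subgroup.zpowers σ := fun g ↦ by
    rcases hall g with rfl | rfl
    · exact one_mem _
    · exact Subgroup.mem_zpowers _
  have : IsCyclic (K ≃ₐ[ℚ] K) := ⟨σ, hgen⟩
  have hnorm (x : K) : x * σ x = algebraMap ℚ K (Algebra.norm ℚ x) := by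
    rw [Algebra.norm_eq_prod_automorphisms, ← huniv, Finset.prod_pair hσ1, AlgEquiv.one_apply]
  refine ⟨σ, hnorm, fun x hx ↦ ?_, fun x hx ↦ groupCohomology.exists_div_of_norm_eq_one hgen hx,
    fun x hx ↦ ?_⟩
  · have h := congrArg φ (hnorm x)
    rw [map_mul, hσφ, Complex.mul_conj, eq_ratCast, map_ratCast] at h
    have h' : Complex.normSq (φ x) = (Algebra.norm ℚ x : ℝ) := by exact_mod_cast h
    have := Complex.normSq_pos.mpr ((map_ne_zero φ).mpr hx)
    rw [h'] at this
    exact_mod_cast this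
  · refine (IsGalois.mem_range_algebraMap_iff_fixed x).mpr fun g ↦ ?_
    rcases hall g with rfl | rfl
    · rfl
    · exact hx

theorem torsion_eq_top {K : Type*} [Field K] [NumberField K]
    (hdeg : Module.finrank ℚ K = 2) (hneg : discr K < 0) :
    Units.torsion K = ⊤ := by
  obtain ⟨hr, hc⟩ := nrPlaces_of_discr_neg hdeg hneg
  have : IsEmpty (Fin (Units.rank K)) := by
    rw [Units.rank, InfinitePlace.card_eq_nrRealPlaces_add_nrComplexPlaces, hr, hc]
    exact Fin.isEmpty
  simpa [Set.range_eq_empty] using Units.closure_fundSystem_sup_torsion_eq_top (K := K)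

theorem index_units_sq {K : Type*} [Field K] [NumberField K]
    (hdeg : Module.finrank ℚ K = 2) (hneg : discr K < 0) :
    (powMonoidHom 2 : (𝓞 K)ˣ →* (𝓞 K)ˣ).range.index = 2 := by
  have htop := torsion_eq_top hdeg hneg
  have : Finite (𝓞 K)ˣ := by
    have : Finite (⊤ : Subgroup (𝓞 K)ˣ) := htop ▸ inferInstance
    exact Finite.of_equiv _ Subgroup.topEquiv.toEquiv
  rw [IsCyclic.index_powMonoidHom_range, Nat.gcd_eq_right]
  have h := (Units.even_torsionOrder K).two_dvd
  rwa [Units.torsionOrder, htop, Subgroup.card_top] at h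

open scoped nonZeroDivisors

/-- The group homomorphism sending `q` to the principal fractional ideal generated by `q`. -/
noncomputable def ratPrincipal (K : Type*) [Field K] [NumberField K] :
    ℚˣ →* (FractionalIdeal (𝓞 K)⁰ K)ˣ :=
  (toPrincipalIdeal (𝓞 K) K).comp (Units.map (algebraMap ℚ K))

/-- The fractional ideals whose square is generated by a rational number. -/
noncomputable def ambiguousIdeals (K : Type*) [Field K] [NumberField K] :
    Subgroup (FractionalIdeal (𝓞 K)⁰ K)ˣ :=
  (ratPrincipal K).range.comap (powMonoidHom 2)

/-- The absolute norm on invertible fractional ideals. -/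
noncomputable def unitsAbsNorm (K : Type*) [Field K] [NumberField K] :
    (FractionalIdeal (𝓞 K)⁰ K)ˣ →* ℚˣ :=
  Units.map (FractionalIdeal.absNorm (R := 𝓞 K) (K := K)).toMonoidHom

/-- The parities of the valuations of the norm of a fractional ideal at a finite set of primes. -/
noncomputable def normParity (K : Type*) [Field K] [NumberField K] (s : Finset ℕ)
    (hs : ∀ p ∈ s, p.Prime) :
    (FractionalIdeal (𝓞 K)⁰ K)ˣ →* (s → Multiplicative (ZMod 2)) :=
  MonoidHom.pi fun p ↦
    { toFun := fun I ↦ Multiplicative.ofAdd (padicValRat p (unitsAbsNorm K I) : ZMod 2)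
      map_one' := by simp
      map_mul' := fun I J ↦ by
        have : Fact (p : ℕ).Prime := ⟨hs p p.2⟩
        rw [map_mul, Units.val_mul, padicValRat.mul (Units.ne_zero _) (Units.ne_zero _),
          Int.cast_add, ofAdd_add] }

section

variable {K : Type*} [Field K] [NumberField K]

theorem unitsAbsNorm_pos (I : (FractionalIdeal (𝓞 K)⁰ K)ˣ) : (0 : ℚ) < unitsAbsNorm K I :=
  lt_of_le_of_ne (FractionalIdeal.absNorm_nonneg _) (Units.ne_zero _).symm

theorem unitsAbsNorm_toPrincipalIdeal (x : Kˣ) :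
    (unitsAbsNorm K (toPrincipalIdeal (𝓞 K) K x) : ℚ) = |Algebra.norm ℚ (x : K)| := by
  simp [unitsAbsNorm]

theorem coe_ratPrincipal (q : ℚˣ) :
    (ratPrincipal K q : FractionalIdeal (𝓞 K)⁰ K) =
      FractionalIdeal.spanSingleton (𝓞 K)⁰ (algebraMap ℚ K q) := by
  simp [ratPrincipal]

theorem unitsAbsNorm_ratPrincipal (hdeg : Module.finrank ℚ K = 2) (q : ℚˣ) :
    (unitsAbsNorm K (ratPrincipal K q) : ℚ) = (q : ℚ) ^ 2 := by
  rw [ratPrincipal, MonoidHom.comp_apply, unitsAbsNorm_toPrincipalIdeal, Units.coe_map,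
    MonoidHom.coe_coe, Algebra.norm_algebraMap, hdeg, abs_of_nonneg (sq_nonneg _)]

theorem ratPrincipal_neg (q : ℚˣ) : ratPrincipal K (-q) = ratPrincipal K q := by
  ext1
  rw [coe_ratPrincipal, coe_ratPrincipal, Units.val_neg, map_neg,
    ← FractionalIdeal.coeToSubmodule_inj, FractionalIdeal.coe_spanSingleton,
    FractionalIdeal.coe_spanSingleton, ← Set.neg_singleton, Submodule.span_neg]

theorem mem_ambiguousIdeals_iff (hdeg : Module.finrank ℚ K = 2)
    {I : (FractionalIdeal (𝓞 K)⁰ K)ˣ} :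
    I ∈ ambiguousIdeals K ↔ I ^ 2 = ratPrincipal K (unitsAbsNorm K I) := by
  refine ⟨?_, fun h ↦ ⟨_, h.symm⟩⟩
  rintro ⟨q, hq⟩
  rw [powMonoidHom_apply] at hq
  have h := unitsAbsNorm_ratPrincipal hdeg q
  rw [hq, map_pow, Units.val_pow_eq_pow_val, sq_eq_sq_iff_eq_or_eq_neg] at h
  rcases h with h | h
  · rw [Units.ext h, hq]
  · rw [← Units.val_neg] at h
    rw [Units.ext h, ratPrincipal_neg, hq]

theorem le_one_of_sq_le_one {I : FractionalIdeal (𝓞 K)⁰ K} (h : I ^ 2 ≤ 1) : I ≤ 1 := by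
  intro x hx
  have hx2 : x ^ 2 ∈ (1 : FractionalIdeal (𝓞 K)⁰ K) := by
    rw [sq]
    exact h (sq I ▸ FractionalIdeal.mul_mem_mul hx hx)
  obtain ⟨y, hy⟩ := (FractionalIdeal.mem_one_iff _).mp hx2
  exact (FractionalIdeal.mem_one_iff _).mpr
    (IsIntegrallyClosed.exists_algebraMap_eq_of_isIntegral_pow (n := 2) two_pos
      (hy ▸ isIntegral_algebraMap))

theorem eq_one_of_sq_eq_one {I : (FractionalIdeal (𝓞 K)⁰ K)ˣ} (h : I ^ 2 = 1) : I = 1 := by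
  have hle : ∀ J : (FractionalIdeal (𝓞 K)⁰ K)ˣ, J ^ 2 = 1 → (J : FractionalIdeal (𝓞 K)⁰ K) ≤ 1 :=
    fun J hJ ↦ le_one_of_sq_le_one (by rw [← Units.val_pow_eq_pow_val, hJ, Units.val_one])
  refine Units.ext (le_antisymm (hle I h) ?_)
  rw [Units.val_one, ← I.mul_inv]
  calc (I : FractionalIdeal (𝓞 K)⁰ K) * (I⁻¹ : (FractionalIdeal (𝓞 K)⁰ K)ˣ)
      ≤ I * 1 := mul_le_mul_right (hle I⁻¹ (by rw [inv_pow, h, inv_one])) _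
    _ = I := mul_one _

/-- If a squarefree integer `s` generates the square of an ideal, then its prime factors
ramify. -/
theorem dvd_discr_of_sq_eq_span {J : Ideal (𝓞 K)} {s : ℕ} (hs : Squarefree s)
    (hJ : J ^ 2 = Ideal.span {(s : 𝓞 K)}) {p : ℕ} (hp : p.Prime) (hps : p ∣ s) :
    (p : ℤ) ∣ discr K := by
  by_contra hD
  rw [forall_not_dvd_sq (Nat.prime_iff_prime_int.mp hp)] at hD
  simp only [Int.cast_natCast] at hD
  have hpu : ¬ IsUnit (p : 𝓞 K) := by
    have hcast : ((p : 𝓞 K) : K) = algebraMap ℚ K p := by simp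
    rw [NumberField.isUnit_iff_norm, RingOfIntegers.coe_norm, hcast, Algebra.norm_algebraMap,
      abs_pow, Nat.abs_cast]
    exact (one_lt_pow₀ (by exact_mod_cast hp.one_lt) Module.finrank_pos.ne').ne'
  obtain ⟨P, hPm, hle⟩ := Ideal.exists_le_maximal (Ideal.span {(p : 𝓞 K)})
    (by rwa [Ne, Ideal.span_singleton_eq_top])
  have hPp : (p : 𝓞 K) ∈ P := (Ideal.span_singleton_le_iff_mem _).mp hle
  have hP0 : P ≠ ⊥ := by
    rintro rfl
    exact hp.ne_zero (by exact_mod_cast (Ideal.mem_bot.mp hPp))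
  have hPprime : Prime P := Ideal.prime_of_isPrime hP0 hPm.isPrime
  refine hD P hPm.isPrime hPp ?_
  obtain ⟨t, rfl⟩ := hps
  have hcop : Nat.Coprime p t := (Nat.squarefree_mul_iff.mp hs).1
  rw [Nat.cast_mul, ← Ideal.span_singleton_mul_span_singleton] at hJ
  have hPJ : P ∣ J := hPprime.dvd_of_dvd_pow (n := 2)
    (hJ ▸ (Ideal.dvd_iff_le.mpr hle).mul_right _)
  have ht : ¬ P ∣ Ideal.span {(t : 𝓞 K)} := by
    intro h
    rw [Ideal.dvd_span_singleton] at h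
    obtain ⟨a, b, hab⟩ := Nat.isCoprime_iff_coprime.mpr hcop
    apply hPm.ne_top
    rw [Ideal.eq_top_iff_one]
    have : (1 : 𝓞 K) = a * p + b * t := by exact_mod_cast hab.symm
    rw [this]
    exact add_mem (P.mul_mem_left _ hPp) (P.mul_mem_left _ h)
  exact hPprime.pow_dvd_of_dvd_mul_right 2 ht (hJ ▸ pow_dvd_pow_of_dvd hPJ 2)

theorem exists_sq_mul_squarefree {q : ℚ} (hq : 0 < q) :
    ∃ (c : ℚˣ) (s : ℕ), Squarefree s ∧ q = (c : ℚ) ^ 2 * s := by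
  obtain ⟨s, r, hsr, hs⟩ := Nat.sq_mul_squarefree (q.num.toNat * q.den)
  have hnum : ((q.num.toNat : ℕ) : ℚ) = q.num := by
    exact_mod_cast Int.toNat_of_nonneg (Rat.num_pos.mpr hq).le
  have hden : (q.den : ℚ) ≠ 0 := by exact_mod_cast q.den_nz
  have hsr' : (r : ℚ) ^ 2 * s = q.num * q.den := by
    rw [← hnum]; exact_mod_cast hsr
  have hr : (r : ℚ) ≠ 0 := by
    intro h
    have hn : (q.num : ℚ) ≠ 0 := by exact_mod_cast (Rat.num_pos.mpr hq).ne'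
    rw [h] at hsr'
    exact mul_ne_zero hn hden (by rw [← hsr']; ring)
  refine ⟨Units.mk0 (r / q.den) (div_ne_zero hr hden), s, hs, ?_⟩
  rw [Units.val_mk0, div_pow, div_mul_eq_mul_div, hsr', sq, mul_div_mul_right _ _ hden,
    Rat.num_div_den]

theorem mem_range_ratPrincipal {I : (FractionalIdeal (𝓞 K)⁰ K)ˣ} {q : ℚˣ} (hq : (0 : ℚ) < q)
    (hI : I ^ 2 = ratPrincipal K q)
    (heven : ∀ p : ℕ, p.Prime → (p : ℤ) ∣ discr K → Even (padicValRat p q)) :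
    I ∈ (ratPrincipal K).range := by
  obtain ⟨c, s, hs, hcs⟩ := exists_sq_mul_squarefree hq
  have hs0 : (s : ℚ) ≠ 0 := by exact_mod_cast hs.ne_zero
  have hJ : (I * (ratPrincipal K c)⁻¹) ^ 2 = ratPrincipal K (Units.mk0 (s : ℚ) hs0) := by
    rw [mul_pow, hI, inv_pow, ← map_pow, ← map_inv, ← map_mul]
    congr 1
    ext
    rw [Units.val_mul, hcs, Units.val_inv_eq_inv_val, Units.val_pow_eq_pow_val, Units.val_mk0]
    field_simp
  set J := I * (ratPrincipal K c)⁻¹ with hJdef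
  have hspan : (J : FractionalIdeal (𝓞 K)⁰ K) ^ 2 =
      (Ideal.span {(s : 𝓞 K)} : Ideal (𝓞 K)) := by
    rw [← Units.val_pow_eq_pow_val, hJ, coe_ratPrincipal, FractionalIdeal.coeIdeal_span_singleton]
    simp
  obtain ⟨J', hJ'⟩ := FractionalIdeal.le_one_iff_exists_coeIdeal.mp
    (le_one_of_sq_le_one (hspan ▸ FractionalIdeal.coeIdeal_le_one))
  rw [← hJ', ← FractionalIdeal.coeIdeal_pow, FractionalIdeal.coeIdeal_inj] at hspan
  have hs1 : s = 1 := by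
    by_contra hne
    obtain ⟨p, hp, hps⟩ := Nat.exists_prime_and_dvd hne
    have : Fact p.Prime := ⟨hp⟩
    have h := heven p hp (dvd_discr_of_sq_eq_span hs hspan hp hps)
    have hv : padicValNat p s = 1 := by
      rw [← Nat.factorization_def _ hp]
      exact le_antisymm (hs.natFactorization_le_one p)
        ((hp.dvd_iff_one_le_factorization hs.ne_zero).mp hps)
    rw [hcs, padicValRat.mul (pow_ne_zero 2 c.ne_zero) hs0, padicValRat.pow,
      padicValRat.of_nat, hv] at h
    exact absurd h (by rw [Int.not_even_iff_odd]; exact ⟨padicValRat p c, by push_cast; ring⟩)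
  have hJ1 : J = 1 := eq_one_of_sq_eq_one (by
    rw [hJ, ← map_one (ratPrincipal K)]
    congr 1
    ext
    simp [hs1])
  exact ⟨c, (mul_inv_eq_one.mp hJ1).symm⟩

end

section

variable {K : Type*} [Field K] [NumberField K]

theorem range_ratPrincipal_le :
    (ratPrincipal K).range ≤ ambiguousIdeals K := by
  rintro _ ⟨q, rfl⟩
  exact ⟨q ^ 2, map_pow _ _ _⟩

theorem normParity_eq_one_iff {s : Finset ℕ} {hs : ∀ p ∈ s, p.Prime}
    {I : (FractionalIdeal (𝓞 K)⁰ K)ˣ} :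
    normParity K s hs I = 1 ↔ ∀ p ∈ s, Even (padicValRat p (unitsAbsNorm K I)) := by
  rw [funext_iff, Subtype.forall]
  refine forall₂_congr fun p hp ↦ ?_
  change Multiplicative.ofAdd (padicValRat p (unitsAbsNorm K I) : ZMod 2) = 1 ↔ _
  rw [ofAdd_eq_one, ZMod.intCast_eq_zero_iff_even]

theorem ker_normParity_inf (hdeg : Module.finrank ℚ K = 2) {s : Finset ℕ}
    {hs : ∀ p ∈ s, p.Prime} (hsD : ∀ p : ℕ, p.Prime → (p : ℤ) ∣ discr K → p ∈ s) :
    (normParity K s hs).ker ⊓ ambiguousIdeals K = (ratPrincipal K).range := by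
  refine le_antisymm ?_ (le_inf ?_ range_ratPrincipal_le)
  · rintro I ⟨hI, hA⟩
    exact mem_range_ratPrincipal (unitsAbsNorm_pos I) ((mem_ambiguousIdeals_iff hdeg).mp hA)
      fun p hp hpD ↦ normParity_eq_one_iff.mp hI p (hsD p hp hpD)
  · rintro _ ⟨q, rfl⟩
    refine normParity_eq_one_iff.mpr fun p hp ↦ ?_
    have : Fact p.Prime := ⟨hs p hp⟩
    rw [unitsAbsNorm_ratPrincipal hdeg, padicValRat.pow]
    exact even_two.mul_right _

theorem map_normParity_eq_top (hdeg : Module.finrank ℚ K = 2) {s : Finset ℕ}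
    {hs : ∀ p ∈ s, p.Prime} (hsD : ∀ p ∈ s, (p : ℤ) ∣ discr K) :
    (ambiguousIdeals K).map (normParity K s hs) = ⊤ := by
  rw [eq_top_iff]
  intro x _
  refine Subgroup.pi_mem_of_mulSingle_mem x fun p ↦ ?_
  have hp := hs p p.2
  have : Fact (p : ℕ).Prime := ⟨hp⟩
  have hx : x p = 1 ∨ x p = Multiplicative.ofAdd 1 := by
    generalize x p = y
    revert y
    decide
  rcases hx with hx | hx
  · rw [hx, Pi.mulSingle_one]
    exact one_mem _
  obtain ⟨P, hP, hPp⟩ := exists_sq_eq_span hdeg hp (hsD p p.2)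
  have hP0 : P ∈ (Ideal (𝓞 K))⁰ := by
    rw [mem_nonZeroDivisors_iff_ne_zero]
    rintro rfl
    rw [Submodule.zero_eq_bot, Ideal.absNorm_bot] at hPp
    exact hp.ne_zero hPp.symm
  have hp0 : ((p : ℕ) : ℚ) ≠ 0 := by exact_mod_cast hp.ne_zero
  have hnorm : (unitsAbsNorm K (FractionalIdeal.mk0 K ⟨P, hP0⟩) : ℚ) = (p : ℕ) := by
    simp [unitsAbsNorm, FractionalIdeal.coeIdeal_absNorm, hPp]
  refine ⟨FractionalIdeal.mk0 K ⟨P, hP0⟩, ⟨Units.mk0 (p : ℕ) hp0, ?_⟩, ?_⟩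
  · ext1
    rw [coe_ratPrincipal, powMonoidHom_apply, Units.val_pow_eq_pow_val, FractionalIdeal.coe_mk0,
      ← FractionalIdeal.coeIdeal_pow, hP, FractionalIdeal.coeIdeal_span_singleton]
    simp
  · funext r
    change Multiplicative.ofAdd (padicValRat r (unitsAbsNorm K _) : ZMod 2) = _
    have hr := hs r r.2
    rw [hnorm, padicValRat.of_nat]
    rcases eq_or_ne r p with rfl | hrp
    · rw [Pi.mulSingle_eq_same, hx, padicValNat_self]
      rfl
    · have hrp' : ¬ (r : ℕ) ∣ p := fun h ↦
        hrp (Subtype.ext ((Nat.prime_dvd_prime_iff_eq hr hp).mp h))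
      rw [Pi.mulSingle_eq_of_ne hrp, padicValNat.eq_zero_of_not_dvd hrp']
      rfl

theorem relIndex_range_ratPrincipal (hdeg : Module.finrank ℚ K = 2) :
    (ratPrincipal K).range.relIndex (ambiguousIdeals K) =
      2 ^ (discr K).natAbs.primeFactors.card := by
  have hs : ∀ p ∈ (discr K).natAbs.primeFactors, p.Prime := fun p ↦ Nat.prime_of_mem_primeFactors
  rw [← ker_normParity_inf hdeg (hs := hs) fun p hp hpD ↦ Nat.mem_primeFactors.mpr
      ⟨hp, Int.natCast_dvd.mp hpD, Int.natAbs_ne_zero.mpr (discr_ne_zero K)⟩,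
    Subgroup.inf_relIndex_right, Subgroup.relIndex_ker,
    map_normParity_eq_top hdeg fun p hp ↦ Int.natCast_dvd.mpr (Nat.dvd_of_mem_primeFactors hp),
    Subgroup.card_top, Nat.card_fun, Nat.card_eq_fintype_card, Nat.card_eq_fintype_card,
    Fintype.card_coe, Fintype.card_multiplicative, ZMod.card]

end

section

variable {K : Type} [Field K] [NumberField K]

/-- The basic properties of the nontrivial automorphism of an imaginary quadratic field, on
units. -/
theorem exists_units_conj (hdeg : Module.finrank ℚ K = 2) (hneg : discr K < 0) :
    ∃ σ : Kˣ →* Kˣ,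
      (∀ x, x * σ x = Units.map (algebraMap ℚ K) (Units.map (Algebra.norm ℚ) x)) ∧
      (∀ x : Kˣ, 0 < Algebra.norm ℚ (x : K)) ∧
      (∀ x : Kˣ, Algebra.norm ℚ (x : K) = 1 → ∃ y, y / σ y = x) ∧
      (∀ x, σ x = x ↔ x ∈ (Units.map (algebraMap ℚ K : ℚ →* K)).range) := by
  obtain ⟨σ, h1, h2, h3, h4⟩ := exists_conj hdeg hneg
  refine ⟨Units.map (σ : K →* K), fun x ↦ Units.ext (h1 x), fun x ↦ h2 x x.ne_zero,
    fun x hx ↦ ?_, fun x ↦ ⟨fun hx ↦ ?_, ?_⟩⟩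
  · obtain ⟨y, hy⟩ := h3 x hx
    exact ⟨y, Units.ext (by rw [Units.val_div_eq_div_val, ← hy]; rfl)⟩
  · obtain ⟨q, hq⟩ := h4 x (congrArg Units.val hx)
    have hq0 : q ≠ 0 := by
      rintro rfl
      exact x.ne_zero (by rw [← hq, map_zero])
    exact ⟨Units.mk0 q hq0, Units.ext hq⟩
  · rintro ⟨q, rfl⟩
    exact Units.ext (σ.commutes q)

theorem toPrincipalIdeal_eq_one_iff {x : Kˣ} :
    toPrincipalIdeal (𝓞 K) K x = 1 ↔ x ∈ (Units.map (algebraMap (𝓞 K) K : 𝓞 K →* K)).range := by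
  have hle : ∀ y : Kˣ, toPrincipalIdeal (𝓞 K) K y = 1 → ∃ a : 𝓞 K, algebraMap (𝓞 K) K a = y := by
    intro y hy
    rw [← FractionalIdeal.mem_one_iff (𝓞 K)⁰, ← Units.val_one, ← hy, coe_toPrincipalIdeal]
    exact FractionalIdeal.mem_spanSingleton_self _ _
  constructor
  · intro hx
    obtain ⟨a, ha⟩ := hle x hx
    obtain ⟨b, hb⟩ := hle x⁻¹ (by rw [map_inv, hx, inv_one])
    have hab : a * b = 1 := by
      apply RingOfIntegers.coe_injective
      rw [map_mul, ha, hb, map_one, Units.mul_inv]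
    exact ⟨⟨a, b, hab, by rw [mul_comm, hab]⟩, Units.ext ha⟩
  · rintro ⟨u, rfl⟩
    rw [toPrincipalIdeal_eq_iff, Units.val_one, Units.coe_map, MonoidHom.coe_coe,
      ← FractionalIdeal.coeIdeal_span_singleton, Ideal.span_singleton_eq_top.mpr u.isUnit,
      FractionalIdeal.coeIdeal_top]

/-- The principal ambiguous ideals modulo the rational ones form a group of order two. -/
theorem relIndex_principal_ambiguous (hdeg : Module.finrank ℚ K = 2) (hneg : discr K < 0) :
    (ratPrincipal K).range.relIndex ((toPrincipalIdeal (𝓞 K) K).range ⊓ ambiguousIdeals K) = 2 := by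
  obtain ⟨σ, hσ, hpos, h90, hfix⟩ := exists_units_conj hdeg hneg
  set δ : Kˣ →* Kˣ := MonoidHom.id Kˣ / σ
  set j : (𝓞 K)ˣ →* Kˣ := Units.map (algebraMap (𝓞 K) K : 𝓞 K →* K) with hj
  have hδx (x : Kˣ) : δ x = x / σ x := rfl
  have hunits (u : Kˣ) (hu : u ∈ j.range) : Algebra.norm ℚ (u : K) = 1 := by
    rw [hj, ← toPrincipalIdeal_eq_one_iff] at hu
    rw [← abs_of_pos (hpos u), ← unitsAbsNorm_toPrincipalIdeal, hu, map_one, Units.val_one]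
  have hδu (u : Kˣ) (hu : u ∈ j.range) : δ u = u ^ 2 := by
    have h : u * σ u = 1 := by
      rw [hσ, ← map_one (Units.map (algebraMap ℚ K : ℚ →* K))]
      congr 1
      exact Units.ext (hunits u hu)
    rw [hδx, eq_inv_of_mul_eq_one_right h, div_inv_eq_mul, sq]
  have hA : (ambiguousIdeals K).comap (toPrincipalIdeal (𝓞 K) K) = j.range.comap δ := by
    ext x
    have hN : unitsAbsNorm K (toPrincipalIdeal (𝓞 K) K x) = Units.map (Algebra.norm ℚ) x :=
      Units.ext (by rw [unitsAbsNorm_toPrincipalIdeal, abs_of_pos (hpos x)]; rfl)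
    rw [Subgroup.mem_comap, Subgroup.mem_comap, mem_ambiguousIdeals_iff hdeg, hN, ratPrincipal,
      MonoidHom.comp_apply, ← hσ, ← div_eq_one, ← map_pow, ← map_div, toPrincipalIdeal_eq_one_iff,
      sq, mul_div_mul_left_eq_div, hδx]
  have hQ : (ratPrincipal K).range.comap (toPrincipalIdeal (𝓞 K) K) =
      (j.range.map (powMonoidHom 2)).comap δ := by
    ext x
    constructor
    · rintro ⟨q, hq⟩
      rw [ratPrincipal, MonoidHom.comp_apply, eq_comm, ← div_eq_one, ← map_div,
        toPrincipalIdeal_eq_one_iff] at hq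
      refine ⟨_, hq, ?_⟩
      rw [powMonoidHom_apply, ← hδu _ hq, map_div, div_eq_self, hδx, div_eq_one, eq_comm, hfix]
      exact ⟨q, rfl⟩
    · rintro ⟨u, hu, hux⟩
      rw [powMonoidHom_apply, ← hδu u hu, eq_comm, ← div_eq_one, ← map_div, hδx, div_eq_one,
        eq_comm, hfix] at hux
      obtain ⟨q, hq⟩ := hux
      refine ⟨q, ?_⟩
      rw [ratPrincipal, MonoidHom.comp_apply, hq, map_div, toPrincipalIdeal_eq_one_iff.mpr hu,
        div_one]
  have hle : j.range ≤ δ.range := fun u hu ↦ h90 u (hunits u hu)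
  have hjinj : Function.Injective j := Units.map_injective RingOfIntegers.coe_injective
  rw [← Subgroup.map_comap_eq, ← Subgroup.relIndex_comap, hA, hQ, Subgroup.relIndex_comap,
    Subgroup.map_comap_eq, inf_eq_right.mpr hle]
  have : j.range.map (powMonoidHom 2) = (powMonoidHom 2 : (𝓞 K)ˣ →* (𝓞 K)ˣ).range.map j := by
    rw [MonoidHom.map_range, MonoidHom.map_range]
    congr 1
  rw [this, MonoidHom.range_eq_map j, Subgroup.relIndex_map_map_of_injective _ _ hjinj,
    Subgroup.relIndex_top_right, index_units_sq hdeg hneg]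

theorem ker_classGroup_mk : (ClassGroup.mk K).ker = (toPrincipalIdeal (𝓞 K) K).range := by
  ext I
  rw [MonoidHom.mem_ker, ClassGroup.mk_eq_one_iff, mem_principal_ideals_iff,
    FractionalIdeal.isPrincipal_iff]
  simp only [eq_comm]

theorem map_mk_ambiguousIdeals (hdeg : Module.finrank ℚ K = 2) (hneg : discr K < 0) :
    (ambiguousIdeals K).map (ClassGroup.mk K) =
      (powMonoidHom 2 : ClassGroup (𝓞 K) →* ClassGroup (𝓞 K)).ker := by
  apply le_antisymm
  · rintro _ ⟨I, ⟨q, hq⟩, rfl⟩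
    rw [MonoidHom.mem_ker, powMonoidHom_apply, ← map_pow, ← MonoidHom.mem_ker, ker_classGroup_mk]
    exact ⟨_, hq⟩
  · intro c hc
    obtain ⟨J', rfl⟩ := ClassGroup.mk0_surjective c
    rw [← ClassGroup.mk_mk0 K] at hc ⊢
    generalize FractionalIdeal.mk0 K J' = J at hc ⊢
    rw [MonoidHom.mem_ker, powMonoidHom_apply, ← map_pow, ← MonoidHom.mem_ker,
      ker_classGroup_mk] at hc
    obtain ⟨g, hg⟩ := hc
    obtain ⟨σ, hσ, hpos, h90, hfix⟩ := exists_units_conj hdeg hneg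
    have hnorm : Algebra.norm ℚ (g : K) = (unitsAbsNorm K J : ℚ) ^ 2 := by
      rw [← abs_of_pos (hpos g), ← unitsAbsNorm_toPrincipalIdeal, hg, map_pow,
        Units.val_pow_eq_pow_val]
    have hone : Units.map (Algebra.norm ℚ)
        (g / Units.map (algebraMap ℚ K) (unitsAbsNorm K J)) = 1 := by
      rw [map_div, div_eq_one]
      ext1
      rw [Units.coe_map, Units.coe_map, Units.coe_map, MonoidHom.coe_coe, Algebra.norm_algebraMap,
        hdeg, hnorm]
    obtain ⟨y, hy⟩ := h90 _ (congrArg Units.val hone)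
    refine ⟨J * (toPrincipalIdeal (𝓞 K) K y)⁻¹,
      ⟨unitsAbsNorm K J / Units.map (Algebra.norm ℚ) y, ?_⟩, ?_⟩
    · rw [powMonoidHom_apply, mul_pow, ← hg, inv_pow, ← map_pow, ← map_inv, ← map_mul,
        ratPrincipal, MonoidHom.comp_apply, map_div, ← hσ]
      congr 1
      rw [div_eq_div_iff_mul_eq_mul] at hy
      rw [div_eq_iff_eq_mul, mul_comm, ← mul_assoc, eq_mul_inv_iff_mul_eq, mul_assoc,
        mul_comm (σ y), ← hy, ← mul_assoc, ← sq, mul_comm]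
    · rw [map_mul, map_inv, mul_eq_left, inv_eq_one, ← MonoidHom.mem_ker, ker_classGroup_mk]
      exact ⟨y, rfl⟩

theorem card_ker_pow_two (hdeg : Module.finrank ℚ K = 2) (hneg : discr K < 0) :
    2 * Nat.card (powMonoidHom 2 : ClassGroup (𝓞 K) →* ClassGroup (𝓞 K)).ker =
      2 ^ (discr K).natAbs.primeFactors.card := by
  have hle : (ratPrincipal K).range ≤ (toPrincipalIdeal (𝓞 K) K).range := by
    rintro _ ⟨q, rfl⟩
    exact ⟨_, rfl⟩
  rw [← relIndex_range_ratPrincipal hdeg, ← Subgroup.relIndex_mul_relIndex _ _ _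
      (le_inf hle range_ratPrincipal_le) inf_le_right, relIndex_principal_ambiguous hdeg hneg,
    Subgroup.inf_relIndex_right, ← ker_classGroup_mk, Subgroup.relIndex_ker,
    map_mk_ambiguousIdeals hdeg hneg]

end

/-- (Genus theory) Let `D < 0` be a fundamental discriminant and `K = ℚ(√D)`. Then the
quotient `Cl(D)/Cl(D)²` of the class group by its subgroup of squares is an elementary
abelian 2-group of order `2^{ω(D) − 1}`; i.e. the 2-rank of `Cl(D)` is `ω(D) − 1`. -/
theorem two_rank_classGroup
    (D : ℤ) (hfund : IsFundamentalDiscriminant D) (hneg : D < 0)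
    (K : Type) [Field K] [NumberField K]
    (hdeg : Module.finrank ℚ K = 2) (hdisc : NumberField.discr K = D) :
    (∀ x : ClassGroup (𝓞 K) ⧸ (powMonoidHom 2 : ClassGroup (𝓞 K) →* ClassGroup (𝓞 K)).range,
        x ^ 2 = 1) ∧
    Nat.card
        (ClassGroup (𝓞 K) ⧸ (powMonoidHom 2 : ClassGroup (𝓞 K) →* ClassGroup (𝓞 K)).range)
      = 2 ^ (D.natAbs.primeFactors.card - 1) := by
  subst hdisc
  refine ⟨fun x ↦ ?_, ?_⟩
  · induction x using QuotientGroup.induction_on with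
    | H c => exact (QuotientGroup.eq_one_iff _).mpr ⟨c, rfl⟩
  · have h := card_ker_pow_two hdeg hneg
    rw [← Subgroup.index, Subgroup.index_range]
    cases hn : (discr K).natAbs.primeFactors.card with
    | zero => rw [hn] at h; omega
    | succ n => rw [hn, pow_succ'] at h; exact Nat.eq_of_mul_eq_mul_left two_pos h
end
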